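/- arXiv:1811.09723 — 2 statements merged into one kernel-verified Lean document; each statement's English description precedes it below -/
import Mathlib

section
/- Suppose triangle ABC is N-tiled by a tile with angles (α, β, γ) where γ > π/2, and let PQ be a side of ABC. If no tile having an edge contained in PQ has its side of length c contained in PQ, then some tile of the tiling has its γ angle at P or at Q. -/
open EuclideanGeometry Real

noncomputable section

/-- A point of the Euclidean plane. -/
abbrev Pt : Type := EuclideanSpace ℝ (Fin 2)

/-- A triangle, given by its three vertices. -/
abbrev Tri : Type := Fin 3 → Pt

/-- A genuine (nondegenerate) triangle. -/
def IsTriangle (T : Tri) : Prop := AffineIndependent ℝ T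

/-- The closed triangle (convex hull of the vertices). -/
def triSet (T : Tri) : Set Pt := convexHull ℝ (Set.range T)

/-- Two triangles are congruent iff corresponding distances agree
up to a permutation of the vertices. -/
def CongruentTri (T₁ T₂ : Tri) : Prop :=
  ∃ σ : Equiv.Perm (Fin 3), ∀ i j : Fin 3, dist (T₁ i) (T₁ j) = dist (T₂ (σ i)) (T₂ (σ j))

/-- An `N`-tiling of the triangle `ABC` by the tile `T`: a family of `N` triangles,
each congruent to `T`, with pairwise disjoint interiors, whose union is the
closed triangle `ABC`. -/
structure IsTiling (N : ℕ) (ABC T : Tri) (tiles : Fin N → Tri) : Prop where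
  congr : ∀ i, CongruentTri (tiles i) T
  disj : ∀ i j, i ≠ j → interior (triSet (tiles i)) ∩ interior (triSet (tiles j)) = ∅
  cover : (⋃ i, triSet (tiles i)) = triSet ABC

/-- The interior angle of the triangle `T` at its `k`-th vertex. -/
def triAngle (T : Tri) (k : Fin 3) : ℝ := ∠ (T (k + 1)) (T k) (T (k + 2))

/-- The side of `T` opposite to the `k`-th vertex. -/
def sideLen (T : Tri) (k : Fin 3) : ℝ := dist (T (k + 1)) (T (k + 2))

/-- `T` has angles `α`, `β`, `γ` (at vertices `0`, `1`, `2`, which are opposite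
the sides of lengths `a`, `b`, `c` respectively). -/
def HasAngles (T : Tri) (α β γ : ℝ) : Prop :=
  triAngle T 0 = α ∧ triAngle T 1 = β ∧ triAngle T 2 = γ

/-- Two triangles are similar iff corresponding distances agree up to a
permutation of the vertices and a positive scale factor. -/
def SimilarTri (T₁ T₂ : Tri) : Prop :=
  ∃ r : ℝ, 0 < r ∧ ∃ σ : Equiv.Perm (Fin 3),
    ∀ i j : Fin 3, dist (T₁ i) (T₁ j) = r * dist (T₂ (σ i)) (T₂ (σ j))

lemma angle_perm (T : Tri) (a b : Fin 3) (ha : a ≠ 2) (hb : b ≠ 2) (hab : a ≠ b) :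
    ∠ (T a) (T 2) (T b) = triAngle T 2 := by
  have : (a = 0 ∧ b = 1) ∨ (a = 1 ∧ b = 0) := by omega
  rcases this with ⟨rfl, rfl⟩ | ⟨rfl, rfl⟩
  · rfl
  · rw [EuclideanGeometry.angle_comm]; rfl

lemma dist_perm (T : Tri) (a b : Fin 3) (ha : a ≠ 2) (hb : b ≠ 2) (hab : a ≠ b) :
    dist (T a) (T b) = sideLen T 2 := by
  have : (a = 0 ∧ b = 1) ∨ (a = 1 ∧ b = 0) := by omega
  rcases this with ⟨rfl, rfl⟩ | ⟨rfl, rfl⟩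
  · rfl
  · rw [dist_comm]; rfl

lemma tile_facts (S T : Tri) (h : CongruentTri S T) (hT : IsTriangle T) (γ : ℝ)
    (hγ : triAngle T 2 = γ) (hg : π / 2 < γ) :
    IsTriangle S ∧ ∃ m : Fin 3, triAngle S m = γ ∧
      ∀ k l : Fin 3, k ≠ m → l ≠ m → k ≠ l →
        dist (S k) (S l) = sideLen T 2 ∧ inner ℝ (S k - S m) (S l - S m) < 0 := by
  obtain ⟨σ, hσ⟩ := h
  have hcong : Congruent S (T ∘ σ) := by
    rw [congruent_iff_dist_eq]; exact hσ
  obtain ⟨m, hm⟩ := σ.surjective 2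
  have hne : ∀ k, k ≠ m → σ k ≠ 2 := by
    intro k hk h; exact hk (σ.injective (h.trans hm.symm))
  have hang : ∀ k l : Fin 3, k ≠ m → l ≠ m → k ≠ l → ∠ (S k) (S m) (S l) = γ := by
    intro k l hk hl hkl
    rw [angle_eq_of_congruent hcong k m l, ← hγ,
      ← angle_perm T (σ k) (σ l) (hne k hk) (hne l hl) (fun h => hkl (σ.injective h))]
    simp [hm]
  have h1 : m + 1 ≠ m := by fin_cases m <;> decide
  have h2 : m + 2 ≠ m := by fin_cases m <;> decide
  have h12 : m + 1 ≠ m + 2 := by fin_cases m <;> decide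
  have htri : IsTriangle S := by
    unfold IsTriangle at *
    have hTi := hT.injective
    rw [affineIndependent_iff_not_collinear_of_ne h1 h12 h2.symm]
    rw [affineIndependent_iff_not_collinear_of_ne (i₁ := σ (m+1)) (i₂ := σ m) (i₃ := σ (m+2))
      (fun h => h1 (σ.injective h)) (fun h => h12 (σ.injective h))
      (fun h => h2 (σ.injective h).symm)] at hT
    rw [EuclideanGeometry.collinear_iff_eq_or_eq_or_angle_eq_zero_or_angle_eq_pi] at *
    rw [angle_eq_of_congruent hcong]
    have hd : ∀ i j, S i = S j ↔ T (σ i) = T (σ j) := by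
      intro i j; rw [← dist_eq_zero, hσ, dist_eq_zero]
    rw [hd, hd]
    exact hT
  refine ⟨htri, m, hang _ _ h1 h2 h12, ?_⟩
  intro k l hk hl hkl
  refine ⟨?_, ?_⟩
  · rw [hσ]; exact dist_perm T _ _ (hne k hk) (hne l hl) (fun h => hkl (σ.injective h))
  · have ha := hang k l hk hl hkl
    have hi := htri.injective
    have e1 : S k - S m ≠ 0 := sub_ne_zero.2 (fun h => hk (hi h))
    have e2 : S l - S m ≠ 0 := sub_ne_zero.2 (fun h => hl (hi h))
    rw [← InnerProductGeometry.cos_angle_mul_norm_mul_norm]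
    have : cos (InnerProductGeometry.angle (S k - S m) (S l - S m)) < 0 := by
      apply Real.cos_neg_of_pi_div_two_lt_of_lt
      · have : InnerProductGeometry.angle (S k - S m) (S l - S m) = γ := ha
        rw [this]; exact hg
      · have := InnerProductGeometry.angle_le_pi (S k - S m) (S l - S m)
        linarith [Real.pi_pos]
    have := norm_pos_iff.2 e1
    have := norm_pos_iff.2 e2
    exact mul_neg_of_neg_of_pos ‹_› (by positivity)

lemma mem_triSet (T : Tri) (k l m : Fin 3) (hkl : k ≠ l) (hkm : k ≠ m) (hlm : l ≠ m) (z : Pt)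
    (hz : z ∈ triSet T) : ∃ a b c : ℝ, 0 ≤ a ∧ 0 ≤ b ∧ 0 ≤ c ∧ a + b + c = 1 ∧
      z = a • T k + b • T l + c • T m := by
  have hr : Set.range T = {T k, T l, T m} := by
    ext x
    simp only [Set.mem_range, Set.mem_insert_iff, Set.mem_singleton_iff]
    constructor
    · rintro ⟨y, rfl⟩
      have : y = k ∨ y = l ∨ y = m := by omega
      rcases this with rfl | rfl | rfl <;> simp
    · rintro (rfl | rfl | rfl) <;> exact ⟨_, rfl⟩
  rw [triSet, hr, convexHull_insert (by simp)] at hz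
  simp only [convexHull_pair, mem_convexJoin, Set.mem_singleton_iff, exists_eq_left] at hz
  obtain ⟨y, ⟨c, d, hc, hd, hcd, rfl⟩, ⟨a, b, ha, hb, hab, rfl⟩⟩ := hz
  refine ⟨a, b * c, b * d, ha, by positivity, by positivity, ?_, ?_⟩
  · rw [add_assoc, ← mul_add, hcd, mul_one, hab]
  · module

lemma mem_interior_tri (T : Tri) (hT : IsTriangle T) (k l m : Fin 3) (hkl : k ≠ l) (hkm : k ≠ m)
    (hlm : l ≠ m) (a b c : ℝ) (ha : 0 < a) (hb : 0 < b) (hc : 0 < c) (h : a + b + c = 1) :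
    a • T k + b • T l + c • T m ∈ interior (triSet T) := by
  have htop : affineSpan ℝ (Set.range T) = ⊤ := by
    rw [AffineIndependent.affineSpan_eq_top_iff_card_eq_finrank_add_one hT]; simp
  let B : AffineBasis (Fin 3) ℝ Pt := ⟨T, hT, htop⟩
  have hB : ∀ i, B i = T i := fun i => rfl
  have hI := B.interior_convexHull
  have : triSet T = convexHull ℝ (Set.range B) := rfl
  rw [this, hI]
  let w : Fin 3 → ℝ := fun i => if i = k then a else if i = l then b else c
  have huniv : (Finset.univ : Finset (Fin 3)) = {k, l, m} := by
    ext x; simp; omega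
  have wk : w k = a := by simp [w]
  have wl : w l = b := by simp [w, hkl.symm]
  have wm : w m = c := by simp [w, hkm.symm, hlm.symm]
  have hw : ∑ i, w i = 1 := by
    rw [huniv, Finset.sum_insert (by simp [hkl, hkm]), Finset.sum_insert (by simp [hlm]),
      Finset.sum_singleton, wk, wl, wm]; linarith
  have hz : a • T k + b • T l + c • T m = Finset.univ.affineCombination ℝ B w := by
    rw [Finset.affineCombination_eq_linear_combination _ _ _ hw]
    rw [huniv, Finset.sum_insert (by simp [hkl, hkm]), Finset.sum_insert (by simp [hlm]),
      Finset.sum_singleton, wk, wl, wm]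
    simp only [hB]; abel
  intro i
  rw [hz, B.coord_apply_combination_of_mem (Finset.mem_univ i) hw]
  simp only [w]; split_ifs <;> assumption

lemma frame (P Q R : Pt) (h : ¬ Collinear ℝ {P, Q, R}) :
    ∃ n : Pt, inner ℝ n (Q - P) = 0 ∧ 0 < inner ℝ n (R - P) ∧
      ∀ w : Pt, ∃ a b : ℝ, w = a • (Q - P) + b • n := by
  have hQ : Q - P ≠ 0 := by
    intro h0; apply h; rw [sub_eq_zero] at h0; subst h0; simpa using collinear_pair ℝ Q R
  set u := Q - P with hu
  set t := inner ℝ u (R - P) / inner ℝ u u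
  have huu : inner ℝ u u ≠ (0 : ℝ) := by simpa using hQ
  set n := (R - P) - t • u with hn
  have hn0 : n ≠ 0 := by
    intro h0; apply h
    rw [collinear_iff_of_mem (p₀ := P) (by simp)]
    refine ⟨u, ?_⟩
    intro p hp
    simp only [Set.mem_insert_iff, Set.mem_singleton_iff] at hp
    rcases hp with rfl | rfl | rfl
    · exact ⟨0, by simp⟩
    · exact ⟨1, by simp [hu]⟩
    · refine ⟨t, ?_⟩
      have : p - P = t • u := by rw [hn, sub_eq_zero] at h0; exact h0
      rw [← this]; simp
  have hnu : inner ℝ n u = 0 := by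
    rw [hn, inner_sub_left, inner_smul_left, real_inner_comm]
    simp only [t]; simp; field_simp; simp
  refine ⟨n, hnu, ?_, ?_⟩
  · have : R - P = n + t • u := by simp [hn]
    rw [this, inner_add_right, inner_smul_right, hnu]
    have := norm_pos_iff.2 hn0
    simp; positivity
  · intro w
    have hli : LinearIndependent ℝ ![u, n] := by
      apply linearIndependent_of_ne_zero_of_inner_eq_zero (𝕜 := ℝ)
      · intro i; fin_cases i <;> simp [hQ, hn0]
      · intro i j hij
        fin_cases i <;> fin_cases j <;> simp_all [real_inner_comm]
    have hs := hli.span_eq_top_of_card_eq_finrank' (by simp)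
    have hw : w ∈ Submodule.span ℝ (Set.range ![u, n]) := by rw [hs]; trivial
    rw [Matrix.range_cons_cons_empty, Submodule.mem_span_pair] at hw
    obtain ⟨a, b, h⟩ := hw
    exact ⟨a, b, h.symm⟩

lemma frame' (P Q R : Pt) (h : ¬ Collinear ℝ {P, Q, R}) :
    ∃ (n : Pt) (f g : Pt → ℝ), inner ℝ n (Q - P) = 0 ∧ 0 < g R ∧
      (∀ z, z = P + f z • (Q - P) + g z • n) ∧
      (∀ a b : ℝ, f (P + a • (Q - P) + b • n) = a ∧ g (P + a • (Q - P) + b • n) = b) := by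
  obtain ⟨n, hn, hR, hd⟩ := frame P Q R h
  have hQ : Q - P ≠ 0 := by
    intro h0; apply h; rw [sub_eq_zero] at h0; subst h0; simpa using collinear_pair ℝ Q R
  have hn0 : n ≠ 0 := by rintro rfl; simp at hR
  have hn' : inner ℝ (Q - P) n = 0 := by rw [real_inner_comm]; exact hn
  have h1 : 0 < inner ℝ (Q - P) (Q - P) := real_inner_self_pos.2 hQ
  have h2 : 0 < inner ℝ n n := real_inner_self_pos.2 hn0
  have key : ∀ a b : ℝ,
      inner ℝ (Q - P) (P + a • (Q - P) + b • n - P) / inner ℝ (Q - P) (Q - P) = a ∧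
      inner ℝ n (P + a • (Q - P) + b • n - P) / inner ℝ n n = b := by
    intro a b
    have : P + a • (Q - P) + b • n - P = a • (Q - P) + b • n := by abel
    rw [this, inner_add_right, inner_add_right, inner_smul_right, inner_smul_right,
      inner_smul_right, inner_smul_right, hn, hn']
    constructor
    · rw [mul_zero, add_zero, mul_div_assoc, div_self h1.ne', mul_one]
    · rw [mul_zero, zero_add, mul_div_assoc, div_self h2.ne', mul_one]
  refine ⟨n, fun z => inner ℝ (Q - P) (z - P) / inner ℝ (Q - P) (Q - P),
    fun z => inner ℝ n (z - P) / inner ℝ n n, hn, by positivity, ?_, key⟩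
  intro z
  obtain ⟨a, b, hab⟩ := hd (z - P)
  have hz : z = P + a • (Q - P) + b • n := by rw [add_assoc, ← hab]; abel
  have := key a b
  rw [← hz] at this
  beta_reduce
  rw [this.1, this.2]; exact hz

lemma near_interior (S : Tri) (hS : IsTriangle S) (k l m : Fin 3) (hkl : k ≠ l) (hkm : k ≠ m)
    (hlm : l ≠ m) (P u n : Pt) (p q τ t h e : ℝ) (hk : S k = P + p • u) (hl : S l = P + q • u)
    (hm : S m = P + τ • u + (h * (q - p)) • u + e • n) (he : 0 < e)
    (ht0 : 0 ≤ t) (ht1 : t < 1) (hτ : τ = p + t * (q - p)) (hh : 0 < t ∨ h < 0) :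
    ∀ᶠ ε in nhdsWithin (0 : ℝ) (Set.Ioi 0), P + τ • u + ε • n ∈ interior (triSet S) := by
  have hA : ∀ᶠ ε in nhdsWithin (0 : ℝ) (Set.Ioi 0),
      0 < (1 - t) * (1 - ε / e) + ε / e * h := by
    apply Filter.Eventually.filter_mono nhdsWithin_le_nhds
    have hc : Continuous (fun ε : ℝ => (1 - t) * (1 - ε / e) + ε / e * h) := by fun_prop
    exact hc.continuousAt.eventually (lt_mem_nhds (by simp; linarith))
  have hB : ∀ᶠ ε in nhdsWithin (0 : ℝ) (Set.Ioi 0),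
      0 < t * (1 - ε / e) - ε / e * h := by
    rcases ht0.lt_or_eq with ht | ht
    · apply Filter.Eventually.filter_mono nhdsWithin_le_nhds
      have hc : Continuous (fun ε : ℝ => t * (1 - ε / e) - ε / e * h) := by fun_prop
      exact hc.continuousAt.eventually (lt_mem_nhds (by simp; linarith))
    · have hh' : h < 0 := by
        rcases hh with hh | hh
        · linarith
        · exact hh
      filter_upwards [self_mem_nhdsWithin] with ε hε
      have hε : 0 < ε := hε
      have : 0 < ε / e := by positivity
      rw [← ht]; nlinarith
  filter_upwards [hA, hB, self_mem_nhdsWithin] with ε h1 h2 hε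
  have hε : 0 < ε := hε
  have h3 : 0 < ε / e := by positivity
  have := mem_interior_tri S hS k l m hkl hkm hlm _ _ _ h1 h2 h3 (by ring)
  convert this using 1
  rw [hk, hl, hm, hτ]
  have h4 : ε = ε / e * e := by field_simp
  generalize ε / e = s at *
  subst h4
  module

lemma edge_exists (S : Tri) (hS : IsTriangle S) (P u n : Pt) (f g : Pt → ℝ)
    (hz : ∀ z, z = P + f z • u + g z • n)
    (hfg : ∀ a b : ℝ, f (P + a • u + b • n) = a ∧ g (P + a • u + b • n) = b)
    (hpos : ∀ j, 0 ≤ g (S j)) (τ τ' : ℝ) (hτ : τ < τ')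
    (hx : P + τ • u ∈ triSet S) (hy : P + τ' • u ∈ triSet S) :
    ∃ k l m : Fin 3, k ≠ l ∧ k ≠ m ∧ l ≠ m ∧ S k = P + f (S k) • u ∧ S l = P + f (S l) • u ∧
      0 < g (S m) ∧ f (S k) ≤ τ ∧ τ < f (S l) := by
  obtain ⟨m, hm⟩ : ∃ m, 0 < g (S m) := by
    by_contra! hcon
    rw [IsTriangle, affineIndependent_iff_not_collinear] at hS
    apply hS
    rw [collinear_iff_exists_forall_eq_smul_vadd]
    refine ⟨P, u, ?_⟩
    rintro _ ⟨j, rfl⟩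
    refine ⟨f (S j), ?_⟩
    have h0 : g (S j) = 0 := le_antisymm (hcon j) (hpos j)
    have := hz (S j)
    rw [h0] at this
    rw [vadd_eq_add, add_comm]
    simpa using this
  have hcomb : ∀ (k l : Fin 3), k ≠ l → k ≠ m → l ≠ m → ∀ σ : ℝ, P + σ • u ∈ triSet S →
      ∃ a b : ℝ, 0 ≤ a ∧ 0 ≤ b ∧ a + b = 1 ∧ σ = a * f (S k) + b * f (S l) ∧
        a * g (S k) = 0 ∧ b * g (S l) = 0 := by
    intro k l hkl hkm hlm σ hσ
    obtain ⟨a, b, c, ha, hb, hc, habc, he⟩ := mem_triSet S k l m hkl hkm hlm _ hσ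
    have e1 : a • S k + b • S l + c • S m =
        P + (a * f (S k) + b * f (S l) + c * f (S m)) • u +
          (a * g (S k) + b * g (S l) + c * g (S m)) • n := by
      have hc' : c = 1 - a - b := by linarith
      conv_lhs => rw [hz (S k), hz (S l), hz (S m)]
      rw [hc']; module
    have h1 := hfg σ 0
    have h2 := hfg (a * f (S k) + b * f (S l) + c * f (S m))
      (a * g (S k) + b * g (S l) + c * g (S m))
    rw [← e1, ← he] at h2
    rw [zero_smul, add_zero] at h1
    have hf := h1.1.symm.trans h2.1
    have hg := h1.2.symm.trans h2.2
    have p1 := mul_nonneg ha (hpos k)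
    have p2 := mul_nonneg hb (hpos l)
    have p3 := mul_nonneg hc hm.le
    have hc0 : c * g (S m) = 0 := by linarith
    have hc1 : c = 0 := by
      rcases mul_eq_zero.1 hc0 with h | h
      · exact h
      · linarith
    subst hc1
    exact ⟨a, b, ha, hb, by linarith, by linarith, by linarith, by linarith⟩
  have main : ∀ (k l : Fin 3), k ≠ l → k ≠ m → l ≠ m → f (S k) ≤ f (S l) →
      g (S k) = 0 ∧ g (S l) = 0 ∧ f (S k) ≤ τ ∧ τ < f (S l) := by
    intro k l hkl hkm hlm hle
    obtain ⟨a, b, ha, hb, hab, e1, e2, e3⟩ := hcomb k l hkl hkm hlm _ hx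
    obtain ⟨a', b', ha', hb', hab', e1', e2', e3'⟩ := hcomb k l hkl hkm hlm _ hy
    have hb1 : b = 1 - a := by linarith
    have hb1' : b' = 1 - a' := by linarith
    subst hb1 hb1'
    have hgk : g (S k) = 0 := by
      by_contra hne
      have h1 : a = 0 := (mul_eq_zero.1 e2).resolve_right hne
      have h2 : a' = 0 := (mul_eq_zero.1 e2').resolve_right hne
      subst h1 h2; linarith
    have hgl : g (S l) = 0 := by
      by_contra hne
      have h1 := (mul_eq_zero.1 e3).resolve_right hne
      have h2 := (mul_eq_zero.1 e3').resolve_right hne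
      have h1 : a = 1 := by linarith
      have h2 : a' = 1 := by linarith
      subst h1 h2; linarith
    refine ⟨hgk, hgl, by nlinarith, by nlinarith⟩
  have fin : ∀ j, g (S j) = 0 → S j = P + f (S j) • u := by
    intro j hj
    have := hz (S j)
    rwa [hj, zero_smul, add_zero] at this
  have h1 : m + 1 ≠ m := by fin_cases m <;> decide
  have h2 : m + 2 ≠ m := by fin_cases m <;> decide
  have h12 : m + 1 ≠ m + 2 := by fin_cases m <;> decide
  rcases le_total (f (S (m + 1))) (f (S (m + 2))) with hle | hle
  · obtain ⟨r1, r2, r3, r4⟩ := main _ _ h12 h1 h2 hle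
    exact ⟨_, _, m, h12, h1, h2, fin _ r1, fin _ r2, hm, r3, r4⟩
  · obtain ⟨r1, r2, r3, r4⟩ := main _ _ h12.symm h2 h1 hle
    exact ⟨_, _, m, h12.symm, h2, h1, fin _ r1, fin _ r2, hm, r3, r4⟩

lemma tile_exists (N : ℕ) (tiles : Fin N → Tri) (P u : Pt)
    (hcov : ∀ s : ℝ, 0 ≤ s → s ≤ 1 → ∃ i, P + s • u ∈ triSet (tiles i))
    (τ : ℝ) (h0 : 0 ≤ τ) (h1 : τ < 1) :
    ∃ i, ∃ τ', τ < τ' ∧ P + τ • u ∈ triSet (tiles i) ∧ P + τ' • u ∈ triSet (tiles i) := by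
  have : ∃ i, ∃ᶠ s in nhdsWithin τ (Set.Ioi τ), P + s • u ∈ triSet (tiles i) := by
    by_contra! hcon
    have hall := Filter.eventually_all.2 hcon
    have hI : ∀ᶠ s in nhdsWithin τ (Set.Ioi τ), s ∈ Set.Ioo τ 1 := Ioo_mem_nhdsGT h1
    obtain ⟨s, hs, hs'⟩ := (hall.and hI).exists
    obtain ⟨i, hi⟩ := hcov s (by linarith [hs'.1]) hs'.2.le
    exact hs i hi
  obtain ⟨i, hi⟩ := this
  obtain ⟨τ', h2, h3⟩ := (hi.and_eventually self_mem_nhdsWithin).exists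
  refine ⟨i, τ', h3, ?_, h2⟩
  have hcl : IsClosed (triSet (tiles i)) :=
    ((Set.finite_range (tiles i)).isCompact_convexHull ℝ).isClosed
  refine hcl.mem_of_frequently_of_tendsto hi ?_
  apply Filter.Tendsto.mono_left _ nhdsWithin_le_nhds
  have hc : Continuous (fun s : ℝ => P + s • u) := by fun_prop
  exact hc.tendsto τ

lemma obtuse_coord (P u n A B C : Pt) (x y z e : ℝ) (hn : inner ℝ n u = 0)
    (hA : A = P + x • u) (hB : B = P + y • u) (hC : C = P + z • u + e • n)
    (h : inner ℝ (B - A) (C - A) < 0) : (y - x) * (z - x) < 0 := by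
  have e1 : B - A = (y - x) • u := by rw [hA, hB]; module
  have e2 : C - A = (z - x) • u + e • n := by rw [hA, hC]; module
  have hn' : inner ℝ u n = 0 := by rw [real_inner_comm]; exact hn
  rw [e1, e2, inner_smul_left, inner_add_right, inner_smul_right, inner_smul_right, hn'] at h
  have h1 : 0 ≤ inner ℝ u u := real_inner_self_nonneg
  simp only [conj_trivial] at h
  by_contra! hcon
  nlinarith [mul_nonneg hcon h1]

/-- Suppose triangle `ABC` is `N`-tiled by a tile with angles `(α, β, γ)`,
`γ > π/2`, and `PQ` is a side of `ABC`.  If no tile having an edge contained in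
`PQ` has its side of length `c` contained in `PQ`, then some tile has its `γ`
angle at `P` or at `Q`. -/
theorem gamma_at_endpoint_of_side (N : ℕ) (ABC T : Tri)
    (hABC : IsTriangle ABC) (hT : IsTriangle T)
    (α β γ : ℝ) (hangles : HasAngles T α β γ)
    (hγ : π / 2 < γ)
    (tiles : Fin N → Tri) (ht : IsTiling N ABC T tiles)
    (P Q : Pt) (hside : ∃ k l : Fin 3, k ≠ l ∧ P = ABC k ∧ Q = ABC l)
    (hnoc : ∀ (i : Fin N) (k l : Fin 3), k ≠ l →
      segment ℝ (tiles i k) (tiles i l) ⊆ segment ℝ P Q →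
      dist (tiles i k) (tiles i l) ≠ sideLen T 2) :
    ∃ (i : Fin N) (k : Fin 3), (tiles i k = P ∨ tiles i k = Q) ∧
      triAngle (tiles i) k = γ := by
  obtain ⟨k0, l0, hkl0, hP, hQ⟩ := hside
  obtain ⟨r0, hkr0, hlr0⟩ : ∃ r0 : Fin 3, k0 ≠ r0 ∧ l0 ≠ r0 := by
    revert k0 l0; intro k0 l0; fin_cases k0 <;> fin_cases l0 <;> intros <;> first
      | exact ⟨0, by decide, by decide⟩
      | exact ⟨1, by decide, by decide⟩
      | exact ⟨2, by decide, by decide⟩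
  have hnc : ¬ Collinear ℝ {P, Q, ABC r0} := by
    have := hABC
    rw [IsTriangle, affineIndependent_iff_not_collinear_of_ne hkl0 hkr0 hlr0] at this
    rwa [hP, hQ]
  obtain ⟨n, f, g, hn, hgR, hz, hfg⟩ := frame' P Q (ABC r0) hnc
  set u := Q - P with hu
  -- points of ABC
  have hin : ∀ z ∈ triSet ABC, 0 ≤ g z ∧ (g z = 0 → 0 ≤ f z ∧ f z ≤ 1) := by
    intro z hzm
    obtain ⟨a, b, c, ha, hb, hc, habc, he⟩ := mem_triSet ABC k0 l0 r0 hkl0 hkr0 hlr0 z hzm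
    have e1 : z = P + (b + c * f (ABC r0)) • u + (c * g (ABC r0)) • n := by
      have ha' : a = 1 - b - c := by linarith
      have hQ' : Q = P + u := by rw [hu]; abel
      rw [he, ← hP, ← hQ, hQ', ha']
      conv_lhs => rw [hz (ABC r0)]
      module
    have h2 := hfg (b + c * f (ABC r0)) (c * g (ABC r0))
    rw [← e1] at h2
    rw [h2.1, h2.2]
    refine ⟨by positivity, fun h => ?_⟩
    have hc0 : c = 0 := (mul_eq_zero.1 h).resolve_right hgR.ne'
    subst hc0
    constructor <;> linarith
  have hsub : ∀ i, triSet (tiles i) ⊆ triSet ABC := by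
    intro i; rw [← ht.cover]; exact Set.subset_iUnion (fun i => triSet (tiles i)) i
  have hvert : ∀ i j, tiles i j ∈ triSet ABC := fun i j =>
    hsub i (subset_convexHull ℝ _ ⟨j, rfl⟩)
  have hseg : ∀ s : ℝ, 0 ≤ s → s ≤ 1 → P + s • u ∈ segment ℝ P Q := by
    intro s h0 h1
    refine ⟨1 - s, s, by linarith, h0, by ring, ?_⟩
    rw [hu]; module
  have hsegABC : segment ℝ P Q ⊆ triSet ABC := by
    apply (convex_convexHull ℝ _).segment_subset
    · rw [hP]; exact subset_convexHull ℝ _ ⟨_, rfl⟩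
    · rw [hQ]; exact subset_convexHull ℝ _ ⟨_, rfl⟩
  have hcov : ∀ s : ℝ, 0 ≤ s → s ≤ 1 → ∃ i, P + s • u ∈ triSet (tiles i) := by
    intro s h0 h1
    have := hsegABC (hseg s h0 h1)
    rw [← ht.cover] at this
    simpa using this
  have hfacts := fun i => tile_facts (tiles i) T (ht.congr i) hT γ hangles.2.2 hγ
  let E : Fin N → Fin 3 → Fin 3 → Fin 3 → Prop := fun i k l m =>
    k ≠ l ∧ k ≠ m ∧ l ≠ m ∧ tiles i k = P + f (tiles i k) • u ∧
      tiles i l = P + f (tiles i l) • u ∧ 0 < g (tiles i m) ∧ f (tiles i k) < f (tiles i l)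
  have hg0 : ∀ z, z = P + f z • u → g z = 0 := by
    intro z h
    have := (hfg (f z) 0).2
    rwa [zero_smul, add_zero, ← h] at this
  have hA : ∀ τ : ℝ, 0 ≤ τ → τ < 1 → ∃ i k l m, E i k l m ∧ f (tiles i k) ≤ τ ∧
      τ < f (tiles i l) := by
    intro τ h0 h1
    obtain ⟨i, τ', hτ, hx, hy⟩ := tile_exists N tiles P u hcov τ h0 h1
    obtain ⟨k, l, m, c1, c2, c3, c4, c5, c6, c7, c8⟩ := edge_exists (tiles i) (hfacts i).1 P u n f g
      hz hfg (fun j => (hin _ (hvert i j)).1) τ τ' hτ hx hy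
    exact ⟨i, k, l, m, ⟨c1, c2, c3, c4, c5, c6, by linarith⟩, c7, c8⟩
  have hmemseg : ∀ i k, tiles i k = P + f (tiles i k) • u → tiles i k ∈ segment ℝ P Q := by
    intro i k h
    have h1 := (hin _ (hvert i k)).2 (hg0 _ h)
    rw [h]; exact hseg _ h1.1 h1.2
  have hgam : ∀ i k l m, E i k l m →
      (triAngle (tiles i) l = γ ∧
        (f (tiles i k) - f (tiles i l)) * (f (tiles i m) - f (tiles i l)) < 0) ∨
      (triAngle (tiles i) k = γ ∧
        (f (tiles i l) - f (tiles i k)) * (f (tiles i m) - f (tiles i k)) < 0) := by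
    rintro i k l m ⟨c1, c2, c3, c4, c5, c6, c7⟩
    obtain ⟨m0, ha, hm0⟩ := (hfacts i).2
    have hcases : m0 = l ∨ m0 = k ∨ m0 = m := by omega
    rcases hcases with rfl | rfl | rfl
    · left
      exact ⟨ha, obtuse_coord P u n _ _ _ _ _ _ _ hn c5 c4 (hz _)
        (hm0 k m c1 c3.symm c2).2⟩
    · right
      exact ⟨ha, obtuse_coord P u n _ _ _ _ _ _ _ hn c4 c5 (hz _)
        (hm0 l m c1.symm c2.symm c3).2⟩
    · exfalso
      exact hnoc i k l c1 ((convex_segment P Q).segment_subset (hmemseg i k c4) (hmemseg i l c5))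
        (hm0 k l c2 c3 c1).1
  by_contra! hno
  classical
  let F : Finset (Fin N × Fin 3) := Finset.univ.filter fun x =>
    ∃ k m, E x.1 k x.2 m ∧ triAngle (tiles x.1) x.2 = γ ∧
      (f (tiles x.1 k) - f (tiles x.1 x.2)) * (f (tiles x.1 m) - f (tiles x.1 x.2)) < 0
  have hF : F.Nonempty := by
    obtain ⟨i, k, l, m, hE, h1, h2⟩ := hA 0 le_rfl one_pos
    rcases hgam i k l m hE with ⟨h3, h4⟩ | ⟨h3, h4⟩
    · exact ⟨(i, l), by simp only [F, Finset.mem_filter, Finset.mem_univ, true_and]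
                        exact ⟨k, m, hE, h3, h4⟩⟩
    · exfalso
      have hk := hE.2.2.2.1
      have h5 := (hin _ (hvert i k)).2 (hg0 _ hk)
      have h6 : f (tiles i k) = 0 := by linarith [h5.1]
      rw [h6, zero_smul, add_zero] at hk
      exact hno i k (Or.inl hk) h3
  obtain ⟨⟨i, l⟩, hmem, hmax⟩ := F.exists_max_image (fun x => f (tiles x.1 x.2)) hF
  simp only [F, Finset.mem_filter, Finset.mem_univ, true_and] at hmem
  obtain ⟨k, m, hE, hγl, hob⟩ := hmem
  have hEcopy := hE
  obtain ⟨c1, c2, c3, c4, c5, c6, c7⟩ := hE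
  set τ := f (tiles i l) with hτ
  have hl01 := (hin _ (hvert i l)).2 (hg0 _ c5)
  rw [← hτ] at hl01
  have hτ1 : τ < 1 := by
    rcases hl01.2.lt_or_eq with h | h
    · exact h
    · exfalso
      apply hno i l (Or.inr _) hγl
      rw [c5, h, hu]; module
  obtain ⟨j, k', l', m', hE', h1, h2⟩ := hA τ hl01.1 hτ1
  have hE'copy := hE'
  obtain ⟨d1, d2, d3, d4, d5, d6, d7⟩ := hE'
  have hin1 := near_interior (tiles i) (hfacts i).1 l k m c1.symm c3 c2 P u n τ (f (tiles i k)) τ 0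
    ((f (tiles i m) - τ) / (f (tiles i k) - τ)) (g (tiles i m)) c5 c4
    (by
      have : f (tiles i k) - τ ≠ 0 := by linarith
      rw [div_mul_cancel₀ _ this]
      conv_lhs => rw [hz (tiles i m)]
      module) c6 le_rfl one_pos (by ring)
    (Or.inr (by
      have h3 : f (tiles i k) - τ < 0 := by linarith
      have h4 : 0 < f (tiles i m) - τ := by by_contra! hc; nlinarith
      exact div_neg_of_pos_of_neg h4 h3))
  have hpq : 0 < f (tiles j l') - f (tiles j k') := by linarith
  have hin2 := near_interior (tiles j) (hfacts j).1 k' l' m' d1 d2 d3 P u n (f (tiles j k'))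
    (f (tiles j l')) τ ((τ - f (tiles j k')) / (f (tiles j l') - f (tiles j k')))
    ((f (tiles j m') - τ) / (f (tiles j l') - f (tiles j k'))) (g (tiles j m')) d4 d5
    (by
      rw [div_mul_cancel₀ _ hpq.ne']
      conv_lhs => rw [hz (tiles j m')]
      module) d6 (div_nonneg (by linarith) hpq.le) (by rw [div_lt_one hpq]; linarith)
    (by rw [div_mul_cancel₀ _ hpq.ne']; ring)
    (by
      rcases h1.lt_or_eq with h | h
      · left; exact div_pos (by linarith) hpq
      · right
        rcases hgam j k' l' m' hE'copy with ⟨h3, h4⟩ | ⟨h3, h4⟩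
        · exfalso
          have := hmax (j, l') (by
            simp only [F, Finset.mem_filter, Finset.mem_univ, true_and]
            exact ⟨k', m', hE'copy, h3, h4⟩)
          simp only at this
          linarith
        · apply div_neg_of_neg_of_pos _ hpq
          rw [← h]
          by_contra! hc; nlinarith)
  obtain ⟨ε, hε1, hε2⟩ := (hin1.and hin2).exists
  have hij : i = j := by
    by_contra hne
    have := ht.disj i j hne
    have hmm : P + τ • u + ε • n ∈ interior (triSet (tiles i)) ∩ interior (triSet (tiles j)) :=
      ⟨hε1, hε2⟩
    rw [this] at hmm
    exact hmm
  subst hij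
  have hl' : l' = l ∨ l' = k ∨ l' = m := by omega
  rcases hl' with rfl | rfl | rfl
  · linarith
  · linarith
  · have := hg0 _ d5
    linarith
end
end

section
/- Suppose triangle ABC is N-tiled by a tile T with angles (α, β, γ) such that (i) γ > π/2, (ii) α is not a rational multiple of π, and (iii) every interior angle of triangle ABC is less than γ. Then there are at least two c edges of tiles on side AC: at least two tiles of the tiling have their side of length c contained in the side AC of ABC. -/
open EuclideanGeometry Real

noncomputable section

section Part1
/-- one-dimensional chain data -/
structure Chain1 {ι : Type*} (I : Finset ι) (l r : ι → ℝ) (F : Set ℝ) : Prop where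
  bd : ∀ e ∈ I, 0 ≤ l e ∧ l e < r e ∧ r e ≤ 1
  dj : ∀ e ∈ I, ∀ e' ∈ I, e ≠ e' → ∀ t, t ∈ Set.Ioo (l e) (r e) → t ∈ Set.Ioo (l e') (r e') → False
  fin : F.Finite
  cov : ∀ t ∈ Set.Ioo (0:ℝ) 1, t ∉ F → ∃ e ∈ I, t ∈ Set.Ioo (l e) (r e)

namespace Chain1
variable {ι : Type*} {I : Finset ι} {l r : ι → ℝ} {F : Set ℝ}

theorem left (h : Chain1 I l r F) {x : ℝ} (h0 : 0 < x) (h1 : x ≤ 1) :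
    ∃ e ∈ I, l e < x ∧ x ≤ r e := by
  by_contra hc
  push Not at hc
  have e1 : ∀ᶠ y in nhdsWithin x (Set.Iio x), ∀ e ∈ I, y ∉ Set.Ioo (l e) (r e) := by
    rw [Filter.eventually_all_finset]
    intro e he
    by_cases hl : l e < x
    · have hr := hc e he hl
      filter_upwards [mem_nhdsWithin_of_mem_nhds (lt_mem_nhds hr)] with y hy hy2
      exact absurd hy2.2 (not_lt.2 (le_of_lt hy))
    · filter_upwards [self_mem_nhdsWithin] with y hy hy2
      have := hy2.1
      simp at hy
      linarith
  have e2 : ∀ᶠ y in nhdsWithin x (Set.Iio x), y ∉ F := by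
    have hcl : IsClosed (F \ {x}) := (h.fin.subset Set.sdiff_subset).isClosed
    have : (F \ {x})ᶜ ∈ nhds x := hcl.isOpen_compl.mem_nhds (by simp)
    filter_upwards [mem_nhdsWithin_of_mem_nhds this, self_mem_nhdsWithin] with y hy hy2 hy3
    exact hy ⟨hy3, by simp at hy2 ⊢; exact ne_of_lt hy2⟩
  have e3 : ∀ᶠ y in nhdsWithin x (Set.Iio x), 0 < y := mem_nhdsWithin_of_mem_nhds (lt_mem_nhds h0)
  obtain ⟨y, hy1, hy2, hy3, hy4⟩ := (e1.and (e2.and (e3.and self_mem_nhdsWithin))).exists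
  obtain ⟨e, he, hh⟩ := h.cov y ⟨hy3, lt_of_lt_of_le hy4 h1⟩ hy2
  exact hy1 e he hh

theorem right (h : Chain1 I l r F) {x : ℝ} (h0 : 0 ≤ x) (h1 : x < 1) :
    ∃ e ∈ I, l e ≤ x ∧ x < r e := by
  have h' : Chain1 I (fun e => 1 - r e) (fun e => 1 - l e) ((fun t => 1 - t) '' F) := by
    refine ⟨fun e he => ?_, fun e he e' he' hne t ht ht' => ?_, h.fin.image _, fun t ht htF => ?_⟩
    · have := h.bd e he
      exact ⟨by linarith, by linarith, by linarith⟩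
    · exact h.dj e he e' he' hne (1 - t) ⟨by linarith [ht.2], by linarith [ht.1]⟩
        ⟨by linarith [ht'.2], by linarith [ht'.1]⟩
    · obtain ⟨e, he, hh⟩ := h.cov (1 - t) ⟨by linarith [ht.2], by linarith [ht.1]⟩
        (fun hF => htF ⟨1 - t, hF, by ring⟩)
      exact ⟨e, he, by linarith [hh.2], by linarith [hh.1]⟩
  obtain ⟨e, he, h2, h3⟩ := h'.left (x := 1 - x) (by linarith) (by linarith)
  exact ⟨e, he, by linarith, by linarith⟩

theorem ex_left (h : Chain1 I l r F) : ∃ e ∈ I, l e = 0 := by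
  obtain ⟨e, he, h1, h2⟩ := h.right (x := 0) le_rfl one_pos
  exact ⟨e, he, le_antisymm h1 (h.bd e he).1⟩

theorem ex_right (h : Chain1 I l r F) : ∃ e ∈ I, r e = 1 := by
  obtain ⟨e, he, h1, h2⟩ := h.left (x := 1) one_pos le_rfl
  exact ⟨e, he, le_antisymm (h.bd e he).2.2 h2⟩

theorem r_inj (h : Chain1 I l r F) {e e' : ι} (he : e ∈ I) (he' : e' ∈ I) (hr : r e = r e') : e = e' := by
  by_contra hne
  have b1 := h.bd e he
  have b2 := h.bd e' he'
  refine h.dj e he e' he' hne ((max (l e) (l e') + r e) / 2) ⟨?_, ?_⟩ ⟨?_, ?_⟩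
  · have := le_max_left (l e) (l e'); linarith
  · have : max (l e) (l e') < r e := max_lt b1.2.1 (by linarith)
    linarith
  · have := le_max_right (l e) (l e'); linarith
  · have : max (l e) (l e') < r e := max_lt b1.2.1 (by linarith)
    linarith

theorem node (h : Chain1 I l r F) {e : ι} (he : e ∈ I) (h0 : l e ≠ 0) : ∃ e' ∈ I, r e' = l e := by
  have b1 := h.bd e he
  obtain ⟨e', he', h1, h2⟩ := h.left (x := l e) (lt_of_le_of_ne b1.1 (Ne.symm h0)) (by linarith)
  have hne : e ≠ e' := by rintro rfl; exact lt_irrefl _ h1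
  refine ⟨e', he', le_antisymm ?_ h2⟩
  by_contra hc
  push Not at hc
  refine h.dj e he e' he' hne ((l e + min (r e) (r e')) / 2) ⟨?_, ?_⟩ ⟨?_, ?_⟩
  · have : l e < min (r e) (r e') := lt_min b1.2.1 hc
    linarith
  · have := min_le_left (r e) (r e'); linarith
  · have : l e < min (r e) (r e') := lt_min b1.2.1 hc
    linarith
  · have := min_le_right (r e) (r e'); linarith

theorem pigeon [DecidableEq ι] (h : Chain1 I l r F) (g : ι → ℝ) (S : Finset ι) (hS : S ⊆ I)
    (hg : ∀ e ∈ S, g e = l e ∨ g e = r e) (h0 : ∀ e ∈ S, g e ≠ 0) (h1 : ∀ e ∈ S, g e ≠ 1)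
    (hinj : ∀ e ∈ S, ∀ e' ∈ S, g e = g e' → e = e') :
    S.card < I.card ∧ (S.card + 1 = I.card → ∀ e ∈ I,
      (l e ≠ 0 → ∃ s ∈ S, g s = l e) ∧ (r e ≠ 1 → ∃ s ∈ S, g s = r e)) := by
  classical
  set R := (I.image r).erase 1 with hR
  have hcI : (I.image r).card = I.card :=
    Finset.card_image_of_injOn (fun e he e' he' hh => h.r_inj he he' hh)
  have h1m : (1:ℝ) ∈ I.image r := by
    obtain ⟨e, he, hh⟩ := h.ex_right
    exact Finset.mem_image.2 ⟨e, he, hh⟩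
  have hRc : R.card + 1 = I.card := by rw [hR, Finset.card_erase_add_one h1m, hcI]
  have hlR : ∀ e ∈ I, l e ≠ 0 → l e ∈ R := by
    intro e he hne
    obtain ⟨e', he', hh⟩ := h.node he hne
    refine Finset.mem_erase.2 ⟨?_, Finset.mem_image.2 ⟨e', he', hh⟩⟩
    have := h.bd e he
    linarith
  have hrR : ∀ e ∈ I, r e ≠ 1 → r e ∈ R := fun e he hne =>
    Finset.mem_erase.2 ⟨hne, Finset.mem_image.2 ⟨e, he, rfl⟩⟩
  have hgc : (S.image g).card = S.card :=
    Finset.card_image_of_injOn (fun e he e' he' hh => hinj e he e' he' hh)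
  have hsub : S.image g ⊆ R := by
    intro x hx
    obtain ⟨e, he, rfl⟩ := Finset.mem_image.1 hx
    rcases hg e he with hh | hh
    · rw [hh]; exact hlR e (hS he) (hh ▸ h0 e he)
    · rw [hh]; exact hrR e (hS he) (hh ▸ h1 e he)
  have hle := Finset.card_le_card hsub
  refine ⟨by omega, fun hc e he => ?_⟩
  have heq : S.image g = R := Finset.eq_of_subset_of_card_le hsub (by omega)
  constructor
  · intro hne
    have := hlR e he hne
    rw [← heq] at this
    obtain ⟨s, hs, hh⟩ := Finset.mem_image.1 this
    exact ⟨s, hs, hh⟩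
  · intro hne
    have := hrR e he hne
    rw [← heq] at this
    obtain ⟨s, hs, hh⟩ := Finset.mem_image.1 this
    exact ⟨s, hs, hh⟩

theorem sum_len (h : Chain1 I l r F) : ∑ e ∈ I, (r e - l e) = 1 := by
  classical
  have m1 : MeasureTheory.volume (⋃ e ∈ I, Set.Ioo (l e) (r e)) =
      ∑ e ∈ I, MeasureTheory.volume (Set.Ioo (l e) (r e)) := by
    apply MeasureTheory.measure_biUnion_finset
    · intro e he e' he' hne
      rw [Function.onFun, Set.disjoint_left]
      intro t ht ht'
      exact h.dj e he e' he' hne t ht ht'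
    · intro e _; exact measurableSet_Ioo
  have m2 : MeasureTheory.volume (⋃ e ∈ I, Set.Ioo (l e) (r e)) = 1 := by
    apply le_antisymm
    · calc _ ≤ MeasureTheory.volume (Set.Icc (0:ℝ) 1) := by
            apply MeasureTheory.measure_mono
            intro t ht
            simp only [Set.mem_iUnion] at ht
            obtain ⟨e, he, ht⟩ := ht
            have := h.bd e he
            exact ⟨by linarith [ht.1], by linarith [ht.2]⟩
        _ = 1 := by simp
    · calc (1 : ENNReal) = MeasureTheory.volume (Set.Ioo (0:ℝ) 1 \ F) := by
            rw [MeasureTheory.measure_sdiff_null (h.fin.measure_zero _)]; simp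
        _ ≤ _ := by
            apply MeasureTheory.measure_mono
            intro t ht
            obtain ⟨e, he, hh⟩ := h.cov t ht.1 ht.2
            simp only [Set.mem_iUnion]
            exact ⟨e, he, hh⟩
  rw [m1] at m2
  simp only [Real.volume_Ioo] at m2
  rw [← ENNReal.ofReal_sum_of_nonneg (fun e he => by linarith [(h.bd e he).2.1])] at m2
  have := congrArg ENNReal.toReal m2
  rw [ENNReal.toReal_ofReal (Finset.sum_nonneg fun e he => by linarith [(h.bd e he).2.1])] at this
  simpa using this

end Chain1
end Part1

section Part2
instance factTwoPi : Fact (0 < 2 * π) := ⟨by positivity⟩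

abbrev Cir : Type := AddCircle (2 * π)

def ud (θ : Cir) : Pt := !₂[Real.Angle.cos θ, Real.Angle.sin θ]

theorem ud_coe (x : ℝ) : ud ((x : ℝ) : Cir) = !₂[Real.cos x, Real.sin x] := by
  unfold ud
  rw [show Real.Angle.cos ((x:ℝ):Cir) = Real.cos x from Real.Angle.cos_coe x,
    show Real.Angle.sin ((x:ℝ):Cir) = Real.sin x from Real.Angle.sin_coe x]

theorem Lud (L : Pt →ₗ[ℝ] ℝ) (x : ℝ) :
    L (ud (x : Cir)) = Real.cos x * L !₂[1,0] + Real.sin x * L !₂[0,1] := by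
  rw [ud_coe, ← smul_eq_mul, ← smul_eq_mul, ← map_smul, ← map_smul, ← map_add]
  congr 1
  ext i; fin_cases i <;> simp

theorem polar (a b : ℝ) (h : a ≠ 0 ∨ b ≠ 0) : ∃ ρ φ : ℝ, 0 < ρ ∧ a = ρ * Real.cos φ ∧ b = ρ * Real.sin φ := by
  have h0 : (⟨a, b⟩ : ℂ) ≠ 0 := by
    intro h'
    have := congrArg Complex.re h'
    have := congrArg Complex.im h'
    simp_all
  refine ⟨‖(⟨a, b⟩ : ℂ)‖, Complex.arg ⟨a, b⟩, by simpa using h0, ?_, ?_⟩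
  · rw [Complex.norm_mul_cos_arg]
  · rw [Complex.norm_mul_sin_arg]

theorem Lne (L : Pt →ₗ[ℝ] ℝ) (h : L ≠ 0) : L !₂[1,0] ≠ 0 ∨ L !₂[0,1] ≠ 0 := by
  by_contra hc
  push Not at hc
  apply h
  ext v
  have : v = v 0 • (!₂[1,0] : Pt) + v 1 • (!₂[0,1] : Pt) := by
    ext i; fin_cases i <;> simp
  rw [this, map_add, map_smul, map_smul, hc.1, hc.2]; simp

theorem Lpolar (L : Pt →ₗ[ℝ] ℝ) (h : L ≠ 0) : ∃ ρ φ : ℝ, 0 < ρ ∧ ∀ x : ℝ, L (ud ((φ + x : ℝ) : Cir)) = ρ * Real.cos x := by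
  obtain ⟨ρ, φ, h0, h1, h2⟩ := polar _ _ (Lne L h)
  refine ⟨ρ, φ, h0, fun x => ?_⟩
  rw [Lud, h1, h2, Real.cos_add, Real.sin_add]
  have := Real.sin_sq_add_cos_sq φ
  linear_combination (ρ * Real.cos x) * this

theorem Vpolar (v : Pt) (h : v ≠ 0) : ∃ ρ φ : ℝ, 0 < ρ ∧ v = ρ • ud (φ : Cir) := by
  obtain ⟨ρ, φ, h0, h1, h2⟩ := polar (v 0) (v 1) (by
    by_contra hc; push Not at hc; apply h; ext i; fin_cases i; exacts [hc.1, hc.2])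
  refine ⟨ρ, φ, h0, ?_⟩
  rw [ud_coe]
  ext i; fin_cases i <;> simp [h1, h2]

theorem cir_rep (φ : ℝ) (θ : Cir) : ∃ x : ℝ, |x| ≤ π ∧ θ = ((φ + x : ℝ) : Cir) ∧ dist θ (φ : Cir) = |x| := by
  have hx : ∃ x : ℝ, |x| ≤ π ∧ (θ - (φ : Cir)) = (x : Cir) := by
    refine ⟨Real.Angle.toReal (θ - (φ : Cir)), Real.Angle.abs_toReal_le_pi _, ?_⟩
    exact (Real.Angle.coe_toReal (θ - (φ : Cir))).symm
  obtain ⟨x, h1, h2⟩ := hx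
  refine ⟨x, h1, ?_, ?_⟩
  · rw [AddCircle.coe_add, ← h2]; abel
  · rw [dist_eq_norm, h2, AddCircle.norm_coe_eq_abs_iff _ (by have := Real.pi_pos; linarith)]
    rw [abs_of_pos (a := 2 * π) (by positivity)]; linarith

theorem half_vol (L : Pt →ₗ[ℝ] ℝ) (h : L ≠ 0) :
    MeasureTheory.volume {θ : Cir | 0 ≤ L (ud θ)} = ENNReal.ofReal π := by
  obtain ⟨ρ, φ, h0, h1⟩ := Lpolar L h
  have : {θ : Cir | 0 ≤ L (ud θ)} = Metric.closedBall (φ : Cir) (π / 2) := by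
    ext θ
    obtain ⟨x, hx, rfl, hd⟩ := cir_rep φ θ
    rw [Set.mem_ofPred_eq, Metric.mem_closedBall, hd, h1]
    rw [abs_le] at hx ⊢
    constructor
    · intro h
      have hc : 0 ≤ Real.cos x := by
        by_contra hc; push Not at hc; nlinarith
      constructor
      · by_contra hx'; push Not at hx'
        have := Real.cos_neg_of_pi_div_two_lt_of_lt (x := -x) (by linarith) (by linarith [Real.pi_pos])
        rw [Real.cos_neg] at this; linarith
      · by_contra hx'; push Not at hx'
        have := Real.cos_neg_of_pi_div_two_lt_of_lt (x := x) (by linarith) (by linarith [Real.pi_pos])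
        linarith
    · intro h
      have := Real.cos_nonneg_of_mem_Icc (x := x) ⟨by linarith, h.2⟩
      positivity
  rw [this, AddCircle.volume_closedBall]
  congr 1
  rw [min_eq_right] <;> linarith [Real.pi_pos]

theorem null_vol (L : Pt →ₗ[ℝ] ℝ) (h : L ≠ 0) :
    MeasureTheory.volume {θ : Cir | L (ud θ) = 0} = 0 := by
  obtain ⟨ρ, φ, h0, h1⟩ := Lpolar L h
  have : {θ : Cir | L (ud θ) = 0} ⊆ Metric.closedBall ((φ + π/2 : ℝ) : Cir) 0 ∪ Metric.closedBall ((φ - π/2 : ℝ) : Cir) 0 := by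
    intro θ hθ
    obtain ⟨x, hx, rfl, hd⟩ := cir_rep φ θ
    rw [Set.mem_ofPred_eq, h1] at hθ
    have hc : Real.cos x = 0 := by
      rcases mul_eq_zero.1 hθ with h | h
      · linarith
      · exact h
    rw [abs_le] at hx
    rw [Metric.closedBall_zero, Metric.closedBall_zero]
    rcases lt_trichotomy x 0 with h | h | h
    · right
      have : x = -(π/2) := by
        have := Real.injOn_cos (x₁ := -x) (x₂ := π/2) ⟨by linarith, by linarith⟩ ⟨by linarith [Real.pi_pos], by linarith [Real.pi_pos]⟩ (by rw [Real.cos_neg, hc, Real.cos_pi_div_two])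
        linarith
      rw [this]; simp [sub_eq_add_neg]
    · subst h; simp at hc
    · left
      have : x = (π/2) := by
        have := Real.injOn_cos (x₁ := x) (x₂ := π/2) ⟨by linarith, by linarith⟩ ⟨by linarith [Real.pi_pos], by linarith [Real.pi_pos]⟩ (by rw [ hc, Real.cos_pi_div_two])
        linarith
      rw [this]; simp
  refine MeasureTheory.measure_mono_null this (MeasureTheory.measure_union_null ?_ ?_) <;>
  · rw [AddCircle.volume_closedBall]
    simp [Real.pi_pos.le]

theorem ud_comb (ψ δ x : ℝ) : Real.sin δ • ud ((ψ + δ/2 + x : ℝ) : Cir) =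
    Real.sin (δ/2 - x) • ud (ψ : Cir) + Real.sin (δ/2 + x) • ud ((ψ + δ : ℝ) : Cir) := by
  simp only [ud_coe]
  obtain ⟨h, rfl⟩ : ∃ h, δ = 2 * h := ⟨δ/2, by ring⟩
  rw [show 2 * h / 2 = h by ring]
  have h1 := Real.sin_sq_add_cos_sq h
  ext i; fin_cases i
  · simp [Real.cos_add, Real.sin_add, Real.sin_sub, Real.sin_two_mul, Real.cos_two_mul]
    linear_combination (-2 * cos h * sin x * cos ψ) * h1
  · simp [Real.cos_add, Real.sin_add, Real.sin_sub, Real.sin_two_mul, Real.cos_two_mul]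
    linear_combination (-2 * cos h * sin x * sin ψ) * h1

theorem cone_aux (δ x : ℝ) (h0 : 0 < δ) (h1 : δ < π) (hx : |x| ≤ π) :
    (0 ≤ Real.sin (δ/2 - x) ∧ 0 ≤ Real.sin (δ/2+x)) ↔ |x| ≤ δ/2 := by
  rw [abs_le] at hx ⊢
  constructor
  · rintro ⟨ha, hb⟩
    have hs : 0 < Real.sin (δ/2) := Real.sin_pos_of_pos_of_lt_pi (by linarith) (by linarith)
    have hc : 0 ≤ Real.cos x := by
      rw [Real.sin_sub] at ha; rw [Real.sin_add] at hb
      by_contra hc; push Not at hc; nlinarith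
    have hx2 : -(π/2) ≤ x ∧ x ≤ π/2 := by
      constructor
      · by_contra hx'; push Not at hx'
        have := Real.cos_neg_of_pi_div_two_lt_of_lt (x := -x) (by linarith) (by linarith [Real.pi_pos])
        rw [Real.cos_neg] at this; linarith
      · by_contra hx'; push Not at hx'
        have := Real.cos_neg_of_pi_div_two_lt_of_lt (x := x) (by linarith) (by linarith [Real.pi_pos])
        linarith
    constructor
    · by_contra hc; push Not at hc
      have := Real.sin_neg_of_neg_of_neg_pi_lt (x := δ/2+x) (by linarith) (by linarith)
      linarith
    · by_contra hc; push Not at hc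
      have := Real.sin_neg_of_neg_of_neg_pi_lt (x := δ/2-x) (by linarith) (by linarith)
      linarith
  · rintro ⟨ha, hb⟩
    exact ⟨Real.sin_nonneg_of_nonneg_of_le_pi (by linarith) (by linarith),
      Real.sin_nonneg_of_nonneg_of_le_pi (by linarith) (by linarith)⟩

theorem inner_ud (x y : ℝ) : inner ℝ (ud (x : Cir)) (ud (y : Cir)) = Real.cos (y - x) := by
  simp [ud_coe, Real.cos_sub, PiLp.inner_apply, Fin.sum_univ_two]

theorem cone_vol (L1 L2 : Pt →ₗ[ℝ] ℝ) (v1 v2 : Pt) (h11 : L1 v1 = 1) (h12 : L1 v2 = 0)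
    (h21 : L2 v1 = 0) (h22 : L2 v2 = 1) :
    MeasureTheory.volume {θ : Cir | 0 ≤ L1 (ud θ) ∧ 0 ≤ L2 (ud θ)} =
      ENNReal.ofReal (InnerProductGeometry.angle v1 v2) := by
  obtain ⟨ρ1, ψ, hρ1, hv1⟩ := Vpolar v1 (by rintro rfl; simp at h11)
  obtain ⟨ρ2, ψ2, hρ2, hv2⟩ := Vpolar v2 (by rintro rfl; simp at h22)
  obtain ⟨δ, hδ, hδ2, -⟩ := cir_rep ψ (ψ2 : Cir)
  rw [hδ2] at hv2
  rw [hv1, map_smul, smul_eq_mul] at h11 h21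
  rw [hv2, map_smul, smul_eq_mul] at h12 h22
  have h21' : L2 (ud (ψ : Cir)) = 0 := (mul_eq_zero.1 h21).resolve_left hρ1.ne'
  have h12' : L1 (ud ((ψ + δ : ℝ) : Cir)) = 0 := (mul_eq_zero.1 h12).resolve_left hρ2.ne'
  have h11' : 0 < L1 (ud (ψ : Cir)) := by
    by_contra hc; push Not at hc; nlinarith
  have h22' : 0 < L2 (ud ((ψ + δ : ℝ) : Cir)) := by
    by_contra hc; push Not at hc; nlinarith
  have E1 : ∀ x : ℝ, Real.sin δ * L1 (ud ((ψ + δ/2 + x : ℝ) : Cir)) = Real.sin (δ/2 - x) * L1 (ud (ψ : Cir)) := by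
    intro x
    have := congrArg L1 (ud_comb ψ δ x)
    simpa only [map_add, map_smul, smul_eq_mul, h12', mul_zero, add_zero] using this
  have E2 : ∀ x : ℝ, Real.sin δ * L2 (ud ((ψ + δ/2 + x : ℝ) : Cir)) = Real.sin (δ/2 + x) * L2 (ud ((ψ + δ : ℝ) : Cir)) := by
    intro x
    have := congrArg L2 (ud_comb ψ δ x)
    simpa only [map_add, map_smul, smul_eq_mul, h21', mul_zero, zero_add] using this
  have hδ' := abs_le.1 hδ
  have hs : Real.sin δ ≠ 0 := by
    intro hs
    have := E1 (-(δ/2))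
    rw [hs] at this
    have e1 := E1 (δ/2 - π/2)
    rw [hs] at e1
    simp at e1
    linarith
  have hδ0 : δ ≠ 0 := by rintro rfl; simp at hs
  have hδ1 : δ ≠ π := by rintro rfl; simp at hs
  have hδ3 : δ ≠ -π := by rintro rfl; simp at hs
  have hang : InnerProductGeometry.angle v1 v2 = |δ| := by
    rw [hv1, hv2, InnerProductGeometry.angle_smul_left_of_pos _ _ hρ1, InnerProductGeometry.angle_smul_right_of_pos _ _ hρ2]
    unfold InnerProductGeometry.angle
    have hn : ∀ x : ℝ, ‖ud (x : Cir)‖ = 1 := by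
      intro x
      have h1 := real_inner_self_eq_norm_sq (ud (x : Cir))
      rw [inner_ud] at h1
      simp at h1
      have := norm_nonneg (ud (x:Cir))
      nlinarith
    rw [hn, hn, inner_ud]
    simp
    rw [← Real.cos_abs, Real.arccos_cos (abs_nonneg _) hδ]
  have key : {θ : Cir | 0 ≤ L1 (ud θ) ∧ 0 ≤ L2 (ud θ)} = Metric.closedBall ((ψ + δ/2 : ℝ) : Cir) (|δ| / 2) := by
    ext θ
    obtain ⟨x, hx, rfl, hd⟩ := cir_rep (ψ + δ/2) θ
    rw [Set.mem_ofPred_eq, Metric.mem_closedBall, hd]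
    have e1 := E1 x
    have e2 := E2 x
    rcases lt_or_gt_of_ne hδ0 with hneg | hpos
    · have hsn : Real.sin δ < 0 := Real.sin_neg_of_neg_of_neg_pi_lt hneg (lt_of_le_of_ne hδ'.1 hδ3.symm)
      rw [abs_of_neg hneg]
      rw [← cone_aux (-δ) x (by linarith) (by have := lt_of_le_of_ne hδ'.1 hδ3.symm; linarith) hx]
      have f1 : Real.sin (-δ/2 - x) = - Real.sin (δ/2+x) := by rw [← Real.sin_neg]; congr 1; ring
      have f2 : Real.sin (-δ/2 + x) = - Real.sin (δ/2-x) := by rw [← Real.sin_neg]; congr 1; ring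
      rw [f1, f2]
      constructor
      · rintro ⟨g1, g2⟩
        constructor <;> (by_contra hc; push Not at hc; nlinarith)
      · rintro ⟨g1, g2⟩
        constructor <;> (by_contra hc; push Not at hc; nlinarith)
    · have hsn : 0 < Real.sin δ := Real.sin_pos_of_pos_of_lt_pi hpos (lt_of_le_of_ne hδ'.2 hδ1)
      rw [abs_of_pos hpos]
      rw [← cone_aux δ x hpos (lt_of_le_of_ne hδ'.2 hδ1) hx]
      constructor
      · rintro ⟨g1, g2⟩
        constructor <;> (by_contra hc; push Not at hc; nlinarith)
      · rintro ⟨g1, g2⟩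
        constructor <;> (by_contra hc; push Not at hc; nlinarith)
  rw [key, AddCircle.volume_closedBall, hang]
  congr 1
  rw [min_eq_right] <;> linarith
end Part2

section Part3
open MeasureTheory Filter Topology

abbrev AB : Type := AffineBasis (Fin 3) ℝ Pt

abbrev lc (b : AB) (k : Fin 3) : Pt →ₗ[ℝ] ℝ := (b.coord k).linear

theorem co_add (b : AB) (k : Fin 3) (y v : Pt) (ε : ℝ) :
    b.coord k (y + ε • v) = b.coord k y + ε * lc b k v := by
  have := (b.coord k).map_vadd y (ε • v)
  simp only [vadd_eq_add, map_smul, smul_eq_mul] at this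
  rw [add_comm y, this]; ring

theorem lc_sub (b : AB) (k : Fin 3) (x y : Pt) : lc b k (x - y) = b.coord k x - b.coord k y := by
  have := (b.coord k).linearMap_vsub x y
  simpa using this

theorem co_sum (b : AB) (y : Pt) : b.coord 0 y + b.coord 1 y + b.coord 2 y = 1 := by
  have := b.sum_coord_apply_eq_one y
  rwa [Fin.sum_univ_three] at this

theorem co_sum' (b : AB) (k : Fin 3) (y : Pt) : b.coord k y + b.coord (k+1) y + b.coord (k+2) y = 1 := by
  have := co_sum b y
  fin_cases k <;> simp <;> linarith

theorem co_self (b : AB) (k : Fin 3) : b.coord k (b k) = 1 := by simp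

theorem co_ne (b : AB) {k l : Fin 3} (h : k ≠ l) : b.coord k (b l) = 0 := by
  simp [h]

theorem co_ext (b : AB) {x y : Pt} (h : ∀ k, b.coord k x = b.coord k y) : x = y := by
  rw [← b.linear_combination_coord_eq_self x, ← b.linear_combination_coord_eq_self y]
  simp [h]

theorem lc_ne (b : AB) (k : Fin 3) : lc b k ≠ 0 := by
  intro h
  have := lc_sub b k (b k) (b (k+1))
  rw [h, co_self, co_ne b (by fin_cases k <;> decide)] at this
  simp at this

theorem k3 (k : Fin 3) : k+1+1 = k+2 ∧ k+2+1 = k ∧ k+1+2 = k ∧ k+2+2 = k+1 := by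
  revert k; decide

theorem fin3 (k l : Fin 3) : l = k ∨ l = k+1 ∨ l = k+2 := by revert k l; decide

theorem eq_vertex (b : AB) (k : Fin 3) (y : Pt) (h1 : b.coord (k+1) y = 0) (h2 : b.coord (k+2) y = 0) :
    y = b k := by
  have h0 := co_sum' b k y
  apply co_ext b
  intro l
  have hl := fin3 k l
  rcases hl with rfl | rfl | rfl
  · rw [co_self]; linarith
  · rw [h1, co_ne b (by fin_cases k <;> decide)]
  · rw [h2, co_ne b (by fin_cases k <;> decide)]

def D (b : AB) (y : Pt) : Set Cir :=
  {θ | ∀ k, 0 ≤ b.coord k y ∧ (b.coord k y = 0 → 0 ≤ lc b k (ud θ))}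

theorem ev_of_D {b : AB} {y : Pt} {θ : Cir} (h : θ ∈ D b y) :
    ∀ᶠ ε in 𝓝[>] (0:ℝ), ∀ k, 0 ≤ b.coord k (y + ε • ud θ) := by
  rw [eventually_all]
  intro k
  obtain ⟨h1, h2⟩ := h k
  simp only [co_add]
  rcases h1.eq_or_lt with h0 | h0
  · filter_upwards [self_mem_nhdsWithin] with ε hε
    rw [← h0, zero_add]
    exact mul_nonneg (le_of_lt hε) (h2 h0.symm)
  · have : Tendsto (fun ε : ℝ => b.coord k y + ε * lc b k (ud θ)) (𝓝[>] 0) (𝓝 (b.coord k y + 0 * lc b k (ud θ))) :=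
      Tendsto.mono_left (Continuous.tendsto (by fun_prop) 0) nhdsWithin_le_nhds
    rw [zero_mul, add_zero] at this
    filter_upwards [this.eventually_const_lt h0] with ε hε
    exact hε.le

theorem evpos {b : AB} {y : Pt} {θ : Cir} (h : θ ∈ D b y) (h' : ∀ k, lc b k (ud θ) ≠ 0) :
    ∀ᶠ ε in 𝓝[>] (0:ℝ), ∀ k, 0 < b.coord k (y + ε • ud θ) := by
  rw [eventually_all]
  intro k
  obtain ⟨h1, h2⟩ := h k
  simp only [co_add]
  rcases h1.eq_or_lt with h0 | h0
  · filter_upwards [self_mem_nhdsWithin] with ε hε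
    rw [← h0, zero_add]
    exact mul_pos hε (lt_of_le_of_ne (h2 h0.symm) (h' k).symm)
  · have : Tendsto (fun ε : ℝ => b.coord k y + ε * lc b k (ud θ)) (𝓝[>] 0) (𝓝 (b.coord k y + 0 * lc b k (ud θ))) :=
      Tendsto.mono_left (Continuous.tendsto (by fun_prop) 0) nhdsWithin_le_nhds
    rw [zero_mul, add_zero] at this
    exact this.eventually_const_lt h0

theorem D_of_freq {b : AB} {y : Pt} {θ : Cir}
    (h : ∃ᶠ ε in 𝓝[>] (0:ℝ), ∀ k, 0 ≤ b.coord k (y + ε • ud θ)) : θ ∈ D b y := by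
  intro k
  have hk : ∃ᶠ ε in 𝓝[>] (0:ℝ), 0 ≤ b.coord k (y + ε • ud θ) := h.mono fun ε h => h k
  simp only [co_add] at hk
  constructor
  · by_contra hc
    push Not at hc
    apply hk
    have : Tendsto (fun ε : ℝ => b.coord k y + ε * lc b k (ud θ)) (𝓝[>] 0) (𝓝 (b.coord k y + 0 * lc b k (ud θ))) :=
      Tendsto.mono_left (Continuous.tendsto (by fun_prop) 0) nhdsWithin_le_nhds
    rw [zero_mul, add_zero] at this
    filter_upwards [this.eventually_lt_const hc] with ε hε
    exact not_le.2 hε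
  · intro h0
    by_contra hc
    push Not at hc
    apply hk
    filter_upwards [self_mem_nhdsWithin] with ε hε
    rw [h0, zero_add, not_le]
    exact mul_neg_of_pos_of_neg hε hc

theorem ud_cont : Continuous ud := by
  unfold ud
  have h1 : Continuous (fun θ : Cir => Real.Angle.cos θ) := Real.Angle.continuous_cos
  have h2 : Continuous (fun θ : Cir => Real.Angle.sin θ) := Real.Angle.continuous_sin
  refine (PiLp.continuous_toLp 2 _).comp ?_
  refine continuous_pi fun i => ?_
  fin_cases i
  · exact h1
  · exact h2

theorem D_meas (b : AB) (y : Pt) : MeasurableSet (D b y) := by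
  have : D b y = ⋂ k, {θ | 0 ≤ b.coord k y ∧ (b.coord k y = 0 → 0 ≤ lc b k (ud θ))} := by
    ext θ; simp [D]
  rw [this]
  refine MeasurableSet.iInter fun k => ?_
  have hL : Continuous fun θ => lc b k (ud θ) := (LinearMap.continuous_of_finiteDimensional _).comp ud_cont
  by_cases h1 : 0 ≤ b.coord k y
  · by_cases h2 : b.coord k y = 0
    · simp only [h2, le_refl, true_and, forall_const]
      exact (isClosed_le continuous_const hL).measurableSet
    · simp [h1, h2]
  · simp [h1]

def onEdge (b : AB) (k : Fin 3) (y : Pt) : Prop :=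
  b.coord k y = 0 ∧ 0 < b.coord (k+1) y ∧ 0 < b.coord (k+2) y

def ang (b : AB) (y : Pt) : ℝ := (volume (D b y)).toReal

theorem ang_out {b : AB} {y : Pt} {k : Fin 3} (h : b.coord k y < 0) : ang b y = 0 := by
  have : D b y = ∅ := by
    ext θ; simp only [D, Set.mem_ofPred_eq, Set.mem_empty_iff_false, iff_false]
    intro h'; linarith [(h' k).1]
  simp [ang, this]

theorem ang_int {b : AB} {y : Pt} (h : ∀ k, 0 < b.coord k y) : ang b y = 2 * π := by
  have : D b y = Set.univ := by
    ext θ; simp only [D, Set.mem_ofPred_eq, Set.mem_univ, iff_true]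
    intro k; exact ⟨(h k).le, fun h' => absurd h' (h k).ne'⟩
  rw [ang, this, AddCircle.measure_univ, ENNReal.toReal_ofReal (by positivity)]

theorem fin3all (k : Fin 3) (P : Fin 3 → Prop) : (∀ l, P l) ↔ P k ∧ P (k+1) ∧ P (k+2) := by
  constructor
  · intro h; exact ⟨h _, h _, h _⟩
  · rintro ⟨h0, h1, h2⟩ l
    rcases fin3 k l with rfl | rfl | rfl <;> assumption

theorem ang_edge {b : AB} {y : Pt} {k : Fin 3} (h : onEdge b k y) : ang b y = π := by
  obtain ⟨h0, h1, h2⟩ := h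
  have : D b y = {θ : Cir | 0 ≤ lc b k (ud θ)} := by
    ext θ
    rw [D, Set.mem_ofPred_eq, Set.mem_ofPred_eq, fin3all k]
    simp [h0, h1.le, h2.le, h1.ne', h2.ne']
  rw [ang, this, half_vol _ (lc_ne b k), ENNReal.toReal_ofReal (by positivity)]

theorem kne (k : Fin 3) : k ≠ k+1 ∧ k ≠ k+2 ∧ k+1 ≠ k+2 ∧ k + 1 ≠ k ∧ k + 2 ≠ k ∧ k + 2 ≠ k+1 := by
  revert k; decide

theorem ang_vert (b : AB) (k : Fin 3) : ang b (b k) = triAngle b k := by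
  obtain ⟨n1, n2, n3, n4, n5, n6⟩ := kne k
  have : D b (b k) = {θ : Cir | 0 ≤ lc b (k+1) (ud θ) ∧ 0 ≤ lc b (k+2) (ud θ)} := by
    ext θ
    rw [D, Set.mem_ofPred_eq, Set.mem_ofPred_eq, fin3all k]
    simp [co_ne b n4, co_ne b n5]
  rw [ang, this, cone_vol _ _ (b (k+1) - b k) (b (k+2) - b k), ENNReal.toReal_ofReal (InnerProductGeometry.angle_nonneg _ _)]
  · rfl
  · rw [lc_sub, co_self, co_ne b n4]; ring
  · rw [lc_sub, co_ne b n3, co_ne b n4]; ring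
  · rw [lc_sub, co_ne b n6, co_ne b n5]; ring
  · rw [lc_sub, co_self, co_ne b n5]; ring

open Classical in
theorem ang_eq (b : AB) (y : Pt) : ang b y =
    (∑ k, if b k = y then triAngle b k else 0) + (∑ k, if onEdge b k y then π else 0)
      + (if ∀ k, 0 < b.coord k y then 2 * π else 0) := by
  by_cases hv : ∃ k, b k = y
  · obtain ⟨k, rfl⟩ := hv
    obtain ⟨n1, n2, n3, n4, n5, n6⟩ := kne k
    rw [ang_vert, if_neg (fun h => by have := h (k+1); rw [co_ne b n4] at this; exact lt_irrefl _ this)]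
    rw [Finset.sum_eq_single k (fun l _ hl => if_neg (fun h => hl (b.ind.injective h))) (by simp), if_pos rfl]
    rw [Finset.sum_eq_zero]; · simp
    intro l _
    apply if_neg
    rintro ⟨h0, h1, h2⟩
    rcases fin3 k l with rfl | rfl | rfl
    · rw [co_self] at h0; linarith
    · rw [(k3 k).1, co_ne b n5] at h1; linarith
    · rw [(k3 k).2.2.2, co_ne b n4] at h2; linarith
  rw [Finset.sum_eq_zero (fun k _ => if_neg fun h => hv ⟨k, h⟩), zero_add]
  by_cases ho : ∃ k, b.coord k y < 0
  · obtain ⟨k, hk⟩ := ho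
    rw [ang_out hk, if_neg (fun h => by linarith [h k]), Finset.sum_eq_zero]; · simp
    intro l _
    apply if_neg
    rintro ⟨h0, h1, h2⟩
    rcases fin3 l k with rfl | rfl | rfl <;> linarith
  push Not at ho
  by_cases he : ∃ k, onEdge b k y
  · obtain ⟨k, hk⟩ := he
    rw [ang_edge hk, if_neg (fun h => by linarith [h k, hk.1]), Finset.sum_eq_single k, if_pos hk]
    · simp
    · intro l _ hl
      apply if_neg
      rintro ⟨h0, h1, h2⟩
      obtain ⟨g0, g1, g2⟩ := hk
      rcases fin3 k l with rfl | rfl | rfl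
      · exact hl rfl
      · linarith
      · linarith
    · simp
  rw [Finset.sum_eq_zero (fun k _ => if_neg fun h => he ⟨k, h⟩), zero_add]
  have : ∀ k, 0 < b.coord k y := by
    intro k
    by_contra hc
    have h0 : b.coord k y = 0 := le_antisymm (not_lt.1 hc) (ho k)
    obtain ⟨e1, e2, e3, e4⟩ := k3 k
    rcases (ho (k+1)).eq_or_lt with h1 | h1
    · exact hv ⟨k+2, (eq_vertex b (k+2) y (by rw [e2, h0]) (by rw [e4, h1])).symm⟩
    · rcases (ho (k+2)).eq_or_lt with h2 | h2
      · exact hv ⟨k+1, (eq_vertex b (k+1) y (by rw [e1, h2]) (by rw [e3, h0])).symm⟩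
      · exact he ⟨k, h0, h1, h2⟩
  rw [ang_int this, if_pos this]

structure Cfg (N : ℕ) where
  B : AB
  T : AB
  V : Fin N → AB
  hd : ∀ i k l, dist (V i k) (V i l) = dist (T k) (T l)
  disj : ∀ i j, i ≠ j → ∀ y, (∀ k, 0 < (V i).coord k y) → (∀ k, 0 < (V j).coord k y) → False
  cov : ∀ y, (∀ k, 0 ≤ B.coord k y) ↔ ∃ i, ∀ k, 0 ≤ (V i).coord k y
  hγ : π / 2 < triAngle T 2
  hlt : ∀ m, triAngle B m < triAngle T 2

namespace Cfg
variable {N : ℕ} (C : Cfg N)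

theorem ang_tile (i : Fin N) (k : Fin 3) : triAngle (C.V i) k = triAngle C.T k := by
  unfold triAngle EuclideanGeometry.angle InnerProductGeometry.angle
  simp only [real_inner_eq_norm_mul_self_add_norm_mul_self_sub_norm_sub_mul_self_div_two, vsub_eq_sub, sub_sub_sub_cancel_right, ← dist_eq_norm, C.hd]

theorem D_union (y : Pt) : (⋃ i, D (C.V i) y) = D C.B y := by
  ext θ
  rw [Set.mem_iUnion]
  constructor
  · rintro ⟨i, hi⟩
    apply D_of_freq
    apply Eventually.frequently
    filter_upwards [ev_of_D hi] with ε hε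
    exact (C.cov _).2 ⟨i, hε⟩
  · intro h
    by_contra hc
    push Not at hc
    have h1 : ∀ i, ∀ᶠ ε in 𝓝[>] (0:ℝ), ¬ ∀ k, 0 ≤ (C.V i).coord k (y + ε • ud θ) := by
      intro i
      by_contra h'
      exact hc i (D_of_freq h')
    rw [← eventually_all] at h1
    obtain ⟨ε, h2, h3⟩ := (h1.and (ev_of_D h)).exists
    obtain ⟨i, hi⟩ := (C.cov _).1 h3
    exact h2 i hi

theorem ang_sum (y : Pt) : ∑ i, ang (C.V i) y = ang C.B y := by
  unfold ang
  rw [← C.D_union y, measure_iUnion₀ _ (fun i => (D_meas _ _).nullMeasurableSet), tsum_fintype, ENNReal.toReal_sum]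
  · intro i _; exact measure_ne_top _ _
  · intro i j hij
    have : D (C.V i) y ∩ D (C.V j) y ⊆ (⋃ k, {θ | lc (C.V i) k (ud θ) = 0}) ∪ (⋃ k, {θ | lc (C.V j) k (ud θ) = 0}) := by
      rintro θ ⟨h1, h2⟩
      by_contra hc
      simp only [Set.mem_union, Set.mem_iUnion, Set.mem_ofPred_eq, not_or, not_exists] at hc
      obtain ⟨ε, h3, h4⟩ := ((evpos h1 hc.1).and (evpos h2 hc.2)).exists
      exact C.disj i j hij _ h3 h4
    refine measure_mono_null this (measure_union_null ?_ ?_) <;>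
    exact measure_iUnion_null fun k => null_vol _ (lc_ne _ k)

open Classical in
def Nv (k : Fin 3) (y : Pt) : ℕ := (Finset.univ.filter fun i => C.V i k = y).card
open Classical in
def Ne (y : Pt) : ℕ := (Finset.univ.filter fun e : Fin N × Fin 3 => onEdge (C.V e.1) e.2 y).card
open Classical in
def Nf (y : Pt) : ℕ := (Finset.univ.filter fun i => ∀ k, 0 < (C.V i).coord k y).card

theorem count (y : Pt) : C.Nv 0 y * triAngle C.T 0 + C.Nv 1 y * triAngle C.T 1 + C.Nv 2 y * triAngle C.T 2
    + C.Ne y * π + C.Nf y * (2 * π) = ang C.B y := by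
  classical
  rw [← C.ang_sum]
  simp only [ang_eq, ang_tile]
  rw [Finset.sum_add_distrib, Finset.sum_add_distrib, Finset.sum_comm, Fin.sum_univ_three]
  rw [← Finset.sum_product']
  simp only [← Finset.sum_filter, Finset.sum_const, nsmul_eq_mul, Nv, Ne, Nf, Finset.univ_product_univ]

end Cfg
end Part3

section Part4
open MeasureTheory

theorem aff_eq (b : AB) (f : Pt →ᵃ[ℝ] ℝ) (k : Fin 3) (y : Pt) :
    f y = b.coord k y * f (b k) + b.coord (k+1) y * f (b (k+1)) + b.coord (k+2) y * f (b (k+2)) := by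
  have hy : y = b k + b.coord (k+1) y • (b (k+1) - b k) + b.coord (k+2) y • (b (k+2) - b k) := by
    obtain ⟨n1, n2, n3, n4, n5, n6⟩ := kne k
    apply co_ext b
    rw [fin3all k]
    simp only [co_add, lc_sub, co_self, co_ne b n1, co_ne b n2, co_ne b n3, co_ne b n4, co_ne b n5, co_ne b n6]
    have := co_sum' b k y
    refine ⟨by linarith, by ring, by ring⟩
  have hf : ∀ (z v : Pt) (c : ℝ), f (z + c • v) = f z + c * f.linear v := by
    intro z v c
    have := f.map_vadd z (c • v)
    simp only [vadd_eq_add, map_smul, smul_eq_mul] at this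
    rw [add_comm z, this]; ring
  have hs : ∀ x z : Pt, f.linear (x - z) = f x - f z := by
    intro x z; simpa using f.linearMap_vsub x z
  have := co_sum' b k y
  conv_lhs => rw [hy]
  rw [hf, hf, hs, hs]
  linear_combination (- f (b k)) * this

theorem ang_le (b : AB) (y : Pt) : ang b y ≤ 2 * π := by
  have h : volume (D b y) ≤ ENNReal.ofReal (2 * π) := by
    rw [← AddCircle.measure_univ]; exact measure_mono (Set.subset_univ _)
  unfold ang
  have := ENNReal.toReal_mono ENNReal.ofReal_ne_top h
  rwa [ENNReal.toReal_ofReal (by positivity)] at this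

theorem ang_le_pi (b : AB) (y : Pt) (k : Fin 3) (hk : b.coord k y = 0) : ang b y ≤ π := by
  have h : volume (D b y) ≤ ENNReal.ofReal π := by
    rw [← half_vol _ (lc_ne b k)]; exact measure_mono fun θ hθ => (hθ k).2 hk
  unfold ang
  have := ENNReal.toReal_mono ENNReal.ofReal_ne_top h
  rwa [ENNReal.toReal_ofReal (by positivity)] at this

theorem not_col (b : AB) (k : Fin 3) : ¬ Collinear ℝ {b (k+1), b k, b (k+2)} := by
  rw [← affineIndependent_iff_not_collinear_set]
  have := b.ind.comp_embedding (⟨![k+1, k, k+2], by revert k; decide⟩ : Fin 3 ↪ Fin 3)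
  have e : ![b (k+1), b k, b (k+2)] = b ∘ ![k+1, k, k+2] := by
    funext i; fin_cases i <;> rfl
  rw [e]; exact this

theorem tri_pos (b : AB) (k : Fin 3) : 0 < triAngle b k := by
  have h := not_col b k
  rw [collinear_iff_eq_or_eq_or_angle_eq_zero_or_angle_eq_pi] at h
  push Not at h
  exact lt_of_le_of_ne (EuclideanGeometry.angle_nonneg _ _ _) (Ne.symm h.2.2.1)

theorem tri_sum (b : AB) : triAngle b 0 + triAngle b 1 + triAngle b 2 = π := by
  have := EuclideanGeometry.angle_add_angle_add_angle_eq_pi (p₁ := b 0) (p₂ := b 1) (b 2) (fun h => by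
    have := b.ind.injective h; revert this; decide)
  unfold triAngle
  simp only [Fin.isValue, zero_add, show (1+1:Fin 3) = 2 by decide, show (1+2:Fin 3) = 0 by decide, show (2+1:Fin 3) = 0 by decide, show (2+2:Fin 3) = 1 by decide]
  rw [EuclideanGeometry.angle_comm (b 1) (b 0) (b 2), EuclideanGeometry.angle_comm (b 2) (b 1) (b 0), EuclideanGeometry.angle_comm (b 0) (b 2) (b 1)]
  linarith

namespace Cfg
variable {N : ℕ} (C : Cfg N)

def α : ℝ := triAngle C.T 0
def β : ℝ := triAngle C.T 1
def γ : ℝ := triAngle C.T 2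

theorem αpos : 0 < C.α := tri_pos _ _
theorem βpos : 0 < C.β := tri_pos _ _
theorem γpos : 0 < C.γ := tri_pos _ _
theorem abg : C.α + C.β + C.γ = π := tri_sum _
theorem γgt : π / 2 < C.γ := C.hγ
theorem Blt (m : Fin 3) : triAngle C.B m < C.γ := C.hlt m
theorem γlt : C.γ < π := by have := C.αpos; have := C.βpos; have := C.abg; linarith

theorem cnt (y : Pt) : C.Nv 0 y * C.α + C.Nv 1 y * C.β + C.Nv 2 y * C.γ
    + C.Ne y * π + C.Nf y * (2 * π) = ang C.B y := C.count y

theorem Nv_pos {k : Fin 3} {y : Pt} {i : Fin N} (h : C.V i k = y) : 1 ≤ C.Nv k y := by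
  classical
  unfold Nv
  rw [Nat.one_le_iff_ne_zero, ← Nat.pos_iff_ne_zero, Finset.card_pos]
  exact ⟨i, by simp [h]⟩

theorem Nv_card {k : Fin 3} {y : Pt} (s : Finset (Fin N)) (h : ∀ i ∈ s, C.V i k = y) : s.card ≤ C.Nv k y := by
  classical
  unfold Nv
  apply Finset.card_le_card
  intro i hi
  simp [h i hi]

theorem Nv_two {k : Fin 3} {y : Pt} {i j : Fin N} (hij : i ≠ j) (h : C.V i k = y) (h' : C.V j k = y) : 2 ≤ C.Nv k y := by
  classical
  have := C.Nv_card (k := k) (y := y) {i, j} (by simp [h, h'])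
  rwa [Finset.card_pair hij] at this

theorem Nv_ex {k : Fin 3} {y : Pt} (h : 1 ≤ C.Nv k y) : ∃ i, C.V i k = y := by
  classical
  unfold Nv at h
  obtain ⟨i, hi⟩ := Finset.card_pos.1 h
  exact ⟨i, by simpa using hi⟩

theorem Ne_pos {k : Fin 3} {y : Pt} {i : Fin N} (h : onEdge (C.V i) k y) : 1 ≤ C.Ne y := by
  classical
  unfold Ne
  rw [Nat.one_le_iff_ne_zero, ← Nat.pos_iff_ne_zero, Finset.card_pos]
  exact ⟨(i, k), by simp [h]⟩

theorem Ne_two {y : Pt} {e e' : Fin N × Fin 3} (hij : e ≠ e') (h : onEdge (C.V e.1) e.2 y) (h' : onEdge (C.V e'.1) e'.2 y) : 2 ≤ C.Ne y := by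
  classical
  unfold Ne
  rw [← Finset.card_pair hij]
  apply Finset.card_le_card
  intro i hi
  simp only [Finset.mem_insert, Finset.mem_singleton] at hi
  rcases hi with rfl | rfl <;> simp [h, h']

theorem inB (i : Fin N) (y : Pt) (h : ∀ k, 0 ≤ (C.V i).coord k y) (k : Fin 3) : 0 ≤ C.B.coord k y :=
  (C.cov y).2 ⟨i, h⟩ k

theorem vB (i : Fin N) (l k : Fin 3) : 0 ≤ C.B.coord k (C.V i l) := by
  apply C.inB i
  intro m
  by_cases h : m = l
  · subst h; rw [co_self]; norm_num
  · rw [co_ne _ h]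

theorem corner (m : Fin 3) : C.Nv 2 (C.B m) = 0 ∧ C.Ne (C.B m) = 0 ∧ C.Nf (C.B m) = 0 ∧
    C.Nv 0 (C.B m) * C.α + C.Nv 1 (C.B m) * C.β = triAngle C.B m := by
  have h := C.cnt (C.B m)
  rw [ang_vert] at h
  have h1 := C.Blt m
  have := C.αpos; have := C.βpos; have := C.γpos; have := C.γlt
  have a0 : (0:ℝ) ≤ C.Nv 0 (C.B m) * C.α := by positivity
  have a1 : (0:ℝ) ≤ C.Nv 1 (C.B m) * C.β := by positivity
  have a2 : (0:ℝ) ≤ C.Nv 2 (C.B m) * C.γ := by positivity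
  have a3 : (0:ℝ) ≤ C.Ne (C.B m) * π := by positivity
  have a4 : (0:ℝ) ≤ C.Nf (C.B m) * (2*π) := by positivity
  have b2 : C.Nv 2 (C.B m) = 0 := by
    by_contra hc
    have : (1:ℝ) ≤ C.Nv 2 (C.B m) := by exact_mod_cast Nat.one_le_iff_ne_zero.2 hc
    nlinarith
  have b3 : C.Ne (C.B m) = 0 := by
    by_contra hc
    have : (1:ℝ) ≤ C.Ne (C.B m) := by exact_mod_cast Nat.one_le_iff_ne_zero.2 hc
    nlinarith
  have b4 : C.Nf (C.B m) = 0 := by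
    by_contra hc
    have : (1:ℝ) ≤ C.Nf (C.B m) := by exact_mod_cast Nat.one_le_iff_ne_zero.2 hc
    nlinarith [Real.pi_pos]
  refine ⟨b2, b3, b4, ?_⟩
  rw [b2, b3, b4] at h
  push_cast at h
  linarith

def Pa : ℕ := C.Nv 0 (C.B 0) + C.Nv 0 (C.B 1) + C.Nv 0 (C.B 2)
def Qb : ℕ := C.Nv 1 (C.B 0) + C.Nv 1 (C.B 1) + C.Nv 1 (C.B 2)

theorem PQ : C.Pa * C.α + C.Qb * C.β = π := by
  have h0 := (C.corner 0).2.2.2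
  have h1 := (C.corner 1).2.2.2
  have h2 := (C.corner 2).2.2.2
  have := tri_sum C.B
  unfold Pa Qb
  push_cast
  linarith

def HI : Prop := ∀ x y : ℤ, x * C.α + y * C.β = 0 → x = 0 ∧ y = 0

theorem HI_of_irr (h : ¬ ∃ q : ℚ, C.α = (q : ℝ) * π) : C.HI := by
  intro x y hxy
  have hPQ := C.PQ
  have hπ := Real.pi_pos
  have key : x * (C.Qb : ℤ) = y * (C.Pa : ℤ) := by
    by_contra hc
    apply h
    have hne : (x * (C.Qb : ℝ) - y * (C.Pa : ℝ)) ≠ 0 := by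
      intro h'; apply hc; have : (x * (C.Qb : ℝ)) = y * (C.Pa : ℝ) := by linarith
      exact_mod_cast this
    refine ⟨(-y : ℚ) / (x * C.Qb - y * C.Pa), ?_⟩
    push_cast
    rw [div_mul_eq_mul_div, eq_div_iff hne, ← hPQ]
    linear_combination C.Qb * hxy
  have key' : (x : ℝ) * C.Qb = y * C.Pa := by exact_mod_cast key
  have e1 : (x : ℝ) * π = 0 := by rw [← hPQ]; linear_combination C.Pa * hxy + C.β * key'
  have e2 : (y : ℝ) * π = 0 := by rw [← hPQ]; linear_combination C.Qb * hxy - C.α * key'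
  constructor
  · have := (mul_eq_zero.1 e1).resolve_right hπ.ne'; exact_mod_cast this
  · have := (mul_eq_zero.1 e2).resolve_right hπ.ne'; exact_mod_cast this

theorem HI.nat {C : Cfg N} (h : C.HI) {x y x' y' : ℕ} (e : x * C.α + y * C.β = x' * C.α + y' * C.β) : x = x' ∧ y = y' := by
  have := h (x - x') (y - y') (by push_cast; linarith)
  omega

theorem straight (hHI : C.HI) {y : Pt} (hy : ang C.B y = π) (h2 : 1 ≤ C.Nv 2 y) :
    C.Nv 0 y = 1 ∧ C.Nv 1 y = 1 ∧ C.Nv 2 y = 1 ∧ C.Ne y = 0 := by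
  have h := C.cnt y
  rw [hy] at h
  have := C.αpos; have := C.βpos; have := C.γpos; have := C.γgt; have := C.abg
  have a0 : (0:ℝ) ≤ C.Nv 0 y * C.α := by positivity
  have a1 : (0:ℝ) ≤ C.Nv 1 y * C.β := by positivity
  have h2' : (1:ℝ) ≤ C.Nv 2 y := by exact_mod_cast h2
  have a3 : (0:ℝ) ≤ C.Ne y * π := by positivity
  have a4 : (0:ℝ) ≤ C.Nf y * (2*π) := by positivity
  have b3 : C.Ne y = 0 := by
    by_contra hc
    have : (1:ℝ) ≤ C.Ne y := by exact_mod_cast Nat.one_le_iff_ne_zero.2 hc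
    nlinarith
  have b4 : C.Nf y = 0 := by
    by_contra hc
    have : (1:ℝ) ≤ C.Nf y := by exact_mod_cast Nat.one_le_iff_ne_zero.2 hc
    nlinarith [Real.pi_pos]
  have b2 : C.Nv 2 y = 1 := by
    by_contra hc
    have : 2 ≤ C.Nv 2 y := by omega
    have : (2:ℝ) ≤ C.Nv 2 y := by exact_mod_cast this
    nlinarith
  rw [b2, b3, b4] at h
  push_cast at h
  have := hHI.nat (x := C.Nv 0 y) (y := C.Nv 1 y) (x' := 1) (y' := 1) (by push_cast; linarith)
  exact ⟨this.1, this.2, b2, b3⟩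

structure EChain (b : AB) (k0 : Fin 3) (I : Finset (Fin N × Fin 3)) : Prop where
  h1 : ∀ e ∈ I, ∀ v, (v = C.V e.1 (e.2+1) ∨ v = C.V e.1 (e.2+2)) →
    b.coord k0 v = 0 ∧ 0 ≤ b.coord (k0+1) v ∧ 0 ≤ b.coord (k0+2) v
  h2 : ∀ e ∈ I, ∀ e' ∈ I, e ≠ e' → ∀ y, onEdge (C.V e.1) e.2 y → onEdge (C.V e'.1) e'.2 y → False
  h3 : ∀ y, onEdge b k0 y → (∀ j k, C.V j k ≠ y) → ∃ e ∈ I, onEdge (C.V e.1) e.2 y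

namespace EChain
variable {C} {b : AB} {k0 : Fin 3} {I : Finset (Fin N × Fin 3)}

def sl (C : Cfg N) (b : AB) (k0 : Fin 3) (e : Fin N × Fin 3) : ℝ :=
  min (b.coord (k0+2) (C.V e.1 (e.2+1))) (b.coord (k0+2) (C.V e.1 (e.2+2)))
def sr (C : Cfg N) (b : AB) (k0 : Fin 3) (e : Fin N × Fin 3) : ℝ :=
  max (b.coord (k0+2) (C.V e.1 (e.2+1))) (b.coord (k0+2) (C.V e.1 (e.2+2)))

theorem edge_ext {x y : Pt} (hx : b.coord k0 x = 0) (hy : b.coord k0 y = 0) (h : b.coord (k0+2) x = b.coord (k0+2) y) : x = y := by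
  apply co_ext b
  rw [fin3all k0]
  have := co_sum' b k0 x
  have := co_sum' b k0 y
  exact ⟨by rw [hx, hy], by linarith, h⟩

theorem lm_co (p q : Pt) (t : ℝ) (b : AB) (k : Fin 3) :
    b.coord k (AffineMap.lineMap p q t) = (1 - t) * b.coord k p + t * b.coord k q := by
  rw [AffineMap.lineMap_apply, vsub_eq_sub, vadd_eq_add, add_comm, co_add, lc_sub]; ring

theorem eq_lm {x : Pt} (hx : b.coord k0 x = 0) :
    x = AffineMap.lineMap (b (k0+1)) (b (k0+2)) (b.coord (k0+2) x) := by
  obtain ⟨n1, n2, n3, n4, n5, n6⟩ := kne k0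
  apply edge_ext (b := b) (k0 := k0) hx
  · rw [lm_co, co_ne _ n1, co_ne _ n2]; ring
  · rw [lm_co, co_ne _ n6, co_self]; ring

theorem slsr (h : C.EChain b k0 I) {e} (he : e ∈ I) : sl C b k0 e < sr C b k0 e := by
  unfold sl sr
  rw [min_lt_max]
  intro hc
  have := edge_ext (h.h1 e he _ (Or.inl rfl)).1 (h.h1 e he _ (Or.inr rfl)).1 hc
  exact (kne e.2).2.2.1 ((C.V e.1).ind.injective this)

theorem mem_Ioo (h : C.EChain b k0 I) {e} (he : e ∈ I) {y : Pt} (hy : onEdge (C.V e.1) e.2 y) :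
    b.coord k0 y = 0 ∧ b.coord (k0+2) y ∈ Set.Ioo (sl C b k0 e) (sr C b k0 e) := by
  obtain ⟨g0, g1, g2⟩ := hy
  have hs := co_sum' (C.V e.1) e.2 y
  have f0 := aff_eq (C.V e.1) (b.coord k0) e.2 y
  have f2 := aff_eq (C.V e.1) (b.coord (k0+2)) e.2 y
  rw [(h.h1 e he _ (Or.inl rfl)).1, (h.h1 e he _ (Or.inr rfl)).1, g0] at f0
  rw [g0] at f2
  refine ⟨by rw [f0]; ring, ?_⟩
  have hlt := h.slsr he
  unfold sl sr at *
  generalize b.coord (k0+2) (C.V e.1 (e.2+1)) = p at *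
  generalize b.coord (k0+2) (C.V e.1 (e.2+2)) = q at *
  rw [f2]
  generalize (C.V e.1).coord (e.2+1) y = s at *
  generalize (C.V e.1).coord (e.2+2) y = t at *
  have hs' : s = 1 - t := by linarith
  subst hs'
  rcases le_total p q with hpq | hpq
  · rw [min_eq_left hpq, max_eq_right hpq] at *
    constructor <;> nlinarith
  · rw [min_eq_right hpq, max_eq_left hpq] at *
    constructor <;> nlinarith

theorem of_Ioo (h : C.EChain b k0 I) {e} (he : e ∈ I) {y : Pt} (hy0 : b.coord k0 y = 0)
    (hy : b.coord (k0+2) y ∈ Set.Ioo (sl C b k0 e) (sr C b k0 e)) : onEdge (C.V e.1) e.2 y := by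
  have hlt := h.slsr he
  obtain ⟨n1, n2, n3, n4, n5, n6⟩ := kne e.2
  have c1 := (h.h1 e he _ (Or.inl rfl)).1
  have c2 := (h.h1 e he _ (Or.inr rfl)).1
  set p := b.coord (k0+2) (C.V e.1 (e.2+1)) with hp
  set q := b.coord (k0+2) (C.V e.1 (e.2+2)) with hq
  have hl : sl C b k0 e = min p q := rfl
  have hr : sr C b k0 e = max p q := rfl
  rw [hl, hr] at hy hlt
  have hne : q - p ≠ 0 := by
    intro h0
    have : q = p := by linarith
    rw [this] at hlt; simp at hlt
  set t := (b.coord (k0+2) y - p) / (q - p) with ht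
  have e2 : b.coord (k0+2) y = p + t * (q - p) := by rw [ht]; field_simp; ring
  have hyy : y = AffineMap.lineMap (C.V e.1 (e.2+1)) (C.V e.1 (e.2+2)) t := by
    apply edge_ext (b := b) (k0 := k0) hy0
    · rw [lm_co, c1, c2]; ring
    · rw [lm_co, e2, ← hp, ← hq]; ring
  have t01 : 0 < t ∧ t < 1 := by
    obtain ⟨y1, y2⟩ := hy
    rw [e2] at y1 y2
    rcases le_total p q with hpq | hpq
    · rw [min_eq_left hpq, max_eq_right hpq] at *
      constructor <;> nlinarith
    · rw [min_eq_right hpq, max_eq_left hpq] at *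
      constructor <;> nlinarith
  refine ⟨?_, ?_, ?_⟩
  · rw [hyy, lm_co, co_ne _ n1, co_ne _ n2]; ring
  · rw [hyy, lm_co, co_self, co_ne _ n3]; linarith
  · rw [hyy, lm_co, co_self, co_ne _ n6]; linarith

theorem chain1 (h : C.EChain b k0 I) : Chain1 I (sl C b k0) (sr C b k0)
    (Set.range fun x : Fin N × Fin 3 => b.coord (k0+2) (C.V x.1 x.2)) where
  bd := by
    intro e he
    obtain ⟨a0, a1, a2⟩ := h.h1 e he _ (Or.inl rfl)
    obtain ⟨b0, b1, b2⟩ := h.h1 e he _ (Or.inr rfl)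
    have := co_sum' b k0 (C.V e.1 (e.2+1))
    have := co_sum' b k0 (C.V e.1 (e.2+2))
    exact ⟨le_min a2 b2, h.slsr he, max_le (by linarith) (by linarith)⟩
  dj := by
    intro e he e' he' hne t ht ht'
    obtain ⟨n1, n2, n3, n4, n5, n6⟩ := kne k0
    have y0 : b.coord k0 (AffineMap.lineMap (b (k0+1)) (b (k0+2)) t) = 0 := by
      rw [lm_co, co_ne _ n1, co_ne _ n2]; ring
    have y2 : b.coord (k0+2) (AffineMap.lineMap (b (k0+1)) (b (k0+2)) t) = t := by
      rw [lm_co, co_ne _ n6, co_self]; ring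
    exact h.h2 e he e' he' hne _ (h.of_Ioo he y0 (by rwa [y2])) (h.of_Ioo he' y0 (by rwa [y2]))
  fin := Set.finite_range _
  cov := by
    intro t ht htF
    obtain ⟨n1, n2, n3, n4, n5, n6⟩ := kne k0
    set y := AffineMap.lineMap (b (k0+1)) (b (k0+2)) t with hy
    have y0 : b.coord k0 y = 0 := by
      rw [lm_co, co_ne _ n1, co_ne _ n2]; ring
    have y2 : b.coord (k0+2) y = t := by
      rw [lm_co, co_ne _ n6, co_self]; ring
    have y1 : b.coord (k0+1) y = 1 - t := by
      rw [lm_co, co_ne _ n3, co_self]; ring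
    obtain ⟨e, he, hee⟩ := h.h3 y ⟨y0, by rw [y1]; linarith [ht.2], by rw [y2]; exact ht.1⟩ (by
      intro j k hjk; apply htF; exact ⟨(j, k), by simp only [hjk, y2]⟩)
    exact ⟨e, he, by have := (h.mem_Ioo he hee).2; rwa [y2] at this⟩

theorem len (h : C.EChain b k0 I) : dist (b (k0+1)) (b (k0+2)) = ∑ e ∈ I, sideLen C.T e.2 := by
  have hs := h.chain1.sum_len
  have : ∀ e ∈ I, sideLen C.T e.2 = (sr C b k0 e - sl C b k0 e) * dist (b (k0+1)) (b (k0+2)) := by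
    intro e he
    unfold sideLen
    rw [← C.hd e.1]
    have e1 := eq_lm (h.h1 e he _ (Or.inl rfl)).1
    have e2 := eq_lm (h.h1 e he _ (Or.inr rfl)).1
    conv_lhs => rw [e1, e2]
    rw [dist_lineMap_lineMap, Real.dist_eq]
    unfold sl sr
    rw [max_sub_min_eq_abs', ]
  rw [Finset.sum_congr rfl this, ← Finset.sum_mul, hs, one_mul]

theorem end_p {v : Pt} (h0 : b.coord k0 v = 0) : b.coord (k0+2) v = 0 ↔ v = b (k0+1) := by
  obtain ⟨n1, n2, n3, n4, n5, n6⟩ := kne k0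
  constructor
  · intro h; apply edge_ext h0 (co_ne _ n1); rw [h, co_ne _ n6]
  · rintro rfl; exact co_ne _ n6

theorem end_q {v : Pt} (h0 : b.coord k0 v = 0) : b.coord (k0+2) v = 1 ↔ v = b (k0+2) := by
  obtain ⟨n1, n2, n3, n4, n5, n6⟩ := kne k0
  constructor
  · intro h; apply edge_ext h0 (co_ne _ n2); rw [h, co_self]
  · rintro rfl; exact co_self _ _

theorem ex_p (h : C.EChain b k0 I) : ∃ e ∈ I, C.V e.1 (e.2+1) = b (k0+1) ∨ C.V e.1 (e.2+2) = b (k0+1) := by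
  obtain ⟨e, he, h0⟩ := h.chain1.ex_left
  refine ⟨e, he, ?_⟩
  rw [← end_p (h.h1 e he _ (Or.inl rfl)).1, ← end_p (h.h1 e he _ (Or.inr rfl)).1]
  unfold sl at h0
  rcases min_choice (b.coord (k0+2) (C.V e.1 (e.2+1))) (b.coord (k0+2) (C.V e.1 (e.2+2))) with h | h
  · left; rw [← h, h0]
  · right; rw [← h, h0]

theorem ex_q (h : C.EChain b k0 I) : ∃ e ∈ I, C.V e.1 (e.2+1) = b (k0+2) ∨ C.V e.1 (e.2+2) = b (k0+2) := by
  obtain ⟨e, he, h0⟩ := h.chain1.ex_right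
  refine ⟨e, he, ?_⟩
  rw [← end_q (h.h1 e he _ (Or.inl rfl)).1, ← end_q (h.h1 e he _ (Or.inr rfl)).1]
  unfold sr at h0
  rcases max_choice (b.coord (k0+2) (C.V e.1 (e.2+1))) (b.coord (k0+2) (C.V e.1 (e.2+2))) with h | h
  · left; rw [← h, h0]
  · right; rw [← h, h0]

theorem two_end {k : Fin 3} (h : k ≠ 2) : (2 : Fin 3) = k+1 ∨ (2 : Fin 3) = k+2 := by
  revert k; decide

theorem pig (h : C.EChain b k0 I) (hp : ∀ e ∈ I, e.2 ≠ 2 → C.V e.1 2 ≠ b (k0+1))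
    (hq : ∀ e ∈ I, e.2 ≠ 2 → C.V e.1 2 ≠ b (k0+2))
    (hinj : ∀ e ∈ I, ∀ e' ∈ I, e.2 ≠ 2 → e'.2 ≠ 2 → C.V e.1 2 = C.V e'.1 2 → e = e') :
    (∃ e ∈ I, e.2 = 2) ∧ ((∀ e ∈ I, ∀ e' ∈ I, e.2 = 2 → e'.2 = 2 → e = e') →
      ∀ e ∈ I, ∀ v, (v = C.V e.1 (e.2+1) ∨ v = C.V e.1 (e.2+2)) → v ≠ b (k0+1) → v ≠ b (k0+2) →
        ∃ s ∈ I, s.2 ≠ 2 ∧ C.V s.1 2 = v) := by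
  classical
  set S := I.filter fun e => e.2 ≠ 2 with hS
  have hv : ∀ e ∈ S, C.V e.1 2 = C.V e.1 (e.2+1) ∨ C.V e.1 2 = C.V e.1 (e.2+2) := by
    intro e he
    rcases two_end (Finset.mem_filter.1 he).2 with h | h
    · left; rw [← h]
    · right; rw [← h]
  have hv0 : ∀ e ∈ S, b.coord k0 (C.V e.1 2) = 0 := fun e he => (h.h1 e (Finset.mem_filter.1 he).1 _ (hv e he)).1
  have P := h.chain1.pigeon (fun e => b.coord (k0+2) (C.V e.1 2)) S (Finset.filter_subset _ _) (by
      intro e he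
      simp only [sl, sr]
      rcases hv e he with hh | hh <;> rw [hh]
      · rcases le_total (b.coord (k0+2) (C.V e.1 (e.2+1))) (b.coord (k0+2) (C.V e.1 (e.2+2))) with g | g
        · left; rw [min_eq_left g]
        · right; rw [max_eq_left g]
      · rcases le_total (b.coord (k0+2) (C.V e.1 (e.2+1))) (b.coord (k0+2) (C.V e.1 (e.2+2))) with g | g
        · right; rw [max_eq_right g]
        · left; rw [min_eq_right g]) (by
      intro e he h0
      exact hp e (Finset.mem_filter.1 he).1 (Finset.mem_filter.1 he).2 ((end_p (hv0 e he)).1 h0)) (by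
      intro e he h0
      exact hq e (Finset.mem_filter.1 he).1 (Finset.mem_filter.1 he).2 ((end_q (hv0 e he)).1 h0)) (by
      intro e he e' he' hee
      exact hinj e (Finset.mem_filter.1 he).1 e' (Finset.mem_filter.1 he').1 (Finset.mem_filter.1 he).2 (Finset.mem_filter.1 he').2
        (edge_ext (hv0 e he) (hv0 e' he') hee))
  have hsplit : S.card + (I.filter fun e => ¬ e.2 ≠ 2).card = I.card := by
    rw [hS]; convert Finset.card_filter_add_card_filter_not (s := I) (fun e => e.2 ≠ 2)
  obtain ⟨P1, P2⟩ := P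
  have hpos : 0 < (I.filter fun e => ¬ e.2 ≠ 2).card := by omega
  obtain ⟨e0, he0⟩ := Finset.card_pos.1 hpos
  rw [Finset.mem_filter, not_not] at he0
  refine ⟨⟨e0, he0⟩, ?_⟩
  intro huniq e he v hv' vp vq
  have hc1 : (I.filter fun e => ¬ e.2 ≠ 2).card ≤ 1 := by
    rw [Finset.card_le_one]
    intro x hx y hy
    rw [Finset.mem_filter, not_not] at hx hy
    exact huniq x hx.1 y hy.1 hx.2 hy.2
  obtain ⟨Q1, Q2⟩ := P2 (by omega) e he
  have v0 := (h.h1 e he v hv').1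
  have hvs : b.coord (k0+2) v = sl C b k0 e ∨ b.coord (k0+2) v = sr C b k0 e := by
    unfold sl sr
    rcases hv' with rfl | rfl
    · rcases le_total (b.coord (k0+2) (C.V e.1 (e.2+1))) (b.coord (k0+2) (C.V e.1 (e.2+2))) with g | g
      · left; rw [min_eq_left g]
      · right; rw [max_eq_left g]
    · rcases le_total (b.coord (k0+2) (C.V e.1 (e.2+1))) (b.coord (k0+2) (C.V e.1 (e.2+2))) with g | g
      · right; rw [max_eq_right g]
      · left; rw [min_eq_right g]
  have : ∃ s ∈ S, b.coord (k0+2) (C.V s.1 2) = b.coord (k0+2) v := by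
    rcases hvs with g | g
    · rw [g]; exact Q1 (by rw [← g]; exact fun h' => vp ((end_p v0).1 h'))
    · rw [g]; exact Q2 (by rw [← g]; exact fun h' => vq ((end_q v0).1 h'))
  obtain ⟨s, hs, hss⟩ := this
  exact ⟨s, (Finset.mem_filter.1 hs).1, (Finset.mem_filter.1 hs).2, edge_ext (hv0 s hs) v0 hss⟩

end EChain
end Cfg
end Part4

section Part5
open Filter Topology

theorem tricho {b : AB} {y : Pt} (h : ∀ k, 0 ≤ b.coord k y) :
    (∃ k, b k = y) ∨ (∃ k, onEdge b k y) ∨ ∀ k, 0 < b.coord k y := by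
  by_cases hv : ∃ k, b k = y
  · exact Or.inl hv
  right
  by_cases he : ∃ k, onEdge b k y
  · exact Or.inl he
  right
  intro k
  by_contra hc
  have h0 : b.coord k y = 0 := le_antisymm (not_lt.1 hc) (h k)
  obtain ⟨e1, e2, e3, e4⟩ := k3 k
  rcases (h (k+1)).eq_or_lt with h1 | h1
  · exact hv ⟨k+2, (eq_vertex b (k+2) y (by rw [e2, h0]) (by rw [e4, h1])).symm⟩
  · rcases (h (k+2)).eq_or_lt with h2 | h2
    · exact hv ⟨k+1, (eq_vertex b (k+1) y (by rw [e1, h2]) (by rw [e3, h0])).symm⟩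
    · exact he ⟨k, h0, h1, h2⟩

theorem edge_val {b : AB} {k : Fin 3} {y : Pt} (h : onEdge b k y) (f : Pt →ᵃ[ℝ] ℝ) :
    f y = b.coord (k+1) y * f (b (k+1)) + b.coord (k+2) y * f (b (k+2)) := by
  have := aff_eq b f k y
  rw [h.1] at this; linarith

theorem edge_flat {b : AB} {k : Fin 3} {y : Pt} (h : onEdge b k y) (f : Pt →ᵃ[ℝ] ℝ)
    (h1 : 0 ≤ f (b (k+1))) (h2 : 0 ≤ f (b (k+2))) (h0 : f y = 0) : f (b (k+1)) = 0 ∧ f (b (k+2)) = 0 := by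
  have := edge_val h f
  have a := mul_nonneg h.2.1.le h1
  have b' := mul_nonneg h.2.2.le h2
  constructor
  · exact (mul_eq_zero.1 (by linarith : b.coord (k+1) y * f (b (k+1)) = 0)).resolve_left h.2.1.ne'
  · exact (mul_eq_zero.1 (by linarith : b.coord (k+2) y * f (b (k+2)) = 0)).resolve_left h.2.2.ne'

theorem not_flat (b b' : AB) (k' k : Fin 3) (h0 : b'.coord k' (b k) = 0) (h1 : b'.coord k' (b (k+1)) = 0)
    (h2 : b'.coord k' (b (k+2)) = 0) : False := by
  have := aff_eq b (b'.coord k') k (b' k')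
  rw [h0, h1, h2, co_self] at this
  linarith

theorem two_edges_flat (b b' : AB) (k' : Fin 3) {k l : Fin 3} (hkl : k ≠ l) (h1 : b'.coord k' (b (k+1)) = 0)
    (h2 : b'.coord k' (b (k+2)) = 0) (h3 : b'.coord k' (b (l+1)) = 0)
    (h4 : b'.coord k' (b (l+2)) = 0) : False := by
  apply not_flat b b' k' k _ h1 h2
  have : k = l + 1 ∨ k = l + 2 := by rcases fin3 l k with h | h | h; exacts [absurd h hkl, Or.inl h, Or.inr h]
  rcases this with rfl | rfl <;> assumption

theorem edge_uniq {b : AB} {k l : Fin 3} {y : Pt} (h : onEdge b k y) (h' : onEdge b l y) : k = l := by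
  obtain ⟨h0, h1, h2⟩ := h
  obtain ⟨g0, g1, g2⟩ := h'
  rcases fin3 k l with rfl | rfl | rfl
  · rfl
  · linarith
  · linarith

theorem edge_not_vertex {b : AB} {k l : Fin 3} (h : onEdge b k (b l)) : False := by
  obtain ⟨h0, h1, h2⟩ := h
  obtain ⟨n1, n2, n3, n4, n5, n6⟩ := kne k
  rcases fin3 k l with rfl | rfl | rfl
  · rw [co_self] at h0; linarith
  · rw [co_ne _ n6] at h2; linarith
  · rw [co_ne _ n3] at h1; linarith

theorem evpos' {b : AB} {y d : Pt} (h : ∀ k, 0 < b.coord k y ∨ (b.coord k y = 0 ∧ 0 < lc b k d)) :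
    ∀ᶠ ε in 𝓝[>] (0:ℝ), ∀ k, 0 < b.coord k (y + ε • d) := by
  rw [eventually_all]
  intro k
  simp only [co_add]
  rcases h k with h0 | ⟨h0, h1⟩
  · have : Tendsto (fun ε : ℝ => b.coord k y + ε * lc b k d) (𝓝[>] 0) (𝓝 (b.coord k y + 0 * lc b k d)) :=
      Tendsto.mono_left (Continuous.tendsto (by fun_prop) 0) nhdsWithin_le_nhds
    rw [zero_mul, add_zero] at this
    exact this.eventually_const_lt h0
  · filter_upwards [self_mem_nhdsWithin] with ε hε
    rw [h0, zero_add]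
    exact mul_pos hε h1

namespace Cfg
variable {N : ℕ} (C : Cfg N)

theorem bd_count {y : Pt} {k : Fin 3} (hk : C.B.coord k y = 0) :
    C.Nv 2 y ≤ 1 ∧ C.Ne y ≤ 1 ∧ C.Nf y = 0 ∧ C.Nv 2 y + C.Ne y ≤ 1 := by
  have h := C.cnt y
  have h1 := ang_le_pi C.B y k hk
  have := C.αpos; have := C.βpos; have := C.γpos; have := C.γgt; have := Real.pi_pos
  have a0 : (0:ℝ) ≤ C.Nv 0 y * C.α := by positivity
  have a1 : (0:ℝ) ≤ C.Nv 1 y * C.β := by positivity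
  have a2 : (0:ℝ) ≤ C.Nv 2 y * C.γ := by positivity
  have a3 : (0:ℝ) ≤ C.Ne y * π := by positivity
  have a4 : (0:ℝ) ≤ C.Nf y * (2*π) := by positivity
  have b2 : C.Nv 2 y + C.Ne y ≤ 1 := by
    by_contra hc
    have : 2 ≤ C.Nv 2 y + C.Ne y := by omega
    have h5 : (2:ℝ) ≤ C.Nv 2 y + C.Ne y := by exact_mod_cast this
    rcases Nat.eq_zero_or_pos (C.Nv 2 y) with h6 | h6
    · rw [h6] at h5; push_cast at h5; nlinarith
    · have h7 : (1:ℝ) ≤ C.Nv 2 y := by exact_mod_cast h6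
      have h8 : (0:ℝ) ≤ C.Ne y := by positivity
      nlinarith [mul_nonneg h8 Real.pi_pos.le, mul_nonneg (sub_nonneg.2 h7) (sub_nonneg.2 C.γgt.le)]
  have b4 : C.Nf y = 0 := by
    by_contra hc
    have : (1:ℝ) ≤ C.Nf y := by exact_mod_cast Nat.one_le_iff_ne_zero.2 hc
    nlinarith [Real.pi_pos]
  omega

open Classical in
def sideI (k0 : Fin 3) : Finset (Fin N × Fin 3) :=
  Finset.univ.filter fun e => C.B.coord k0 (C.V e.1 (e.2+1)) = 0 ∧ C.B.coord k0 (C.V e.1 (e.2+2)) = 0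

theorem mem_sideI {k0 : Fin 3} {e : Fin N × Fin 3} : e ∈ C.sideI k0 ↔
    C.B.coord k0 (C.V e.1 (e.2+1)) = 0 ∧ C.B.coord k0 (C.V e.1 (e.2+2)) = 0 := by
  classical
  simp [sideI]

theorem Nf_pos {y : Pt} {i : Fin N} (h : ∀ k, 0 < (C.V i).coord k y) : 1 ≤ C.Nf y := by
  classical
  unfold Nf
  rw [Nat.one_le_iff_ne_zero, ← Nat.pos_iff_ne_zero, Finset.card_pos]
  exact ⟨i, by simp [h]⟩

theorem sideChain (k0 : Fin 3) : C.EChain C.B k0 (C.sideI k0) where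
  h1 := by
    intro e he v hv
    rw [mem_sideI] at he
    rcases hv with rfl | rfl
    · exact ⟨he.1, C.vB _ _ _, C.vB _ _ _⟩
    · exact ⟨he.2, C.vB _ _ _, C.vB _ _ _⟩
  h2 := by
    intro e he e' he' hne y hy hy'
    rw [mem_sideI] at he
    have := edge_val hy (C.B.coord k0)
    rw [he.1, he.2] at this
    have h0 : C.B.coord k0 y = 0 := by linarith
    have := (C.bd_count h0).2.1
    have := C.Ne_two hne hy hy'
    omega
  h3 := by
    intro y hy hv
    obtain ⟨i, hi⟩ := (C.cov y).1 ((fin3all k0 _).2 ⟨hy.1.ge, hy.2.1.le, hy.2.2.le⟩)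
    rcases tricho hi with ⟨k, hk⟩ | ⟨k, hk⟩ | h
    · exact absurd hk (hv i k)
    · exact ⟨(i, k), C.mem_sideI.2 (edge_flat hk (C.B.coord k0) (C.vB _ _ _) (C.vB _ _ _) hy.1), hk⟩
    · have := C.Nf_pos h
      have := (C.bd_count hy.1).2.2.1
      omega

theorem side_g0 {k0 : Fin 3} {e} (he : e ∈ C.sideI k0) (h2 : e.2 ≠ 2) : C.B.coord k0 (C.V e.1 2) = 0 := by
  rw [mem_sideI] at he
  rcases EChain.two_end h2 with h | h
  · rw [h]; exact he.1
  · rw [h]; exact he.2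

theorem side_pig (k0 : Fin 3) : (∃ e ∈ C.sideI k0, e.2 = 2) ∧
    ((∀ e ∈ C.sideI k0, ∀ e' ∈ C.sideI k0, e.2 = 2 → e'.2 = 2 → e = e') →
      ∀ e ∈ C.sideI k0, ∀ v, (v = C.V e.1 (e.2+1) ∨ v = C.V e.1 (e.2+2)) → v ≠ C.B (k0+1) → v ≠ C.B (k0+2) →
        ∃ s ∈ C.sideI k0, s.2 ≠ 2 ∧ C.V s.1 2 = v) := by
  apply (C.sideChain k0).pig
  · intro e he h2 h
    have := C.Nv_pos h
    have := (C.corner (k0+1)).1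
    omega
  · intro e he h2 h
    have := C.Nv_pos h
    have := (C.corner (k0+2)).1
    omega
  · intro e he e' he' h2 h2' heq
    have h0 := C.side_g0 he h2
    have := (C.bd_count h0).1
    have h1 : e.1 = e'.1 := by
      by_contra hne
      have := C.Nv_two hne rfl heq.symm
      omega
    have h3 : e.2 = e'.2 := by
      by_contra hne
      rw [mem_sideI] at he he'
      rw [← h1] at he'
      exact two_edges_flat (C.V e.1) C.B k0 hne he.1 he.2 he'.1 he'.2
    exact Prod.ext h1 h3

open Classical in
def adjI (m : Fin N) (k : Fin 3) : Finset (Fin N × Fin 3) :=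
  Finset.univ.filter fun e => e.1 ≠ m ∧ ∃ y, onEdge (C.V m) k y ∧ onEdge (C.V e.1) e.2 y

theorem mem_adjI {m : Fin N} {k : Fin 3} {e : Fin N × Fin 3} : e ∈ C.adjI m k ↔
    e.1 ≠ m ∧ ∃ y, onEdge (C.V m) k y ∧ onEdge (C.V e.1) e.2 y := by
  classical
  simp [adjI]

theorem adj_line {m : Fin N} {k : Fin 3} {e : Fin N × Fin 3} (he : e ∈ C.adjI m k) :
    (C.V m).coord k (C.V e.1 (e.2+1)) = 0 ∧ (C.V m).coord k (C.V e.1 (e.2+2)) = 0 ∧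
      (C.V m).coord k (C.V e.1 e.2) < 0 := by
  obtain ⟨hm, y, hy, hy'⟩ := C.mem_adjI.1 he
  have sep : ∀ d, 0 < lc (C.V m) k d → 0 < lc (C.V e.1) e.2 d → False := by
    intro d h1 h2
    have A := evpos' (b := C.V m) (y := y) (d := d) ((fin3all k _).2 ⟨Or.inr ⟨hy.1, h1⟩, Or.inl hy.2.1, Or.inl hy.2.2⟩)
    have B := evpos' (b := C.V e.1) (y := y) (d := d) ((fin3all e.2 _).2 ⟨Or.inr ⟨hy'.1, h2⟩, Or.inl hy'.2.1, Or.inl hy'.2.2⟩)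
    obtain ⟨ε, h3, h4⟩ := (A.and B).exists
    exact C.disj _ _ hm _ h4 h3
  obtain ⟨n1, n2, n3, n4, n5, n6⟩ := kne e.2
  set v := C.V e.1 (e.2+2) - C.V e.1 (e.2+1) with hv
  set d := C.V e.1 e.2 - C.V e.1 (e.2+1) with hd
  have gv : lc (C.V e.1) e.2 v = 0 := by rw [hv, lc_sub, co_ne _ n1, co_ne _ n2]; ring
  have gd : lc (C.V e.1) e.2 d = 1 := by rw [hd, lc_sub, co_ne _ n1, co_self]; ring
  have fv : lc (C.V m) k v = 0 := by
    by_contra hne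
    set t := (1 - lc (C.V m) k d) / lc (C.V m) k v with ht
    apply sep (d + t • v)
    · rw [map_add, map_smul, smul_eq_mul, ht]; field_simp; norm_num
    · rw [map_add, map_smul, gd, gv]; norm_num
  have fd : lc (C.V m) k d ≤ 0 := by
    by_contra hc
    exact sep d (not_le.1 hc) (by rw [gd]; norm_num)
  rw [hv, lc_sub] at fv
  rw [hd, lc_sub] at fd
  have hval := edge_val hy' ((C.V m).coord k)
  have hsum := co_sum' (C.V e.1) e.2 y
  rw [hy.1] at hval
  rw [hy'.1] at hsum
  have e1 : (C.V m).coord k (C.V e.1 (e.2+1)) = 0 := by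
    have : (C.V m).coord k (C.V e.1 (e.2+2)) = (C.V m).coord k (C.V e.1 (e.2+1)) := by linarith
    rw [this, ← add_mul] at hval
    rw [show (C.V e.1).coord (e.2+1) y + (C.V e.1).coord (e.2+2) y = 1 by linarith] at hval
    linarith
  have e2 : (C.V m).coord k (C.V e.1 (e.2+2)) = 0 := by linarith
  refine ⟨e1, e2, lt_of_le_of_ne (by linarith) ?_⟩
  intro h0
  exact not_flat _ _ k e.2 h0 e1 e2

theorem Ne_three {y : Pt} {e e' e'' : Fin N × Fin 3} (h1 : e ≠ e') (h2 : e ≠ e'') (h3 : e' ≠ e'')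
    (g1 : onEdge (C.V e.1) e.2 y) (g2 : onEdge (C.V e'.1) e'.2 y) (g3 : onEdge (C.V e''.1) e''.2 y) : 3 ≤ C.Ne y := by
  classical
  unfold Ne
  have h := Finset.card_eq_three.2 ⟨e, e', e'', h1, h2, h3, rfl⟩
  refine h.symm.le.trans (Finset.card_le_card ?_)
  intro i hi
  simp only [Finset.mem_insert, Finset.mem_singleton] at hi
  rcases hi with rfl | rfl | rfl <;> simp [g1, g2, g3]

theorem int_count (y : Pt) : C.Nv 2 y ≤ 3 ∧ C.Ne y ≤ 2 ∧ (1 ≤ C.Ne y → C.Nv 2 y ≤ 1) ∧ (2 ≤ C.Ne y → C.Nv 2 y = 0) := by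
  have h := C.cnt y
  have h1 := ang_le C.B y
  have := C.αpos; have := C.βpos; have := C.γpos; have := C.γgt; have := Real.pi_pos
  have a0 : (0:ℝ) ≤ C.Nv 0 y * C.α := by positivity
  have a1 : (0:ℝ) ≤ C.Nv 1 y * C.β := by positivity
  have a4 : (0:ℝ) ≤ C.Nf y * (2*π) := by positivity
  have key : (C.Nv 2 y : ℝ) * C.γ + C.Ne y * π ≤ 2 * π := by linarith
  have k2 : C.Nv 2 y + 2 * C.Ne y ≤ 4 ∧ (1 ≤ C.Nv 2 y → C.Nv 2 y + 2 * C.Ne y ≤ 3) := by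
    constructor
    · by_contra hc
      have : 5 ≤ C.Nv 2 y + 2 * C.Ne y := by omega
      have : (5:ℝ) ≤ C.Nv 2 y + 2 * C.Ne y := by exact_mod_cast this
      nlinarith
    · intro h1
      by_contra hc
      have : 4 ≤ C.Nv 2 y + 2 * C.Ne y := by omega
      have : (4:ℝ) ≤ C.Nv 2 y + 2 * C.Ne y := by exact_mod_cast this
      have : (1:ℝ) ≤ C.Nv 2 y := by exact_mod_cast h1
      nlinarith
  omega

end Cfg
end Part5

section Part6
namespace Cfg
variable {N : ℕ} (C : Cfg N)

structure Uq (k0 : Fin 3) (m : Fin N) : Prop where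
  mem : (m, (2 : Fin 3)) ∈ C.sideI k0
  uniq : ∀ e ∈ C.sideI k0, ∀ e' ∈ C.sideI k0, e.2 = 2 → e'.2 = 2 → e = e'

def Good (m : Fin N) (k : Fin 3) : Prop :=
  (∀ r, ¬ (C.B.coord r (C.V m (k+1)) = 0 ∧ C.B.coord r (C.V m (k+2)) = 0)) ∧
    ∀ e ∈ C.adjI m k, ¬ onEdge (C.V e.1) e.2 (C.V m 2)

def KW (k w : Fin 3) : Prop := (k = 1 ∧ w = 0) ∨ (k = 0 ∧ w = 1)

variable {C} {k0 : Fin 3} {m : Fin N} {k w : Fin 3}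

theorem KW.all (h : KW k w) (P : Fin 3 → Prop) : (∀ l, P l) ↔ P k ∧ P w ∧ P 2 := by
  rcases h with ⟨rfl, rfl⟩ | ⟨rfl, rfl⟩
  · rw [Fin.forall_fin_succ, Fin.forall_fin_two]; simp; tauto
  · rw [Fin.forall_fin_succ, Fin.forall_fin_two]; simp

theorem KW.ends (h : KW k w) (P : Fin 3 → Prop) : (P (k+1) ∧ P (k+2)) ↔ P w ∧ P 2 := by
  rcases h with ⟨rfl, rfl⟩ | ⟨rfl, rfl⟩
  · simp; tauto
  · simp

theorem KW.ne (h : KW k w) : k ≠ w ∧ k ≠ 2 ∧ w ≠ 2 := by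
  rcases h with ⟨rfl, rfl⟩ | ⟨rfl, rfl⟩ <;> decide

theorem KW.oe (h : KW k w) {b : AB} {y : Pt} : onEdge b k y ↔ b.coord k y = 0 ∧ 0 < b.coord w y ∧ 0 < b.coord 2 y := by
  unfold onEdge; rw [h.ends (fun l => 0 < b.coord l y)]

theorem KW.X (h : KW k w) {b : AB} {y : Pt} (h1 : b.coord k y = 0) (h2 : b.coord w y = 0) : y = b 2 := by
  apply eq_vertex b 2
  · rcases h with ⟨rfl, rfl⟩ | ⟨rfl, rfl⟩ <;> simpa
  · rcases h with ⟨rfl, rfl⟩ | ⟨rfl, rfl⟩ <;> simpa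

theorem KW.W (h : KW k w) {b : AB} {y : Pt} (h1 : b.coord k y = 0) (h2 : b.coord 2 y = 0) : y = b w := by
  rcases h with ⟨rfl, rfl⟩ | ⟨rfl, rfl⟩
  · exact eq_vertex b 0 y h1 h2
  · exact eq_vertex b 1 y h2 h1

theorem Uq.flat (U : C.Uq k0 m) : C.B.coord k0 (C.V m 0) = 0 ∧ C.B.coord k0 (C.V m 1) = 0 := by
  have := C.mem_sideI.1 U.mem
  exact this

theorem Uq.coord (U : C.Uq k0 m) (v : Pt) : C.B.coord k0 v = (C.V m).coord 2 v * C.B.coord k0 (C.V m 2) := by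
  have h := aff_eq (C.V m) (C.B.coord k0) 0 v
  simp only [zero_add] at h
  rw [U.flat.1, U.flat.2] at h
  linarith

theorem Uq.Xpos (U : C.Uq k0 m) : 0 < C.B.coord k0 (C.V m 2) := by
  refine lt_of_le_of_ne (C.vB _ _ _) fun h => ?_
  exact not_flat (C.V m) C.B k0 0 U.flat.1 U.flat.2 h.symm

theorem Uq.c2 (U : C.Uq k0 m) (i : Fin N) (l : Fin 3) : 0 ≤ (C.V m).coord 2 (C.V i l) := by
  have := C.vB i l k0
  rw [U.coord] at this
  by_contra hc
  push Not at hc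
  nlinarith [U.Xpos]

theorem Uq.adj_in (U : C.Uq k0 m) (h : KW k w) (G : C.Good m k) {e} (he : e ∈ C.adjI m k) (l : Fin 3)
    (hl : l = e.2+1 ∨ l = e.2+2) : (C.V m).coord k (C.V e.1 l) = 0 ∧ ∀ r, 0 ≤ (C.V m).coord r (C.V e.1 l) := by
  have hk0 : (C.V m).coord k (C.V e.1 l) = 0 := by
    have := C.adj_line he
    rcases hl with rfl | rfl
    · exact this.1
    · exact this.2.1
  refine ⟨hk0, ?_⟩
  rw [h.all]
  refine ⟨hk0.ge, ?_, U.c2 _ _⟩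
  by_contra hc
  push Not at hc
  obtain ⟨hm, y, hy, hy'⟩ := C.mem_adjI.1 he
  have hyw := (h.oe.1 hy).2.1
  set p := (C.V m).coord w y with hp
  set q := (C.V m).coord w (C.V e.1 l) with hq
  set τ := p / (p - q) with hτ
  have hpq : 0 < p - q := by linarith
  have t0 : 0 < τ := div_pos hyw hpq
  have t1 : τ < 1 := by rw [hτ, div_lt_one hpq]; linarith
  have hz : AffineMap.lineMap y (C.V e.1 l) τ = C.V m 2 := by
    apply h.X
    · rw [EChain.lm_co, hy.1, hk0]; ring
    · rw [EChain.lm_co, ← hp, ← hq, hτ]; field_simp; ring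
  apply G.2 e he
  rw [← hz]
  obtain ⟨n1, n2, n3, n4, n5, n6⟩ := kne e.2
  have hvn : ∀ r, 0 ≤ (C.V e.1).coord r (C.V e.1 l) := by
    intro r; by_cases hr : r = l
    · subst hr; rw [co_self]; norm_num
    · rw [co_ne _ hr]
  refine ⟨?_, ?_, ?_⟩
  · rw [EChain.lm_co, hy'.1]
    have : (C.V e.1).coord e.2 (C.V e.1 l) = 0 := by rcases hl with rfl | rfl; exacts [co_ne _ n1, co_ne _ n2]
    rw [this]; ring
  · rw [EChain.lm_co]
    have := mul_pos (sub_pos.2 t1) hy'.2.1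
    have := mul_nonneg t0.le (hvn (e.2+1))
    linarith
  · rw [EChain.lm_co]
    have := mul_pos (sub_pos.2 t1) hy'.2.2
    have := mul_nonneg t0.le (hvn (e.2+2))
    linarith

theorem Uq.adj_on (U : C.Uq k0 m) (h : KW k w) (G : C.Good m k) {e} (he : e ∈ C.adjI m k) {y : Pt}
    (hy : onEdge (C.V e.1) e.2 y) : onEdge (C.V m) k y := by
  obtain ⟨a0, a⟩ := U.adj_in h G he _ (Or.inl rfl)
  obtain ⟨b0, b⟩ := U.adj_in h G he _ (Or.inr rfl)
  have ek := edge_val hy ((C.V m).coord k)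
  rw [a0, b0] at ek
  have yk : (C.V m).coord k y = 0 := by linarith
  rw [h.oe]
  have npos : ∀ r, 0 ≤ (C.V m).coord r y := by
    intro r
    rw [edge_val hy ((C.V m).coord r)]
    have := mul_nonneg hy.2.1.le (a r)
    have := mul_nonneg hy.2.2.le (b r)
    linarith
  refine ⟨yk, lt_of_le_of_ne (npos w) fun h0 => ?_, lt_of_le_of_ne (npos 2) fun h0 => ?_⟩
  · obtain ⟨c1, c2⟩ := edge_flat hy ((C.V m).coord w) (a w) (b w) h0.symm
    have e1 := h.X a0 c1
    have e2 := h.X b0 c2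
    exact (kne e.2).2.2.1 ((C.V e.1).ind.injective (e1.trans e2.symm))
  · obtain ⟨c1, c2⟩ := edge_flat hy ((C.V m).coord 2) (a 2) (b 2) h0.symm
    have e1 := h.W a0 c1
    have e2 := h.W b0 c2
    exact (kne e.2).2.2.1 ((C.V e.1).ind.injective (e1.trans e2.symm))

theorem Uq.chain (U : C.Uq k0 m) (h : KW k w) (G : C.Good m k) : C.EChain (C.V m) k (C.adjI m k) where
  h1 := by
    rintro e he v (rfl | rfl)
    · obtain ⟨a0, a⟩ := U.adj_in h G he _ (Or.inl rfl)
      exact ⟨a0, a _, a _⟩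
    · obtain ⟨a0, a⟩ := U.adj_in h G he _ (Or.inr rfl)
      exact ⟨a0, a _, a _⟩
  h2 := by
    intro e he e' he' hne y hy hy'
    have hmy := U.adj_on h G he hy
    have h1 := (C.mem_adjI.1 he).1
    have h2 := (C.mem_adjI.1 he').1
    have := C.Ne_three (e := e) (e' := e') (e'' := (m, k)) hne (fun h => h1 (by rw [h])) (fun h => h2 (by rw [h])) hy hy' hmy
    have := (C.int_count y).2.1
    omega
  h3 := by
    intro y hy hv
    have hpos : ∀ r, 0 < C.B.coord r y := by
      intro r
      have hin : ∀ l, 0 ≤ (C.V m).coord l y := (fin3all k _).2 ⟨hy.1.ge, hy.2.1.le, hy.2.2.le⟩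
      refine lt_of_le_of_ne (C.inB m y hin r) fun h0 => ?_
      exact G.1 r (edge_flat hy (C.B.coord r) (C.vB _ _ _) (C.vB _ _ _) h0.symm)
    have hc := C.cnt y
    rw [ang_int hpos] at hc
    have nv : ∀ l, C.Nv l y = 0 := by
      intro l
      by_contra hne
      obtain ⟨i, hi⟩ := C.Nv_ex (Nat.one_le_iff_ne_zero.2 hne)
      exact hv i l hi
    rw [nv, nv, nv] at hc
    have hπ := Real.pi_pos
    have hc2 : C.Ne y + 2 * C.Nf y = 2 := by
      have : ((C.Ne y : ℝ) + 2 * C.Nf y) * π = 2 * π := by push_cast at hc; linarith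
      have := mul_right_cancel₀ hπ.ne' this
      exact_mod_cast this
    have h1 : 1 ≤ C.Ne y := C.Ne_pos hy
    have h2 : C.Ne y = 2 := by omega
    classical
    unfold Ne at h2
    obtain ⟨x, z, hxz, hset⟩ := Finset.card_eq_two.1 h2
    have hx : x ∈ Finset.univ.filter fun e : Fin N × Fin 3 => onEdge (C.V e.1) e.2 y := by rw [hset]; simp
    have hz : z ∈ Finset.univ.filter fun e : Fin N × Fin 3 => onEdge (C.V e.1) e.2 y := by rw [hset]; simp
    simp only [Finset.mem_filter, Finset.mem_univ, true_and] at hx hz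
    have aux : ∀ x : Fin N × Fin 3, onEdge (C.V x.1) x.2 y → x ≠ (m, k) → ∃ e ∈ C.adjI m k, onEdge (C.V e.1) e.2 y := by
      intro x hx hne
      refine ⟨x, C.mem_adjI.2 ⟨?_, y, hy, hx⟩, hx⟩
      intro hm
      apply hne
      rw [hm] at hx
      exact Prod.ext hm (edge_uniq hx hy)
    by_cases hxm : x = (m, k)
    · exact aux z hz (fun h => hxz (hxm.trans h.symm))
    · exact aux x hx hxm

end Cfg
end Part6

section Part7
/-- law of sines -/
theorem sines (b : AB) (k : Fin 3) : Real.sin (triAngle b k) * sideLen b (k+1) = Real.sin (triAngle b (k+1)) * sideLen b k := by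
  unfold triAngle sideLen
  obtain ⟨e1, e2, e3, e4⟩ := k3 k
  rw [e1, e3]
  have := law_sin (b (k+1)) (b k) (b (k+2))
  rw [dist_comm (b (k+2)) (b k), this, dist_comm (b (k+2)) (b (k+1))]

theorem triAngle_eq (b : AB) {k w l : Fin 3} (h1 : k ≠ w) (h2 : k ≠ l) (h3 : w ≠ l) : triAngle b w = ∠ (b k) (b w) (b l) := by
  unfold triAngle
  rcases fin3 w k with h | h | h
  · exact absurd h h1
  · rcases fin3 w l with h' | h' | h'
    · exact absurd h'.symm h3
    · exact absurd (h.trans h'.symm) h2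
    · rw [h, h']
  · rcases fin3 w l with h' | h' | h'
    · exact absurd h'.symm h3
    · rw [h, h', angle_comm]
    · exact absurd (h.trans h'.symm) h2

theorem sidepos (b : AB) (k : Fin 3) : 0 < sideLen b k := by
  unfold sideLen
  exact dist_pos.2 fun h => (kne k).2.2.1 (b.ind.injective h)

/-- angle between the opposite of one side and another side -/
theorem opp_angle (b : AB) {k w : Fin 3} (h1 : k ≠ w) (h2 : k ≠ 2) (h3 : w ≠ 2) {p q : Pt}
    (p2 : b.coord 2 p = 0) (pk : b.coord k p < 0) (qk : b.coord k q = 0) (q2 : 0 < b.coord 2 q) :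
    ∠ p (b w) q = π - triAngle b w := by
  rw [triAngle_eq b h1 h2 h3]
  have all3 : ∀ P : Fin 3 → Prop, P k → P w → P 2 → ∀ r, P r := by
    intro P a1 a2 a3 r
    have : r = k ∨ r = w ∨ r = 2 := by clear p2 pk qk q2 a1 a2 a3; revert h1 h2 h3; revert k w r; decide
    rcases this with rfl | rfl | rfl <;> assumption
  have hs : ∀ y, b.coord k y + b.coord w y + b.coord 2 y = 1 := by
    intro y
    have := co_sum b y
    have : (k = 0 ∧ w = 1) ∨ (k = 1 ∧ w = 0) := by clear p2 pk qk q2 all3 this; revert h1 h2 h3; revert k w; decide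
    rcases this with ⟨rfl, rfl⟩ | ⟨rfl, rfl⟩ <;> linarith
  have hp : p = b w + b.coord k p • (b k - b w) := by
    apply co_ext b
    have := hs p
    apply all3
    · rw [co_add, lc_sub, co_self, co_ne _ h1]; ring
    · rw [co_add, lc_sub, co_self, co_ne _ h1.symm]; linarith
    · rw [co_add, lc_sub, co_ne _ h2.symm, co_ne _ h3.symm, p2]; ring
  have hq : q = b w + b.coord 2 q • (b 2 - b w) := by
    apply co_ext b
    have := hs q
    apply all3
    · rw [co_add, lc_sub, co_ne _ h2, co_ne _ h1, qk]; ring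
    · rw [co_add, lc_sub, co_self, co_ne _ h3]; linarith
    · rw [co_add, lc_sub, co_self, co_ne _ h3.symm]; ring
  unfold EuclideanGeometry.angle
  simp only [vsub_eq_sub]
  rw [show p - b w = b.coord k p • (b k - b w) by rw [eq_comm, eq_sub_iff_add_eq, add_comm]; exact hp.symm,
    show q - b w = b.coord 2 q • (b 2 - b w) by rw [eq_comm, eq_sub_iff_add_eq, add_comm]; exact hq.symm,
    InnerProductGeometry.angle_smul_left_of_neg _ _ pk, InnerProductGeometry.angle_smul_right_of_pos _ _ q2,
    InnerProductGeometry.angle_neg_left]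

namespace Cfg
variable {N : ℕ} (C : Cfg N)

def L (k : Fin 3) : ℝ := sideLen C.T k

theorem Lpos (k : Fin 3) : 0 < C.L k := sidepos _ _

theorem dV (i : Fin N) (k : Fin 3) : dist (C.V i (k+1)) (C.V i (k+2)) = C.L k := C.hd _ _ _

theorem sinα : 0 < Real.sin C.α := by
  apply Real.sin_pos_of_pos_of_lt_pi C.αpos; linarith [C.βpos, C.γpos, C.abg]
theorem sinβ : 0 < Real.sin C.β := by
  apply Real.sin_pos_of_pos_of_lt_pi C.βpos; linarith [C.αpos, C.γpos, C.abg]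
theorem sinγ : 0 < Real.sin C.γ := by
  apply Real.sin_pos_of_pos_of_lt_pi C.γpos; linarith [C.αpos, C.βpos, C.abg]

theorem law01 : Real.sin C.α * C.L 1 = Real.sin C.β * C.L 0 := sines C.T 0
theorem law12 : Real.sin C.β * C.L 2 = Real.sin C.γ * C.L 1 := sines C.T 1
theorem law20 : Real.sin C.γ * C.L 0 = Real.sin C.α * C.L 2 := sines C.T 2

theorem sg : Real.sin C.γ = Real.sin (C.α + C.β) := by
  rw [← Real.sin_pi_sub]; congr 1; linarith [C.abg]

theorem L02 : C.L 0 < C.L 2 := by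
  have h : Real.sin C.α < Real.sin C.γ := by
    rw [sg]; apply Real.sin_lt_sin_of_lt_of_le_pi_div_two <;> linarith [C.αpos, C.βpos, C.abg, C.γgt, Real.pi_pos]
  have := C.law20; have := C.sinα; have := C.Lpos 0; have := C.Lpos 2
  by_contra hc
  push Not at hc
  nlinarith

theorem L12 : C.L 1 < C.L 2 := by
  have h : Real.sin C.β < Real.sin C.γ := by
    rw [sg]; apply Real.sin_lt_sin_of_lt_of_le_pi_div_two <;> linarith [C.αpos, C.βpos, C.abg, C.γgt, Real.pi_pos]
  have := C.law12; have := C.sinβ; have := C.Lpos 1; have := C.Lpos 2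
  by_contra hc
  push Not at hc
  nlinarith

theorem αβ (h : C.L 1 < C.L 0) : C.β < C.α := by
  by_contra hc
  push Not at hc
  have h : Real.sin C.α ≤ Real.sin C.β := by
    apply Real.sin_le_sin_of_le_of_le_pi_div_two <;> linarith [C.αpos, C.βpos, C.abg, C.γgt, Real.pi_pos]
  have := C.law01; have := C.sinβ; have := C.Lpos 1; have := C.sinα
  nlinarith

theorem L01 (h : C.HI) : C.L 0 ≠ C.L 1 := by
  intro he
  have h1 := C.law01
  rw [he] at h1
  have h2 := mul_right_cancel₀ (C.Lpos 1).ne' h1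
  have h3 : C.α = C.β := by
    apply Real.injOn_sin _ _ h2 <;> constructor <;> linarith [C.αpos, C.βpos, C.abg, C.γgt, Real.pi_pos]
  have := h 1 (-1) (by rw [h3]; push_cast; ring)
  omega

variable {C} {k0 : Fin 3} {m : Fin N} {k w : Fin 3}

theorem Uq.Wflat (U : C.Uq k0 m) (h : KW k w) : C.B.coord k0 (C.V m w) = 0 := by
  rcases h with ⟨rfl, rfl⟩ | ⟨rfl, rfl⟩
  exacts [U.flat.1, U.flat.2]

theorem Uq.Wex (U : C.Uq k0 m) (h : KW k w) (h1 : C.V m w ≠ C.B (k0+1)) (h2 : C.V m w ≠ C.B (k0+2)) :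
    ∃ s ∈ C.sideI k0, s.2 ≠ 2 ∧ C.V s.1 2 = C.V m w := by
  refine (C.side_pig k0).2 U.uniq _ U.mem _ ?_ h1 h2
  rcases h with ⟨rfl, rfl⟩ | ⟨rfl, rfl⟩
  · left; rfl
  · right; rfl

theorem Uq.zero2 (U : C.Uq k0 m) {v : Pt} (h : C.B.coord k0 v = 0) : (C.V m).coord 2 v = 0 := by
  rw [U.coord] at h
  exact (mul_eq_zero.1 h).resolve_right U.Xpos.ne'

theorem onOther {a b : Fin 3} (h : a ≠ b) : a = b + 1 ∨ a = b + 2 := (fin3 b a).resolve_left h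

theorem Uq.notW (U : C.Uq k0 m) (h : KW k w) (G : C.Good m k) {e} (he : e ∈ C.adjI m k) (he2 : e.2 ≠ 2) :
    C.V e.1 2 ≠ C.V m w := by
  intro heq
  have hN := C.Nv_pos heq
  have hW := U.Wflat h
  have hbd := (C.bd_count hW).1
  have c1 : C.V m w ≠ C.B (k0+1) := by
    intro hc; rw [hc, (C.corner (k0+1)).1] at hN; omega
  have c2 : C.V m w ≠ C.B (k0+2) := by
    intro hc; rw [hc, (C.corner (k0+2)).1] at hN; omega
  obtain ⟨s, hs, hs2, hsW⟩ := U.Wex h c1 c2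
  have hj : s.1 = e.1 := by
    by_contra hne
    have := C.Nv_two hne hsW heq
    omega
  obtain ⟨j, l⟩ := e
  obtain ⟨j', l'⟩ := s
  simp only at hj he2 hs2 heq hsW
  subst hj
  rw [C.mem_sideI] at hs
  obtain ⟨a1, a2, a3⟩ := C.adj_line he
  simp only at hs a1 a2 a3
  have hll : l ≠ l' := by
    rintro rfl
    have e1 := h.W a1 (U.zero2 hs.1)
    have e2 := h.W a2 (U.zero2 hs.2)
    exact (kne l).2.2.1 ((C.V j').ind.injective (e1.trans e2.symm))
  have p2 : (C.V m).coord 2 (C.V j' l) = 0 := by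
    apply U.zero2
    rcases onOther hll with h | h <;> rw [h]
    exacts [hs.1, hs.2]
  obtain ⟨q0, q1⟩ := U.adj_in h G he l' (onOther hll.symm)
  simp only at q0 q1
  have q2 : 0 < (C.V m).coord 2 (C.V j' l') := by
    refine lt_of_le_of_ne (q1 2) fun h0 => ?_
    have := h.W q0 h0.symm
    rw [← heq] at this
    exact hs2 ((C.V j').ind.injective this)
  have := opp_angle (C.V m) h.ne.1 h.ne.2.1 h.ne.2.2 p2 a3 q0 q2
  rw [← heq, ← triAngle_eq (C.V j') he2 hll hs2.symm, C.ang_tile, C.ang_tile] at this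
  have h1 := C.abg; have hα := C.αpos; have hβ := C.βpos
  change C.γ = _ at this
  rcases h with ⟨rfl, rfl⟩ | ⟨rfl, rfl⟩
  · change C.γ = π - C.α at this; linarith
  · change C.γ = π - C.β at this; linarith

theorem Uq.chlen (U : C.Uq k0 m) (h : KW k w) (G : C.Good m k) : C.L k = ∑ e ∈ C.adjI m k, C.L e.2 := by
  rw [← C.dV m k]; exact (U.chain h G).len

theorem Uq.le (U : C.Uq k0 m) (h : KW k w) (G : C.Good m k) {e} (he : e ∈ C.adjI m k) : C.L e.2 ≤ C.L k := by
  rw [U.chlen h G]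
  exact Finset.single_le_sum (f := fun e : Fin N × Fin 3 => C.L e.2) (fun e _ => (C.Lpos _).le) he

theorem Uq.ne2 (U : C.Uq k0 m) (h : KW k w) (G : C.Good m k) {e} (he : e ∈ C.adjI m k) : e.2 ≠ 2 := by
  intro h2
  have := U.le h G he
  rw [h2] at this
  have := C.L02; have := C.L12
  rcases h with ⟨rfl, rfl⟩ | ⟨rfl, rfl⟩ <;> linarith

theorem Uq.exX (U : C.Uq k0 m) (h : KW k w) (G : C.Good m k) : ∃ e ∈ C.adjI m k, C.V e.1 2 = C.V m 2 := by
  by_contra hc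
  push Not at hc
  have hWX : ∀ e ∈ C.adjI m k, C.V e.1 2 ≠ C.V m (k+1) ∧ C.V e.1 2 ≠ C.V m (k+2) := by
    intro e he
    rw [h.ends (fun l => C.V e.1 2 ≠ C.V m l)]
    exact ⟨U.notW h G he (U.ne2 h G he), hc e he⟩
  obtain ⟨⟨e, he, he2⟩, -⟩ := (U.chain h G).pig (fun e he _ => (hWX e he).1) (fun e he _ => (hWX e he).2) (by
    intro e he e' he' h2 h2' heq
    obtain ⟨q0, q1⟩ := U.adj_in h G he 2 (EChain.two_end h2)
    have hon : onEdge (C.V m) k (C.V e.1 2) := by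
      rw [h.oe]
      refine ⟨q0, lt_of_le_of_ne (q1 w) fun h0 => ?_, lt_of_le_of_ne (q1 2) fun h0 => ?_⟩
      · exact hc e he (h.X q0 h0.symm)
      · exact U.notW h G he h2 (h.W q0 h0.symm)
    have := (C.int_count (C.V e.1 2)).2.2.1 (C.Ne_pos hon)
    have h1 : e.1 = e'.1 := by
      by_contra hne
      have := C.Nv_two hne rfl heq.symm
      omega
    have h3 : e.2 = e'.2 := by
      by_contra hne
      have A := C.adj_line he
      have B := C.adj_line he'
      rw [← h1] at B
      exact two_edges_flat (C.V e.1) (C.V m) k hne A.1 A.2.1 B.1 B.2.1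
    exact Prod.ext h1 h3)
  exact U.ne2 h G he he2

theorem KW.symm (h : KW k w) : KW w k := by
  rcases h with ⟨rfl, rfl⟩ | ⟨rfl, rfl⟩
  · exact Or.inr ⟨rfl, rfl⟩
  · exact Or.inl ⟨rfl, rfl⟩

theorem Uq.two_of_good (U : C.Uq k0 m) (h : KW k w) (G : C.Good m k) : 2 ≤ C.Nv 2 (C.V m 2) := by
  obtain ⟨e, he, hX⟩ := U.exX h G
  exact C.Nv_two (C.mem_adjI.1 he).1 hX rfl

theorem Uq.good (U : C.Uq k0 m) (h : KW k w) : C.Good m k := by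
  have hm : 1 ≤ C.Nv 2 (C.V m 2) := C.Nv_pos rfl
  have bad : ∀ {k w}, KW k w → ¬ C.Good m k → (∃ r, C.B.coord r (C.V m w) = 0 ∧ C.B.coord r (C.V m 2) = 0) ∨
      ∃ e ∈ C.adjI m k, onEdge (C.V e.1) e.2 (C.V m 2) := by
    intro k w h hb
    unfold Good at hb
    rw [not_and_or] at hb
    rcases hb with hb | hb
    · left
      push Not at hb
      obtain ⟨r, hr⟩ := hb
      exact ⟨r, (h.ends (fun l => C.B.coord r (C.V m l) = 0)).1 hr⟩
    · right
      push Not at hb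
      exact hb
  by_contra hb
  rcases bad h hb with ⟨r, r1, r2⟩ | ⟨e, he, hon⟩
  · have hbd := C.bd_count r2
    by_cases hb' : C.Good m w
    · have := U.two_of_good h.symm hb'
      omega
    rcases bad h.symm hb' with ⟨s, s1, s2⟩ | ⟨e', he', hon'⟩
    · by_cases hrs : r = s
      · subst hrs
        have : ∀ l, C.B.coord r (C.V m l) = 0 := (h.all _).2 ⟨s1, r1, r2⟩
        exact not_flat _ _ r 0 (this _) (this _) (this _)
      · have : ∃ t, C.V m 2 = C.B t := by
          obtain ⟨t, ht⟩ : ∃ t : Fin 3, (r = t + 1 ∧ s = t + 2) ∨ (r = t + 2 ∧ s = t + 1) := by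
            clear r1 r2 s1 s2; revert r s; decide
          refine ⟨t, eq_vertex _ _ _ ?_ ?_⟩ <;> rcases ht with ⟨rfl, rfl⟩ | ⟨rfl, rfl⟩ <;> assumption
        obtain ⟨t, ht⟩ := this
        rw [ht, (C.corner t).1] at hm
        omega
    · have := C.Ne_pos hon'
      omega
  · have h1 := C.Ne_pos hon
    have hic := C.int_count (C.V m 2)
    by_cases hb' : C.Good m w
    · have := U.two_of_good h.symm hb'
      omega
    rcases bad h.symm hb' with ⟨s, s1, s2⟩ | ⟨e', he', hon'⟩
    · have := C.bd_count s2
      omega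
    · by_cases hee : e = e'
      · subst hee
        have A := C.adj_line he
        have B := C.adj_line he'
        have e1 := h.X A.1 B.1
        have e2 := h.X A.2.1 B.2.1
        exact (kne e.2).2.2.1 ((C.V e.1).ind.injective (e1.trans e2.symm))
      · have := C.Ne_two hee hon hon'
        omega

theorem Uq.three (U : C.Uq k0 m) (hHI : C.HI) : C.Pa ≤ 3 ∧ C.Qb ≤ 3 := by
  have h : KW 1 0 := Or.inl ⟨rfl, rfl⟩
  have G := U.good h
  have G' := U.good h.symm
  obtain ⟨e, he, hX⟩ := U.exX h G
  obtain ⟨e', he', hX'⟩ := U.exX h.symm G'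
  have e2 := U.ne2 h G he
  have e2' := U.ne2 h.symm G' he'
  have A := C.adj_line he
  have B := C.adj_line he'
  have hne : e.1 ≠ e'.1 := by
    intro hj
    obtain ⟨j, l⟩ := e
    obtain ⟨j', l'⟩ := e'
    simp only at hj A B
    subst hj
    by_cases hl : l = l'
    · subst hl
      have e1 := h.X A.1 B.1
      have e2 := h.X A.2.1 B.2.1
      exact (kne l).2.2.1 ((C.V j).ind.injective (e1.trans e2.symm))
    · have := (U.adj_in h.symm G' he' l (onOther hl)).2 1
      simp only at this
      linarith
  have h3 : 3 ≤ C.Nv 2 (C.V m 2) := by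
    classical
    have := C.Nv_card (k := 2) (y := C.V m 2) {m, e.1, e'.1} (by
      intro i hi
      simp only [Finset.mem_insert, Finset.mem_singleton] at hi
      rcases hi with rfl | rfl | rfl
      exacts [rfl, hX, hX'])
    rwa [Finset.card_eq_three.2 ⟨m, e.1, e'.1, (C.mem_adjI.1 he).1.symm, (C.mem_adjI.1 he').1.symm, hne, rfl⟩] at this
  have hic := C.int_count (C.V m 2)
  have hpos : ∀ r, 0 < C.B.coord r (C.V m 2) := by
    intro r
    refine lt_of_le_of_ne (C.vB _ _ _) fun h0 => ?_
    have := C.bd_count h0.symm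
    omega
  have hc := C.cnt (C.V m 2)
  rw [ang_int hpos, show C.Nv 2 (C.V m 2) = 3 by omega, show C.Ne (C.V m 2) = 0 by omega] at hc
  have := C.αpos; have := C.βpos; have := C.γpos; have := Real.pi_pos
  have a0 : (0:ℝ) ≤ C.Nv 0 (C.V m 2) * C.α := by positivity
  have a1 : (0:ℝ) ≤ C.Nv 1 (C.V m 2) * C.β := by positivity
  have hf : C.Nf (C.V m 2) = 0 := by
    by_contra hc'
    have : (1:ℝ) ≤ C.Nf (C.V m 2) := by exact_mod_cast Nat.one_le_iff_ne_zero.2 hc'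
    push_cast at hc
    nlinarith
  rw [hf] at hc
  have hPQ := C.PQ
  have := hHI.nat (x := C.Pa + C.Nv 0 (C.V m 2)) (y := C.Qb + C.Nv 1 (C.V m 2)) (x' := 3) (y' := 3) (by
    push_cast at hc ⊢
    have := C.abg
    linarith)
  omega

theorem Uq.noncorner (U : C.Uq k0 m) (hHI : C.HI) (h : KW k w) (h1 : C.V m w ≠ C.B (k0+1)) (h2 : C.V m w ≠ C.B (k0+2)) :
    C.Nv 0 (C.V m w) = 1 ∧ C.Nv 1 (C.V m w) = 1 := by
  obtain ⟨s, hs, hs2, hsW⟩ := U.Wex h h1 h2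
  have hon : onEdge C.B k0 (C.V m w) := by
    have h0 := U.Wflat h
    refine ⟨h0, lt_of_le_of_ne (C.vB _ _ _) fun h0' => ?_, lt_of_le_of_ne (C.vB _ _ _) fun h0' => ?_⟩
    · exact h2 (eq_vertex _ _ _ (by rw [(k3 k0).2.1]; exact h0) (by rw [(k3 k0).2.2.2]; exact h0'.symm))
    · exact h1 (eq_vertex _ _ _ (by rw [(k3 k0).1]; exact h0'.symm) (by rw [(k3 k0).2.2.1]; exact h0))
  have := C.straight hHI (ang_edge hon) (C.Nv_pos hsW)
  exact ⟨this.1, this.2.1⟩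

theorem Uq.single (U : C.Uq k0 m) (h : KW k w) (G : C.Good m k) {e} (he : e ∈ C.adjI m k) (hk : e.2 = k) :
    C.V e.1 w = C.V m w := by
  have hlen := U.chlen h G
  have huniq : ∀ e' ∈ C.adjI m k, e' = e := by
    intro e' he'
    by_contra hne
    have h1 : ∑ x ∈ ({e, e'} : Finset (Fin N × Fin 3)), C.L x.2 ≤ ∑ e ∈ C.adjI m k, C.L e.2 := by
      apply Finset.sum_le_sum_of_subset_of_nonneg
      · intro x hx
        simp only [Finset.mem_insert, Finset.mem_singleton] at hx
        rcases hx with rfl | rfl <;> assumption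
      · intro x _ _; exact (C.Lpos _).le
    rw [Finset.sum_pair (Ne.symm hne), hk, ← hlen] at h1
    linarith [C.Lpos e'.2]
  obtain ⟨e', he', hX⟩ := U.exX h G
  rw [huniq e' he'] at hX
  have hends : ∀ y, (y = w ∨ y = 2) → ∃ e ∈ C.adjI m k, C.V e.1 (e.2+1) = C.V m y ∨ C.V e.1 (e.2+2) = C.V m y := by
    intro y hy
    have h1 := (U.chain h G).ex_p
    have h2 := (U.chain h G).ex_q
    have := (h.ends (fun y => ∃ e ∈ C.adjI m k, C.V e.1 (e.2+1) = C.V m y ∨ C.V e.1 (e.2+2) = C.V m y)).1 ⟨h1, h2⟩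
    rcases hy with rfl | rfl
    exacts [this.1, this.2]
  obtain ⟨e'', he'', hW⟩ := hends w (Or.inl rfl)
  rw [huniq e'' he'', hk] at hW
  have hW2 : C.V e.1 w = C.V m w ∨ C.V e.1 2 = C.V m w := by
    rcases h with ⟨rfl, rfl⟩ | ⟨rfl, rfl⟩
    · exact hW.symm
    · exact hW
  refine hW2.resolve_right fun h' => ?_
  rw [hX] at h'
  exact h.ne.2.2 ((C.V m).ind.injective h').symm

theorem Uq.exW (U : C.Uq k0 m) (h : KW k w) (G : C.Good m k) :
    ∃ e ∈ C.adjI m k, C.V e.1 (e.2+1) = C.V m w ∨ C.V e.1 (e.2+2) = C.V m w := 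
  ((h.ends (fun y => ∃ e ∈ C.adjI m k, C.V e.1 (e.2+1) = C.V m y ∨ C.V e.1 (e.2+2) = C.V m y)).1
    ⟨(U.chain h G).ex_p, (U.chain h G).ex_q⟩).1

theorem Uq.Pcorner (U : C.Uq k0 m) (hHI : C.HI) (hab : C.L 1 < C.L 0) :
    (C.V m 0 = C.B (k0+1) ∨ C.V m 0 = C.B (k0+2)) ∧ 2 ≤ C.Nv 0 (C.V m 0) := by
  have h : KW 1 0 := Or.inl ⟨rfl, rfl⟩
  have G := U.good h
  obtain ⟨e, he, hX⟩ := U.exX h G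
  have e2 : e.2 = 1 := by
    have h1 := U.le h G he
    have h2 := U.ne2 h G he
    have : e.2 ≠ 0 := by intro h0; rw [h0] at h1; linarith
    omega
  have := U.single h G he e2
  have h2 := C.Nv_two (C.mem_adjI.1 he).1 this rfl
  refine ⟨?_, h2⟩
  by_contra hc
  push Not at hc
  have := U.noncorner hHI h hc.1 hc.2
  omega

theorem Uq.JS (U : C.Uq k0 m) (hHI : C.HI) (hab : C.L 1 < C.L 0) :
    (∃ j : ℕ, 2 ≤ j ∧ C.L 0 = j * C.L 1 ∧ 1 ≤ C.Nv 0 (C.V m 1) ∧ 1 ≤ C.Nv 1 (C.V m 1)) ∨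
    ((C.V m 1 = C.B (k0+1) ∨ C.V m 1 = C.B (k0+2)) ∧ 2 ≤ C.Nv 1 (C.V m 1)) := by
  have h : KW 0 1 := Or.inr ⟨rfl, rfl⟩
  have G := U.good h
  by_cases hS : ∃ e ∈ C.adjI m 0, e.2 = 0
  · right
    obtain ⟨e, he, e2⟩ := hS
    have := U.single h G he e2
    have h2 := C.Nv_two (C.mem_adjI.1 he).1 this rfl
    refine ⟨?_, h2⟩
    by_contra hc
    push Not at hc
    have := U.noncorner hHI h hc.1 hc.2
    omega
  · left
    push Not at hS
    have h1 : ∀ e ∈ C.adjI m 0, e.2 = 1 := by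
      intro e he
      have := hS e he
      have := U.ne2 h G he
      omega
    have hl := U.chlen h G
    rw [Finset.sum_congr rfl (fun e he => by rw [h1 e he] : ∀ e ∈ C.adjI m 0, C.L e.2 = C.L 1), Finset.sum_const,
      nsmul_eq_mul] at hl
    refine ⟨_, ?_, hl, ?_, C.Nv_pos rfl⟩
    · by_contra hc
      have : (C.adjI m 0).card ≤ 1 := by omega
      have : ((C.adjI m 0).card : ℝ) ≤ 1 := by exact_mod_cast this
      have := C.Lpos 1
      nlinarith
    · obtain ⟨e, he, hW⟩ := U.exW h G
      rw [h1 e he] at hW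
      rcases hW with hW | hW
      · exact absurd hW (U.notW h G he (U.ne2 h G he))
      · exact C.Nv_pos hW

theorem Uq.corner_of_len (U : C.Uq k0 m) (hl : dist (C.B (k0+1)) (C.B (k0+2)) = C.L 2) (h : KW k w) :
    C.V m w = C.B (k0+1) ∨ C.V m w = C.B (k0+2) := by
  by_contra hc
  push Not at hc
  obtain ⟨s, hs, hs2, hsW⟩ := U.Wex h hc.1 hc.2
  rw [(C.sideChain k0).len] at hl
  have hne : s ≠ (m, 2) := fun h => hs2 (by rw [h])
  have h1 : ∑ x ∈ ({s, (m,2)} : Finset (Fin N × Fin 3)), C.L x.2 ≤ ∑ e ∈ C.sideI k0, C.L e.2 := by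
    apply Finset.sum_le_sum_of_subset_of_nonneg
    · intro x hx
      simp only [Finset.mem_insert, Finset.mem_singleton] at hx
      rcases hx with rfl | rfl
      exacts [hs, U.mem]
    · intro x _ _; exact (C.Lpos _).le
  rw [Finset.sum_pair hne] at h1
  have := C.Lpos s.2
  change ∑ e ∈ C.sideI k0, C.L e.2 = C.L 2 at hl
  simp only at h1
  linarith

end Cfg
end Part7

section Part8
open MeasureTheory

def triC (b : AB) : Set Pt := {y | ∀ k, 0 ≤ b.coord k y}

def stdS : Set Pt := {x | 0 ≤ x 0 ∧ 0 ≤ x 1 ∧ x 0 + x 1 ≤ 1}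

def areaOf (b : AB) (k : Fin 3) : ℝ := sideLen b (k+1) * sideLen b (k+2) * Real.sin (triAngle b k)

theorem areaOf_succ (b : AB) (k : Fin 3) : areaOf b (k+1) = areaOf b k := by
  unfold areaOf
  obtain ⟨e1, e2, e3, e4⟩ := k3 k
  rw [e1, e3]
  linear_combination (-(sideLen b (k+2))) * sines b k

theorem areaOf_eq (b : AB) (k l : Fin 3) : areaOf b k = areaOf b l := by
  rcases fin3 k l with rfl | rfl | rfl
  · rfl
  · rw [areaOf_succ]
  · rw [← (k3 k).1, areaOf_succ, areaOf_succ]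

def fmat (u v : Pt) : Matrix (Fin 2) (Fin 2) ℝ := !![u 0, v 0; u 1, v 1]

theorem abs_det (u v : Pt) : |(fmat u v).det| = Real.sin (InnerProductGeometry.angle u v) * (‖u‖ * ‖v‖) := by
  rw [InnerProductGeometry.sin_angle_mul_norm_mul_norm, ← Real.sqrt_sq_eq_abs]
  congr 1
  simp only [fmat, Matrix.det_fin_two, PiLp.inner_apply, Fin.sum_univ_two, Matrix.of_apply, Matrix.cons_val', Matrix.cons_val_zero,
    Matrix.cons_val_one, Matrix.cons_val_fin_one, RCLike.inner_apply, conj_trivial]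
  ring

theorem fmat_apply (u v x : Pt) : Matrix.toEuclideanLin (fmat u v) x = x 0 • u + x 1 • v := by
  ext i
  fin_cases i <;> simp [fmat, Matrix.toEuclideanLin, Matrix.mulVec, dotProduct, Fin.sum_univ_two] <;> ring

theorem triC_image (b : AB) : triC b = (fun x => b 0 + x) '' (Matrix.toEuclideanLin (fmat (b 1 - b 0) (b 2 - b 0)) '' stdS) := by
  have hco : ∀ (x : Pt), ∀ k, b.coord k (b 0 + (x 0 • (b 1 - b 0) + x 1 • (b 2 - b 0))) = ![1 - x 0 - x 1, x 0, x 1] k := by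
    intro x k
    rw [← add_assoc, co_add, co_add, lc_sub, lc_sub]
    fin_cases k <;> simp; ring
  rw [Set.image_image]
  ext y
  simp only [Set.mem_image, fmat_apply]
  constructor
  · intro hy
    refine ⟨!₂[b.coord 1 y, b.coord 2 y], ⟨?_, ?_, ?_⟩, ?_⟩
    · simpa using hy 1
    · simpa using hy 2
    · have := co_sum b y; have := hy 0; simp; linarith
    · apply co_ext b
      intro k
      rw [hco]
      have := co_sum b y
      fin_cases k <;> simp
      linarith
  · rintro ⟨x, ⟨h0, h1, h2⟩, rfl⟩ k
    rw [hco]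
    fin_cases k <;> simp <;> linarith

theorem vol_triC (b : AB) : volume (triC b) = ENNReal.ofReal (areaOf b 0) * volume stdS := by
  rw [triC_image, Set.image_add_left, measure_preimage_add, Measure.addHaar_image_linearMap]
  congr 2
  rw [Matrix.toEuclideanLin, Matrix.toLpLin_eq_toLin, LinearMap.det_toLin, abs_det]
  unfold areaOf sideLen triAngle EuclideanGeometry.angle
  simp only [vsub_eq_sub, zero_add]
  rw [show (1:Fin 3) + 1 = 2 from rfl, show (1:Fin 3) + 2 = 0 from rfl, show (2:Fin 3) + 1 = 0 from rfl,
    show (2:Fin 3) + 2 = 1 from rfl, dist_eq_norm, dist_comm, dist_eq_norm]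
  ring

theorem stdS_pos : 0 < volume stdS := by
  have ho : IsOpen {x : Pt | 0 < x 0 ∧ 0 < x 1 ∧ x 0 + x 1 < 1} := by
    have c0 : Continuous fun x : Pt => x 0 := by fun_prop
    have c1 : Continuous fun x : Pt => x 1 := by fun_prop
    exact (isOpen_lt continuous_const c0).inter ((isOpen_lt continuous_const c1).inter
      (isOpen_lt (c0.add c1) continuous_const))
  refine lt_of_lt_of_le (ho.measure_pos volume ⟨!₂[1/4, 1/4], ?_⟩) (measure_mono ?_)
  · simp; norm_num
  · rintro x ⟨h0, h1, h2⟩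
    exact ⟨h0.le, h1.le, h2.le⟩

theorem stdS_fin : volume stdS ≠ ⊤ := by
  have : stdS ⊆ Metric.closedBall 0 2 := by
    rintro x ⟨h0, h1, h2⟩
    rw [mem_closedBall_zero_iff, EuclideanSpace.norm_eq, Fin.sum_univ_two]
    apply Real.sqrt_le_iff.2
    simp
    nlinarith
  exact ((measure_mono this).trans_lt measure_closedBall_lt_top).ne

theorem null_line (b : AB) (k : Fin 3) : volume {y | b.coord k y = 0} = 0 := by
  let s : AffineSubspace ℝ Pt := AffineSubspace.comap (b.coord k) (AffineSubspace.mk' (0:ℝ) ⊥)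
  have hs : (s : Set Pt) = {y | b.coord k y = 0} := by
    ext y; simp [s, AffineSubspace.mem_mk']
  rw [← hs]
  apply Measure.addHaar_affineSubspace
  intro h
  have : b k ∈ (s : Set Pt) := by rw [h]; simp
  rw [hs] at this
  simp at this

theorem triC_meas (b : AB) : MeasurableSet (triC b) := by
  have : triC b = ⋂ k, {y | 0 ≤ b.coord k y} := by ext y; simp [triC]
  rw [this]
  refine MeasurableSet.iInter fun k => ?_
  have : Continuous (b.coord k) := AffineMap.continuous_of_finiteDimensional _
  exact measurableSet_le measurable_const this.measurable

namespace Cfg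
variable {N : ℕ} (C : Cfg N)

theorem area (k l : Fin 3) : N * areaOf C.T k = areaOf C.B l := by
  have h1 : volume (⋃ i, triC (C.V i)) = ∑ i, volume (triC (C.V i)) := by
    rw [measure_iUnion₀]
    · exact tsum_fintype _
    · intro i j hij
      have : triC (C.V i) ∩ triC (C.V j) ⊆ (⋃ k, {y | (C.V i).coord k y = 0}) ∪ (⋃ k, {y | (C.V j).coord k y = 0}) := by
        rintro y ⟨hi, hj⟩
        by_contra hc
        simp only [Set.mem_union, Set.mem_iUnion, Set.mem_ofPred_eq, not_or, not_exists] at hc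
        exact C.disj i j hij y (fun k => lt_of_le_of_ne (hi k) (Ne.symm (hc.1 k))) (fun k => lt_of_le_of_ne (hj k) (Ne.symm (hc.2 k)))
      refine measure_mono_null this ?_
      rw [measure_union_null_iff, measure_iUnion_null_iff, measure_iUnion_null_iff]
      exact ⟨fun k => null_line _ _, fun k => null_line _ _⟩
    · intro i; exact (triC_meas _).nullMeasurableSet
  have h2 : (⋃ i, triC (C.V i)) = triC C.B := by
    ext y; simp only [Set.mem_iUnion]; exact (C.cov y).symm
  have h3 : ∀ i, areaOf (C.V i) 0 = areaOf C.T 0 := by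
    intro i
    unfold areaOf sideLen
    rw [C.ang_tile, C.hd, C.hd]
  rw [h2, vol_triC] at h1
  simp only [vol_triC, h3] at h1
  rw [Finset.sum_const, nsmul_eq_mul, ← mul_assoc] at h1
  have h4 := (ENNReal.mul_left_inj stdS_pos.ne' stdS_fin).1 h1
  have hp : ∀ b : AB, 0 ≤ areaOf b 0 := by
    intro b
    unfold areaOf
    exact mul_nonneg (mul_nonneg dist_nonneg dist_nonneg) (InnerProductGeometry.sin_angle_nonneg _ _)
  have h5 := congrArg ENNReal.toReal h4
  rw [ENNReal.toReal_mul, ENNReal.toReal_ofReal (hp _), ENNReal.toReal_ofReal (hp _)] at h5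
  simp at h5
  rw [areaOf_eq C.T k 0, areaOf_eq C.B l 0, h5]

end Cfg
end Part8

section Part9
theorem ir {c : ℝ} (hc : Irrational c) {x y : ℤ} (h : (x:ℝ) + y * c = 0) : x = 0 ∧ y = 0 := by
  have hy : y = 0 := by
    by_contra hy
    apply hc
    refine ⟨-x / y, ?_⟩
    have : (y:ℝ) ≠ 0 := by exact_mod_cast hy
    push_cast
    field_simp
    linarith
  refine ⟨?_, hy⟩
  rw [hy] at h
  push_cast at h
  have : (x:ℝ) = 0 := by linarith
  exact_mod_cast this

theorem irr_sqrt {c : ℝ} (hc : 0 ≤ c) {n : ℕ} (h : c ^ 2 = n) (hn : ∀ t : ℕ, t ^ 2 ≠ n) : Irrational c := by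
  have : c = Real.sqrt n := by rw [← h, Real.sqrt_sq hc]
  rw [this, irrational_sqrt_natCast_iff]
  rintro ⟨t, ht⟩
  exact hn t (by rw [ht]; ring)

theorem between {j n t : ℕ} (h1 : j ^ 2 < n) (h2 : n < (j+1)^2) : t ^ 2 ≠ n := by
  intro h
  have a : j < t := by
    by_contra hc
    have : t ^ 2 ≤ j ^ 2 := Nat.pow_le_pow_left (not_lt.1 hc) 2
    omega
  have : (j+1)^2 ≤ t ^ 2 := Nat.pow_le_pow_left a 2
  omega

theorem arA1 {j N u v x : ℕ} {c : ℝ} (hj : 2 ≤ j) (hc : 0 < c) (h1 : c ^ 2 = c + j ^ 2) (hv : 1 ≤ v) (h0 : (j:ℝ) < c)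
    (h : (N:ℝ) * j ^ 2 * c = (u + v * c) * (x + c) * (c + j ^ 2 - 1)) : False := by
  have hir : Irrational (2 * c - 1) := by
    refine irr_sqrt ?_ (n := 4 * j ^ 2 + 1) ?_ ?_
    · have : (2:ℝ) ≤ j := by exact_mod_cast hj
      linarith
    · push_cast; linear_combination 4 * h1
    · intro t
      apply between (j := 2 * j)
      · nlinarith
      · nlinarith
  have hc' : Irrational c := by
    intro ⟨q, hq⟩
    exact hir ⟨2 * q - 1, by push_cast; rw [hq]⟩
  have := (ir hc' (x := (u * x + v * j ^ 2) * (j^2 - 1) + (u + v * x + v) * j ^ 2)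
    (y := (u * x + v * j ^ 2) + (u + v * x + v) * (j ^ 2 - 1) + (u + v * x + v) - N * j ^ 2) (by
      push_cast
      linear_combination (-1) * h - (v * c + u + v * x + v + v * (j^2-1)) * h1)).1
  have p1 : (0:ℤ) ≤ (j:ℤ)^2 - 1 := by have : (2:ℤ) ≤ j := by exact_mod_cast hj
                                      nlinarith
  have p2 : (0:ℤ) < (u + v * x + v) * j ^ 2 := by positivity
  have p3 : (0:ℤ) ≤ (u * x + v * j ^ 2) * (j^2 - 1) := mul_nonneg (by positivity) p1
  linarith

theorem irrm {j : ℕ} {c : ℝ} (hj : 2 ≤ j) (hc : 0 < c) (h1 : c ^ 2 = (j:ℝ)^2 + j + 1) : Irrational c := by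
  apply irr_sqrt hc.le (n := j ^ 2 + j + 1)
  · push_cast; exact h1
  · intro t; apply between (j := j) <;> nlinarith

theorem arA2 {j N u v x : ℕ} {c : ℝ} (hj : 2 ≤ j) (hc : 0 < c) (h1 : c ^ 2 = (j:ℝ)^2 + j + 1) (hv : 1 ≤ v)
    (h : (N:ℝ) * c ^ 2 = (x + c) * (u + v * c) * (j + 2)) : x = 0 ∧ u = 0 := by
  have := (ir (irrm hj hc h1) (x := (u * x + v * (j^2+j+1)) * (j + 2) - N * (j^2+j+1)) (y := (u + v * x) * (j + 2)) (by
    push_cast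
    linear_combination (-1) * h - (v * (j + 2) - N) * h1)).2
  have h3 : (u + v * x) * (j + 2) = 0 := by exact_mod_cast this
  have h4 : u + v * x = 0 := (Nat.mul_eq_zero.1 h3).resolve_right (by omega)
  constructor
  · have : v * x = 0 := by omega
    exact (Nat.mul_eq_zero.1 this).resolve_left (by omega)
  · omega

theorem arA3 {j N u v x : ℕ} {c : ℝ} (hj : 2 ≤ j) (hc : 0 < c) (h1 : c ^ 2 = (j:ℝ)^2 + j + 1) (hv : 1 ≤ v)
    (h : (N:ℝ) * j * c = (x + c) * (u + v * c) * (j + 1)) : False := by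
  have := (ir (irrm hj hc h1) (x := (u * x + v * (j^2+j+1)) * (j + 1)) (y := (u + v * x) * (j + 1) - N * j) (by
    push_cast
    linear_combination (-1) * h - (v * (j + 1)) * h1)).1
  have : (0:ℤ) < (u * x + v * (j^2+j+1)) * (j + 1) := by positivity
  omega

theorem arA4 {j N u v : ℕ} {c : ℝ} (hj : 2 ≤ j) (hc : 0 < c) (h1 : c ^ 2 = (j:ℝ)^2 + j + 1) (hv : 1 ≤ v)
    (h : (N:ℝ) * j = (u + v * c) * (j + 1)) : False := by
  have := (ir (irrm hj hc h1) (x := u * (j + 1) - N * j) (y := v * (j + 1)) (by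
    push_cast
    linear_combination (-1) * h)).2
  have : (0:ℤ) < v * (j + 1) := by positivity
  omega

theorem arA5 {j v : ℕ} (hj : 2 ≤ j) (h : v * (2 * j + 1) = j ^ 2 + j + 1) : False := by
  have : (2 * j + 1) ∣ 3 := by
    have e : 4 * (v * (2 * j + 1)) = (2 * j + 1) * (2 * j + 1) + 3 := by rw [h]; ring
    have : (2 * j + 1) ∣ (2 * j + 1) * (2 * j + 1) + 3 := by rw [← e]; exact ⟨4 * v, by ring⟩
    exact (Nat.dvd_add_right (Dvd.intro _ rfl)).1 this
  have := Nat.le_of_dvd (by norm_num) this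
  omega

theorem arA6 {N u w v : ℕ} {r c : ℝ} (hr : 1 < r) (hc : 0 < c) (h1 : c ^ 2 = r ^ 2 + r + 1) (hN : (N:ℝ) = (r + 1) * (r + 2))
    (hv : 1 ≤ v) (h : r * (r + 2) = u * r + w + v * c) : False := by
  have hN6 : 6 < N := by
    have : (6:ℝ) < N := by rw [hN]; nlinarith
    exact_mod_cast this
  have hvR : (0:ℝ) < v := by exact_mod_cast hv
  by_cases hsq : ∃ n : ℕ, n ^ 2 = 4 * N + 1
  · obtain ⟨n, hn⟩ := hsq
    have hodd : n % 2 = 1 := by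
      rcases Nat.mod_two_eq_zero_or_one n with h | h
      · exfalso
        obtain ⟨q, rfl⟩ : ∃ q, n = 2 * q := ⟨n / 2, by omega⟩
        ring_nf at hn; omega
      · exact h
    have hnr : (n:ℝ) = 2 * r + 3 := by
      have : (n:ℝ) ^ 2 = (2 * r + 3) ^ 2 := by
        have : ((n ^ 2 : ℕ) : ℝ) = ((4 * N + 1 : ℕ) : ℝ) := by rw [hn]
        push_cast at this
        rw [this, hN]; ring
      exact (pow_left_inj₀ (by positivity) (by linarith) (by norm_num)).1 this
    obtain ⟨R, hR⟩ : ∃ R : ℕ, n = 2 * R + 3 := by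
      refine ⟨(n - 3) / 2, ?_⟩
      have : (5:ℝ) < n := by linarith
      have : 5 < n := by exact_mod_cast this
      omega
    have hRr : r = R := by
      rw [hR] at hnr; push_cast at hnr; linarith
    subst hRr
    have hR1 : 1 < R := by exact_mod_cast hr
    have hir := irrm hR1 hc h1
    have := (ir hir (x := (u:ℤ) * R + w - R * (R + 2)) (y := v) (by push_cast; linarith)).2
    omega
  · push Not at hsq
    have hir : Irrational (2 * r + 3) := by
      apply irr_sqrt (by linarith) (n := 4 * N + 1) _ hsq
      push_cast; rw [hN]; ring
    have hir' : Irrational r := by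
      intro ⟨q, hq⟩
      exact hir ⟨2 * q + 3, by push_cast; rw [hq]⟩
    set s : ℤ := 1 + u with hs
    set K : ℤ := N - 2 - w with hK
    have e : (v:ℝ) * c = K - s * r := by rw [hK, hs]; push_cast; linear_combination (-1) * h - hN
    have e2 : (v:ℝ)^2 * (N - 1 - 2 * r) = K ^ 2 + s ^ 2 * (N - 2) - (2 * K * s + 3 * s ^ 2) * r := by
      have : ((v:ℝ) * c) ^ 2 = (K - s * r) ^ 2 := by rw [e]
      linear_combination this + ((v:ℝ)^2 - s ^ 2) * hN - (v:ℝ)^2 * h1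
    obtain ⟨i1, i2⟩ := ir hir' (x := (v:ℤ)^2 * (N - 1) - K ^ 2 - s ^ 2 * (N - 2)) (y := 2 * K * s + 3 * s ^ 2 - 2 * v ^ 2) (by
      push_cast; linear_combination e2)
    have key : (2 * K - (N - 1) * s) ^ 2 = s ^ 2 * ((N:ℤ) ^ 2 + 3) := by
      linear_combination (-4) * i1 - 2 * (N - 1) * i2
    have hs0 : s ≠ 0 := by omega
    have hdv : s ∣ (2 * K - (N - 1) * s) := by
      rw [← Int.pow_dvd_pow_iff (n := 2) (by norm_num), key]; exact Dvd.intro _ rfl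
    obtain ⟨t, ht⟩ := hdv
    rw [ht, mul_pow] at key
    have key2 := mul_left_cancel₀ (pow_ne_zero 2 hs0) key
    have : t.natAbs ^ 2 = N ^ 2 + 3 := by
      have : ((t.natAbs ^ 2 : ℕ) : ℤ) = ((N ^ 2 + 3 : ℕ) : ℤ) := by push_cast; rw [sq_abs, key2]
      exact_mod_cast this
    exact between (j := N) (by omega) (by nlinarith) this
end Part9

section Part10
theorem T0 (x y : ℝ) : Real.sin (x - y) * Real.sin (x + y) = Real.sin x ^ 2 - Real.sin y ^ 2 := by
  rw [Real.sin_sub, Real.sin_add]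
  linear_combination (-(Real.sin y)^2) * Real.sin_sq_add_cos_sq x + (Real.sin x)^2 * Real.sin_sq_add_cos_sq y

theorem T3 (x y z : ℝ) (h : x + y + z = π) : 2 * Real.cos x * Real.sin y * Real.sin z =
    Real.sin y ^ 2 + Real.sin z ^ 2 - Real.sin x ^ 2 := by
  have : Real.sin z = Real.sin (x + y) := by rw [← Real.sin_pi_sub]; congr 1; linarith
  rw [this, Real.sin_add]
  linear_combination (Real.sin y ^ 2) * Real.sin_sq_add_cos_sq x - (Real.sin x)^2 * Real.sin_sq_add_cos_sq y

theorem tri3 {p q l : Fin 3} (h1 : p ≠ q) (h2 : p ≠ l) (h3 : q ≠ l) :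
    (p = l + 1 ∧ q = l + 2) ∨ (p = l + 2 ∧ q = l + 1) := by
  revert p q l; decide

namespace Cfg
variable {N : ℕ} (C : Cfg N)

def r : ℝ := C.L 0 / C.L 1
def c : ℝ := C.L 2 / C.L 1
def s : ℝ := Real.sin C.β
def S (k : Fin 3) : ℝ := sideLen C.B k / C.L 1

theorem rpos : 0 < C.r := div_pos (C.Lpos _) (C.Lpos _)
theorem cpos : 0 < C.c := div_pos (C.Lpos _) (C.Lpos _)
theorem spos : 0 < C.s := C.sinβ
theorem Spos (k : Fin 3) : 0 < C.S k := div_pos (sidepos _ _) (C.Lpos _)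
theorem sα : Real.sin C.α = C.r * C.s := by
  have := C.Lpos 1
  unfold r s; field_simp; linarith [C.law01]
theorem sγ : Real.sin C.γ = C.c * C.s := by
  have := C.Lpos 1
  unfold c s; field_simp; linarith [C.law12]

theorem rc : C.r < C.c := div_lt_div_of_pos_right C.L02 (C.Lpos 1)

theorem T1' : Real.sin (C.γ - C.β) * C.r = (C.c ^ 2 - 1) * C.s := by
  have h := T0 C.γ C.β
  rw [show C.γ + C.β = π - C.α by linarith [C.abg], Real.sin_pi_sub, C.sα, C.sγ] at h
  have hs := C.spos
  apply mul_right_cancel₀ hs.ne'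
  unfold s at *
  linear_combination h

theorem T2' : Real.sin (C.γ - C.α) = (C.c ^ 2 - C.r ^ 2) * C.s := by
  have h := T0 C.γ C.α
  rw [show C.γ + C.α = π - C.β by linarith [C.abg], Real.sin_pi_sub, C.sα, C.sγ] at h
  have hs := C.spos
  apply mul_right_cancel₀ hs.ne'
  unfold s at *
  linear_combination h

theorem T3' : Real.sin (2 * C.α) * C.c = C.r * (1 + C.c ^ 2 - C.r ^ 2) * C.s := by
  have h := T3 C.α C.β C.γ C.abg
  rw [C.sα, C.sγ] at h
  rw [Real.sin_two_mul, C.sα]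
  have hs := C.spos
  apply mul_right_cancel₀ hs.ne'
  unfold s at *
  linear_combination C.r * h

theorem T4' : Real.sin (2 * C.β) * (C.r * C.c) = (C.r ^ 2 + C.c ^ 2 - 1) * C.s := by
  have h := T3 C.β C.α C.γ (by linarith [C.abg])
  rw [C.sα, C.sγ] at h
  rw [Real.sin_two_mul]
  have hs := C.spos
  apply mul_right_cancel₀ hs.ne'
  unfold s at *
  linear_combination h

theorem areaN {p q l : Fin 3} (h1 : p ≠ q) (h2 : p ≠ l) (h3 : q ≠ l) :
    N * (C.r * C.c * C.s) = C.S p * C.S q * Real.sin (triAngle C.B l) := by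
  have h := C.area 2 l
  have hT : areaOf C.T 2 = C.L 0 * C.L 1 * Real.sin C.γ := rfl
  have hB : areaOf C.B l = sideLen C.B p * sideLen C.B q * Real.sin (triAngle C.B l) := by
    unfold areaOf
    rcases tri3 h1 h2 h3 with ⟨rfl, rfl⟩ | ⟨rfl, rfl⟩
    · rfl
    · ring
  rw [hT, hB, C.sγ] at h
  have := C.Lpos 1
  have e1 : C.L 0 = C.r * C.L 1 := by unfold r; field_simp
  have e2 : ∀ k, sideLen C.B k = C.S k * C.L 1 := by intro k; unfold S; field_simp
  rw [e1, e2, e2] at h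
  have : C.L 1 ^ 2 ≠ 0 := by positivity
  apply mul_right_cancel₀ this
  linear_combination h

theorem lawB {p q l : Fin 3} (h1 : p ≠ q) (h2 : p ≠ l) (h3 : q ≠ l) : C.S p * Real.sin (triAngle C.B q) =
    C.S q * Real.sin (triAngle C.B p) := by
  have a1 := C.areaN h1 h2 h3
  have a2 := C.areaN (p := p) (q := l) (l := q) h2 h1 h3.symm
  have a3 := C.areaN (p := q) (q := l) (l := p) h3 h1.symm h2.symm
  have := C.Spos l
  apply mul_right_cancel₀ this.ne'
  linarith

theorem sum3 {p q l : Fin 3} (h1 : p ≠ q) (h2 : p ≠ l) (h3 : q ≠ l) :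
    C.Pa = C.Nv 0 (C.B p) + C.Nv 0 (C.B q) + C.Nv 0 (C.B l) ∧ C.Qb = C.Nv 1 (C.B p) + C.Nv 1 (C.B q) + C.Nv 1 (C.B l) := by
  unfold Pa Qb
  rcases tri3 h1 h2 h3 with ⟨rfl, rfl⟩ | ⟨rfl, rfl⟩ <;> fin_cases l <;> simp <;> omega

theorem sum_sides (I : Finset (Fin N × Fin 3)) : ∃ x y z : ℕ, ∑ e ∈ I, C.L e.2 = x * C.L 0 + y * C.L 1 + z * C.L 2 ∧
    z = (I.filter fun e => e.2 = 2).card := by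
  classical
  refine ⟨(I.filter fun e => e.2 = 0).card, (I.filter fun e => e.2 = 1).card, _, ?_, rfl⟩
  have h : ∀ e : Fin N × Fin 3, C.L e.2 = (if e.2 = 0 then C.L 0 else 0) + (if e.2 = 1 then C.L 1 else 0) + (if e.2 = 2 then C.L 2 else 0) := by
    rintro ⟨i, k⟩
    fin_cases k <;> simp
  rw [Finset.sum_congr rfl (fun e _ => h e), Finset.sum_add_distrib, Finset.sum_add_distrib]
  simp only [← Finset.sum_filter, Finset.sum_const, nsmul_eq_mul]

theorem side_len (k : Fin 3) : sideLen C.B k = ∑ e ∈ C.sideI k, C.L e.2 := (C.sideChain k).len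

theorem sides (k : Fin 3) : ∃ x y z : ℕ, C.S k = x * C.r + y + z * C.c ∧ 1 ≤ z ∧ (z = 1 → ∃ m, C.Uq k m) ∧
    ((∃ m, C.Uq k m) → z = 1) := by
  obtain ⟨x, y, z, h, hz⟩ := C.sum_sides (C.sideI k)
  rw [← C.side_len] at h
  have hL := C.Lpos 1
  refine ⟨x, y, z, ?_, ?_, ?_, ?_⟩
  · unfold S r c; rw [h]; field_simp
  · obtain ⟨e, he, h2⟩ := (C.side_pig k).1
    rw [hz]
    exact Finset.card_pos.2 ⟨e, by simp [he, h2]⟩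
  · intro h1
    rw [h1] at hz
    obtain ⟨e, he⟩ := Finset.card_eq_one.1 hz.symm
    have hm : ∀ e', (e' ∈ C.sideI k ∧ e'.2 = 2) ↔ e' = e := by
      intro e'
      have := Finset.ext_iff.1 he e'
      simpa [Finset.mem_filter] using this
    obtain ⟨m1, m2⟩ := (hm e).2 rfl
    refine ⟨e.1, ?_, ?_⟩
    · have : (e.1, (2:Fin 3)) = e := by rw [← m2]
      rw [this]; exact m1
    · intro e1 h1 e2 h2 g1 g2
      rw [(hm e1).1 ⟨h1, g1⟩, (hm e2).1 ⟨h2, g2⟩]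
  · rintro ⟨m, U⟩
    rw [hz, Finset.card_eq_one]
    refine ⟨(m, 2), ?_⟩
    ext e
    rw [Finset.mem_filter, Finset.mem_singleton]
    constructor
    · rintro ⟨h1, h2⟩; exact U.uniq _ h1 _ U.mem h2 rfl
    · rintro rfl; exact ⟨U.mem, rfl⟩

theorem s_of_int {q : Fin 3} : C.Nv 0 (C.B q) * C.α + C.Nv 1 (C.B q) * C.β = triAngle C.B q := (C.corner q).2.2.2

theorem c_eq3 (h : 3 * C.α + 3 * C.β = π) : C.c ^ 2 = C.r ^ 2 + C.r + 1 := by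
  have h2 := C.T2'
  have hg : C.γ - C.α = (C.α + C.β) + C.β := by linarith [C.abg]
  have hc : Real.cos (C.α + C.β) = 1 / 2 := by
    rw [show C.α + C.β = π / 3 by linarith, Real.cos_pi_div_three]
  have h3 : Real.sin C.α = Real.sin (C.α + C.β) * Real.cos C.β - Real.cos (C.α + C.β) * Real.sin C.β := by
    rw [← Real.sin_sub]; congr 1; ring
  rw [hg, Real.sin_add, hc] at h2
  rw [hc, C.sα] at h3
  apply mul_right_cancel₀ C.spos.ne'
  unfold s at *
  linarith

variable {C} {k0 : Fin 3} {m : Fin N}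

theorem Uq.frame (U : C.Uq k0 m) (hHI : C.HI) (hab : C.L 1 < C.L 0) :
    ∃ A Q : Fin 3, A ≠ Q ∧ A ≠ k0 ∧ Q ≠ k0 ∧ C.V m 0 = C.B A ∧ 2 ≤ C.Nv 0 (C.B A) ∧
      ((C.V m 1 = C.B (k0+1) ∨ C.V m 1 = C.B (k0+2)) → C.V m 1 = C.B Q) := by
  obtain ⟨h, h2⟩ := U.Pcorner hHI hab
  obtain ⟨n1, n2, n3, n4, n5, n6⟩ := kne k0
  have hne : C.V m 1 ≠ C.V m 0 := fun h => absurd ((C.V m).ind.injective h) (by decide)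
  rcases h with h | h
  · refine ⟨k0+1, k0+2, n3, n4, n5, h, by rwa [h] at h2, ?_⟩
    rintro (h' | h')
    · exact absurd (h'.trans h.symm) hne
    · exact h'
  · refine ⟨k0+2, k0+1, n6, n5, n4, h, by rwa [h] at h2, ?_⟩
    rintro (h' | h')
    · exact h'
    · exact absurd (h'.trans h.symm) hne

theorem Uq.J (U : C.Uq k0 m) (hHI : C.HI) (hab : C.L 1 < C.L 0) {j : ℕ} (hj : 2 ≤ j) (hL : C.L 0 = j * C.L 1)
    (n0 : 1 ≤ C.Nv 0 (C.V m 1)) (n1 : 1 ≤ C.Nv 1 (C.V m 1)) : False := by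
  obtain ⟨A, Q, hAQ, hAk, hQk, hP, hA2, hQ⟩ := U.frame hHI hab
  obtain ⟨hPa, hQb⟩ := C.sum3 hAQ hAk hQk
  have hPQ := C.PQ
  obtain ⟨hP3, hQ3⟩ := U.three hHI
  have cA := C.s_of_int (q := A)
  have hlt := C.Blt A
  have hα := C.αpos; have hβ := C.βpos; have habg := C.abg; have hγ := C.γgt; have hπ := Real.pi_pos
  have hr : C.r = j := by unfold r; rw [hL]; have := C.Lpos 1; field_simp
  have hαβ := C.αβ hab
  have h2β : 2 * C.β < C.α := by
    by_contra hc
    push Not at hc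
    have h1 : Real.sin C.α ≤ Real.sin (2 * C.β) := by
      apply Real.sin_le_sin_of_le_of_le_pi_div_two <;> linarith
    rw [Real.sin_two_mul, C.sα, hr] at h1
    have h2 : Real.cos C.β < 1 := by
      rw [← Real.cos_zero]
      apply Real.cos_lt_cos_of_nonneg_of_le_pi_div_two <;> linarith
    have h3 : (2:ℝ) ≤ j := by exact_mod_cast hj
    have := C.spos
    unfold s at *
    nlinarith
  have hA0 : (2:ℝ) * C.α ≤ C.Nv 0 (C.B A) * C.α := by
    apply mul_le_mul_of_nonneg_right _ hα.le; exact_mod_cast hA2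
  have hA1 : (0:ℝ) ≤ C.Nv 1 (C.B A) * C.β := by positivity
  have hQ3' : (C.Qb:ℝ) * C.β ≤ 3 * C.β := by
    apply mul_le_mul_of_nonneg_right _ hβ.le; exact_mod_cast hQ3
  have hPa3 : C.Pa = 3 := by
    by_contra hc
    have : C.Pa = 2 := by omega
    rw [this] at hPQ
    push_cast at hPQ
    linarith
  rw [hPa3] at hPQ
  push_cast at hPQ
  have hA1' : C.Nv 1 (C.B A) + 1 < C.Qb := by
    by_contra hc
    have : (C.Qb : ℝ) * C.β ≤ (C.Nv 1 (C.B A) + 1) * C.β := by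
      apply mul_le_mul_of_nonneg_right _ hβ.le; exact_mod_cast not_lt.1 hc
    linarith
  have hA02 : C.Nv 0 (C.B A) = 2 := by
    by_contra hc
    have : (3:ℝ) * C.α ≤ C.Nv 0 (C.B A) * C.α := by
      apply mul_le_mul_of_nonneg_right _ hα.le; exact_mod_cast (by omega : 3 ≤ C.Nv 0 (C.B A))
    linarith
  rw [hA02] at cA
  obtain ⟨x, y, z, hS1, -, -, hz⟩ := C.sides k0
  rw [hz ⟨m, U⟩, hr] at hS1
  obtain ⟨x', y', z', hS2, hz', -, -⟩ := C.sides Q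
  rw [hr] at hS2
  have hArea := C.areaN hQk.symm hAk.symm hAQ.symm
  rw [hS1, hS2, hr] at hArea
  have hs := C.spos; have hcp := C.cpos
  have hsc := fun {x y : ℝ} => mul_right_cancel₀ (a := x) (b := C.s) (c := y) hs.ne'
  have t1 := C.T1'; have t2 := C.T2'; have t3 := C.T3'; have t4 := C.T4'
  rw [hr] at t1 t2 t3 t4
  push_cast at cA hS1
  have hjp : (0:ℝ) < j := by exact_mod_cast (by omega : 0 < j)
  have hQbc : C.Qb = 2 ∨ C.Qb = 3 := by omega
  rcases hQbc with h2 | h3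
  · rw [h2] at hPQ
    push_cast at hPQ
    rw [show C.Nv 1 (C.B A) = 0 by omega] at cA
    have hA : triAngle C.B A = C.γ - C.β := by push_cast at cA; linarith
    rw [show C.γ - C.α = π - C.γ by linarith, Real.sin_pi_sub, C.sγ] at t2
    have hc2 : C.c ^ 2 = C.c + (j:ℝ)^2 := by
      apply hsc; linear_combination -t2
    rw [hA] at hArea
    refine arA1 (N := N) (u := x' * j + y') (v := z') (x := x * j + y) hj hcp hc2 hz' (hr ▸ C.rc) ?_
    apply hsc
    push_cast at hArea ⊢
    linear_combination (j:ℝ) * hArea + ((x:ℝ) * j + y + C.c) * (x' * j + y' + z' * C.c) * (t1 + C.s * hc2)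
  · rw [h3] at hPQ
    push_cast at hPQ
    have hc2 := C.c_eq3 hPQ
    rw [hr] at hc2
    have hA1c : C.Nv 1 (C.B A) = 0 ∨ C.Nv 1 (C.B A) = 1 := by omega
    rcases hA1c with hA1z | hA1o
    · have hA : triAngle C.B A = 2 * C.α := by rw [hA1z] at cA; push_cast at cA; linarith
      rw [hA] at hArea
      obtain ⟨hx, hu⟩ := arA2 (N := N) (u := x' * j + y') (v := z') (x := x * j + y) hj hcp hc2 hz' (by
        apply hsc
        apply mul_right_cancel₀ hjp.ne'
        push_cast at hArea ⊢
        linear_combination C.c * hArea + ((x:ℝ) * j + y + C.c) * (x' * j + y' + z' * C.c) * (t3 + j * C.s * hc2))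
      have hSk : C.S k0 = C.c := by
        rw [hS1]
        have : (x:ℝ) * j + y = 0 := by exact_mod_cast hx
        rw [this]; ring
      have hSQ : C.S Q = z' * C.c := by
        rw [hS2]
        have : (x':ℝ) * j + y' = 0 := by exact_mod_cast hu
        rw [this]; ring
      have hVQ := hQ (U.corner_of_len (by
        unfold S c at hSk
        exact (div_left_inj' (C.Lpos 1).ne').1 hSk) (Or.inr ⟨rfl, rfl⟩ : KW 0 1))
      rw [hVQ] at n0 n1
      have cQ := C.s_of_int (q := Q)
      have ck := C.s_of_int (q := k0)
      have kpos := tri_pos C.B k0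
      have hk0 : C.Nv 0 (C.B k0) = 0 := by omega
      have hk1 : C.Nv 1 (C.B k0) ≠ 0 := by
        intro h; rw [hk0, h] at ck; push_cast at ck; linarith
      rw [show C.Nv 0 (C.B Q) = 1 by omega] at cQ
      have hQ1c : C.Nv 1 (C.B Q) = 2 ∨ C.Nv 1 (C.B Q) = 1 := by omega
      have hAreaQ := C.areaN hAk.symm hQk.symm hAQ
      obtain ⟨x3, y3, z3, hS3, hz3, -, -⟩ := C.sides A
      rw [hr] at hS3
      rcases hQ1c with hQ2 | hQ1
      · have hQa : triAngle C.B Q = C.γ - C.α := by rw [hQ2] at cQ; push_cast at cQ; linarith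
        rw [hQa, t2, hSk, hS3, hr] at hAreaQ
        refine arA4 (N := N) (u := x3 * j + y3) (v := z3) hj hcp hc2 hz3 ?_
        apply hsc
        apply mul_right_cancel₀ hcp.ne'
        push_cast
        linear_combination hAreaQ + C.s * C.c * (x3 * j + y3 + z3 * C.c) * hc2
      · have hQa : triAngle C.B Q = π - C.γ := by rw [hQ1] at cQ; push_cast at cQ; linarith
        have hka : triAngle C.B k0 = 2 * C.β := by
          rw [hk0, show C.Nv 1 (C.B k0) = 2 by omega] at ck; push_cast at ck; linarith
        have hl := C.lawB hQk.symm hAk.symm hAQ.symm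
        rw [hSk, hSQ, hQa, hka, Real.sin_pi_sub, C.sγ] at hl
        have : (z':ℝ) * (2 * j + 1) = j ^ 2 + j + 1 := by
          apply hsc
          apply mul_right_cancel₀ hjp.ne'
          linear_combination (-(z':ℝ)) * t4 - z' * C.s * hc2 - j * hl + j * C.s * hc2
        exact arA5 hj (by exact_mod_cast this)
    · have hA : triAngle C.B A = π - (C.γ - C.α) := by rw [hA1o] at cA; push_cast at cA; linarith
      rw [hA, Real.sin_pi_sub, t2] at hArea
      refine arA3 (N := N) (u := x' * j + y') (v := z') (x := x * j + y) hj hcp hc2 hz' ?_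
      apply hsc
      push_cast at hArea ⊢
      linear_combination hArea + C.s * ((x:ℝ) * j + y + C.c) * (x' * j + y' + z' * C.c) * hc2

end Cfg
end Part10

section Part11
theorem sin2lt {x : ℝ} (h0 : 0 < x) (h1 : x < π / 2) : Real.sin (2 * x) < 2 * Real.sin x := by
  rw [Real.sin_two_mul]
  have h2 : Real.cos x < 1 := by
    rw [← Real.cos_zero]
    apply Real.cos_lt_cos_of_nonneg_of_le_pi_div_two <;> linarith
  have := Real.sin_pos_of_pos_of_lt_pi h0 (by linarith [Real.pi_pos])
  nlinarith

theorem kpq {A Q k l : Fin 3} (h1 : A ≠ Q) (h2 : A ≠ k) (h3 : Q ≠ k) : l = A ∨ l = Q ∨ l = k := by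
  revert A Q k l; decide

namespace Cfg
variable {N : ℕ} {C : Cfg N} {k0 : Fin 3} {m : Fin N}

theorem Uq.dat (U : C.Uq k0 m) (hHI : C.HI) (hab : C.L 1 < C.L 0) :
    ∃ A Q : Fin 3, A ≠ Q ∧ A ≠ k0 ∧ Q ≠ k0 ∧ 2 ≤ C.Nv 0 (C.B A) ∧ 2 ≤ C.Nv 1 (C.B Q) ∧ C.S k0 = C.c := by
  obtain ⟨A, Q, hAQ, hAk, hQk, hP, hA2, hQ⟩ := U.frame hHI hab
  rcases U.JS hHI hab with ⟨j, hj, hL, n0, n1⟩ | ⟨h, n1⟩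
  · exact (U.J hHI hab hj hL n0 n1).elim
  have hV := hQ h
  refine ⟨A, Q, hAQ, hAk, hQk, hA2, by rwa [hV] at n1, ?_⟩
  have h2 := C.dV m 2
  change dist (C.V m 0) (C.V m 1) = _ at h2
  rw [hP, hV] at h2
  have : sideLen C.B k0 = C.L 2 := by
    rw [← h2]
    unfold sideLen
    rcases tri3 hAQ hAk hQk with ⟨rfl, rfl⟩ | ⟨rfl, rfl⟩
    · rfl
    · exact dist_comm _ _
  unfold S c
  rw [this]

theorem Uq.false (U : C.Uq k0 m) (hHI : C.HI) (hab : C.L 1 < C.L 0) : False := by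
  obtain ⟨A, Q, hAQ, hAk, hQk, hA2, hQ2, hS⟩ := U.dat hHI hab
  obtain ⟨hPa, hQb⟩ := C.sum3 hAQ hAk hQk
  have hPQ := C.PQ
  obtain ⟨hP3, hQ3⟩ := U.three hHI
  have cA := C.s_of_int (q := A)
  have cQ := C.s_of_int (q := Q)
  have ck := C.s_of_int (q := k0)
  have kpos := tri_pos C.B k0
  have hα := C.αpos; have hβ := C.βpos; have habg := C.abg; have hγ := C.γgt; have hπ := Real.pi_pos
  have hαβ := C.αβ hab
  have hs := C.spos; have hcp := C.cpos; have hrp := C.rpos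
  have nU : ∀ k, k ≠ k0 → ∀ m', ¬ C.Uq k m' := by
    intro k hk m' U'
    obtain ⟨A', Q', hAQ', hAk', hQk', hA2', hQ2', -⟩ := U'.dat hHI hab
    have eA : A' = A := by
      rcases kpq (l := A') hAQ hAk hQk with h | h | h
      · exact h
      · rw [h] at hA2'; omega
      · rw [h] at hA2'; omega
    have eQ : Q' = Q := by
      rcases kpq (l := Q') hAQ hAk hQk with h | h | h
      · rw [h] at hQ2'; omega
      · exact h
      · rw [h] at hQ2'; omega
    rcases kpq (l := k) hAQ hAk hQk with h | h | h
    · exact hAk' (eA.trans h.symm)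
    · exact hQk' (eQ.trans h.symm)
    · exact hk h
  have big : ∀ k, k ≠ k0 → 2 * C.c ≤ C.S k := by
    intro k hk
    obtain ⟨x, y, z, h, h1, h2, -⟩ := C.sides k
    have : 2 ≤ z := by
      by_contra hc
      obtain ⟨m', U'⟩ := h2 (by omega)
      exact nU k hk m' U'
    have : (2:ℝ) ≤ z := by exact_mod_cast this
    rw [h]
    have h4 : 0 ≤ (x:ℝ) * C.r := by positivity
    have h5 : (0:ℝ) ≤ y := by positivity
    nlinarith
  have klt := C.Blt k0
  have ksin : 0 < Real.sin (triAngle C.B k0) :=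
    Real.sin_pos_of_pos_of_lt_pi kpos (klt.trans C.γlt)
  have lA := C.lawB hAk.symm hQk.symm hAQ
  have lQ := C.lawB hQk.symm hAk.symm hAQ.symm
  rw [hS] at lA lQ
  have bA : 2 * Real.sin (triAngle C.B k0) ≤ Real.sin (triAngle C.B A) := by
    have := big A hAk
    by_contra hc
    push Not at hc
    nlinarith
  have bQ : 2 * Real.sin (triAngle C.B k0) ≤ Real.sin (triAngle C.B Q) := by
    have := big Q hQk
    by_contra hc
    push Not at hc
    nlinarith
  have hα2 := sin2lt hα (by linarith)
  have hβ2 := sin2lt hβ (by linarith)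
  have hk : ¬ (C.Nv 0 (C.B k0) = 0 ∧ C.Nv 1 (C.B k0) = 0) := by
    rintro ⟨h1, h2⟩
    rw [h1, h2] at ck; push_cast at ck; linarith
  by_cases hK0 : C.Nv 0 (C.B k0) = 0
  · have e1 : C.Nv 1 (C.B k0) = 1 := by omega
    have e2 : C.Nv 1 (C.B Q) = 2 := by omega
    have e3 : C.Nv 1 (C.B A) = 0 := by omega
    rw [hK0, e1] at ck
    rw [e2] at cQ
    rw [e3] at cA
    have hk' : triAngle C.B k0 = C.β := by push_cast at ck; linarith
    rw [hk'] at bA bQ lA lQ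
    have eQ0 : C.Nv 0 (C.B Q) = 0 ∨ C.Nv 0 (C.B Q) = 1 := by omega
    rcases eQ0 with e4 | e4
    · have : triAngle C.B Q = 2 * C.β := by rw [e4] at cQ; push_cast at cQ; linarith
      rw [this] at bQ
      linarith
    · have e5 : C.Nv 0 (C.B A) = 2 := by omega
      have hA : triAngle C.B A = 2 * C.α := by rw [e5] at cA; push_cast at cA; linarith
      rw [show C.Pa = 3 by omega, show C.Qb = 3 by omega] at hPQ
      push_cast at hPQ
      have hc2 := C.c_eq3 hPQ
      have hQ : triAngle C.B Q = C.γ - C.α := by rw [e4] at cQ; push_cast at cQ; linarith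
      rw [hA] at lA
      have t3 := C.T3'
      have t2 := C.T2'
      have hSA : C.S A = C.r * (C.r + 2) := by
        apply mul_right_cancel₀ hs.ne'
        unfold s at *
        linear_combination t3 - lA + C.r * Real.sin C.β * hc2
      have ar := C.areaN hAk.symm hQk.symm hAQ
      rw [hQ, t2, hS, hSA] at ar
      obtain ⟨u, w, v, h, hv, -⟩ := C.sides A
      have hr1 : 1 < C.r := by unfold r; rw [one_lt_div (C.Lpos 1)]; exact hab
      refine arA6 (N := N) hr1 hcp hc2 ?_ hv (hSA.symm.trans h)
      apply mul_right_cancel₀ (mul_pos (mul_pos hrp hcp) hs).ne'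
      linear_combination ar + C.c * C.r * (C.r + 2) * C.s * hc2
  · have e1 : C.Nv 0 (C.B k0) = 1 := by omega
    have e2 : C.Nv 0 (C.B A) = 2 := by omega
    have e3 : C.Nv 0 (C.B Q) = 0 := by omega
    by_cases hQb2 : C.Qb = 2
    · rw [e1, show C.Nv 1 (C.B k0) = 0 by omega] at ck
      rw [e2, show C.Nv 1 (C.B A) = 0 by omega] at cA
      rw [show triAngle C.B A = 2 * C.α by push_cast at cA; linarith,
        show triAngle C.B k0 = C.α by push_cast at ck; linarith] at bA
      linarith
    · rw [show C.Pa = 3 by omega, show C.Qb = 3 by omega] at hPQ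
      push_cast at hPQ
      rw [e1] at ck
      have h1 : (C.Nv 1 (C.B k0) : ℝ) * C.β ≤ 1 * C.β := by
        apply mul_le_mul_of_nonneg_right _ hβ.le
        exact_mod_cast (by omega : C.Nv 1 (C.B k0) ≤ 1)
      have h0 : 0 ≤ (C.Nv 1 (C.B k0) : ℝ) * C.β := by positivity
      push_cast at ck
      have : Real.sin (π / 6) < Real.sin (triAngle C.B k0) := by
        apply Real.sin_lt_sin_of_lt_of_le_pi_div_two <;> linarith
      rw [Real.sin_pi_div_six] at this
      linarith [Real.sin_le_one (triAngle C.B A)]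

end Cfg
end Part11

section Part12
theorem indep_of_dist {T V : Tri} (hT : IsTriangle T) (h : ∀ k l, dist (V k) (V l) = dist (T k) (T l)) : IsTriangle V := by
  unfold IsTriangle at *
  have e : ∀ W : Tri, W = ![W 0, W 1, W 2] := by
    intro W; funext i; fin_cases i <;> rfl
  rw [e T, affineIndependent_iff_not_collinear_set, collinear_iff_eq_or_eq_or_angle_eq_zero_or_angle_eq_pi] at hT
  rw [e V, affineIndependent_iff_not_collinear_set, collinear_iff_eq_or_eq_or_angle_eq_zero_or_angle_eq_pi]
  have ha : ∠ (V 0) (V 1) (V 2) = ∠ (T 0) (T 1) (T 2) :=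
    EuclideanGeometry.angle_eq_of_congruent (EuclideanGeometry.side_side_side (h 0 1) (h 1 2) (h 2 0)) 0 1 2
  rw [ha]
  have h1 : V 0 = V 1 ↔ T 0 = T 1 := by rw [← dist_eq_zero, h, dist_eq_zero]
  have h2 : V 2 = V 1 ↔ T 2 = T 1 := by rw [← dist_eq_zero, h, dist_eq_zero]
  rw [h1, h2]
  exact hT

def mkAB (T : Tri) (hT : IsTriangle T) : AB :=
  ⟨T, hT, by
    rw [AffineIndependent.affineSpan_eq_top_iff_card_eq_finrank_add_one hT]
    simp⟩

theorem mkAB_apply (T : Tri) (hT : IsTriangle T) (k : Fin 3) : mkAB T hT k = T k := rfl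

theorem mem_triSet_s15 (b : AB) (y : Pt) : y ∈ triSet b ↔ ∀ k, 0 ≤ b.coord k y := by
  unfold triSet
  rw [b.convexHull_eq_nonneg_coord]
  rfl

theorem mem_int_triSet (b : AB) (y : Pt) : y ∈ interior (triSet b) ↔ ∀ k, 0 < b.coord k y := by
  unfold triSet
  rw [b.interior_convexHull]
  rfl

theorem triSet_perm (T : Tri) (σ : Equiv.Perm (Fin 3)) : triSet (T ∘ σ) = triSet T := by
  unfold triSet
  rw [σ.surjective.range_comp]

theorem mem_seg (b : AB) {y : Pt} (h : ∀ k, 0 ≤ b.coord k y) (h1 : b.coord 1 y = 0) : y ∈ segment ℝ (b 0) (b 2) := by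
  have hs := co_sum b y
  refine ⟨b.coord 0 y, b.coord 2 y, h 0, h 2, by linarith, ?_⟩
  have := b.linear_combination_coord_eq_self y
  rw [Fin.sum_univ_three, h1] at this
  simpa using this

namespace Cfg
variable {N : ℕ} (C : Cfg N)

def sw : Equiv.Perm (Fin 3) := Equiv.swap 0 1

theorem swA (b : AB) : triAngle (b.reindex sw) 0 = triAngle b 1 ∧ triAngle (b.reindex sw) 1 = triAngle b 0 ∧
    triAngle (b.reindex sw) 2 = triAngle b 2 :=
  ⟨EuclideanGeometry.angle_comm _ _ _, EuclideanGeometry.angle_comm _ _ _, EuclideanGeometry.angle_comm _ _ _⟩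

theorem swall (p : Fin 3 → Prop) : (∀ k, p (sw.symm k)) ↔ ∀ k, p k :=
  ⟨fun h k => by simpa using h (sw k), fun h k => h _⟩

def swap : Cfg N where
  B := C.B
  T := C.T.reindex sw
  V i := (C.V i).reindex sw
  hd i k l := C.hd i _ _
  disj i j h y h1 h2 := by
    simp only [AffineBasis.coord_reindex] at h1 h2
    exact C.disj i j h y ((swall (fun k => 0 < (C.V i).coord k y)).1 h1) ((swall (fun k => 0 < (C.V j).coord k y)).1 h2)
  cov y := by
    rw [C.cov y]
    simp only [AffineBasis.coord_reindex]
    exact exists_congr fun i => (swall (fun k => 0 ≤ (C.V i).coord k y)).symm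
  hγ := by rw [(swA C.T).2.2]; exact C.hγ
  hlt m := by rw [(swA C.T).2.2]; exact C.hlt m

theorem HI.swap {C : Cfg N} (h : C.HI) : C.swap.HI := by
  intro x y hxy
  have h1 : C.swap.α = C.β := (swA C.T).1
  have h2 : C.swap.β = C.α := (swA C.T).2.1
  rw [h1, h2] at hxy
  exact (h y x (by linarith)).symm

def On (t : Fin N) : Prop := C.B.coord 1 (C.V t 0) = 0 ∧ C.B.coord 1 (C.V t 1) = 0

theorem two_of_lt (hHI : C.HI) (hab : C.L 1 < C.L 0) : ∃ i j, i ≠ j ∧ C.On i ∧ C.On j := by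
  by_contra hc
  push Not at hc
  obtain ⟨e, he, h2⟩ := (C.side_pig 1).1
  have on : ∀ e ∈ C.sideI 1, e.2 = 2 → C.On e.1 := by
    intro e he h2
    have := C.mem_sideI.1 he
    rw [h2] at this
    exact this
  have : C.Uq 1 e.1 := by
    refine ⟨?_, ?_⟩
    · rw [← h2]; exact he
    · intro e1 g1 e2 g2 k1 k2
      by_contra hne
      refine hc e1.1 e2.1 ?_ (on _ g1 k1) (on _ g2 k2)
      intro h
      exact hne (Prod.ext h (k1.trans k2.symm))
  exact this.false hHI hab

theorem two (hHI : C.HI) : ∃ i j, i ≠ j ∧ C.On i ∧ C.On j := by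
  rcases lt_or_gt_of_ne (C.L01 hHI) with h | h
  · have h' : C.swap.L 1 < C.swap.L 0 := by
      have e1 : C.swap.L 1 = C.L 0 := dist_comm _ _
      have e0 : C.swap.L 0 = C.L 1 := dist_comm _ _
      rw [e1, e0]; exact h
    obtain ⟨i, j, hij, hi, hj⟩ := C.swap.two_of_lt hHI.swap h'
    exact ⟨i, j, hij, ⟨hi.2, hi.1⟩, ⟨hj.2, hj.1⟩⟩
  · exact C.two_of_lt hHI h

end Cfg
end Part12

/-- Suppose triangle `ABC` is `N`-tiled by a tile with angles `(α, β, γ)` such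
that `γ > π/2`, `α` is not a rational multiple of `π`, and every interior
angle of `ABC` is less than `γ`.  Then at least two tiles have their side of
length `c` contained in the side `AC` of `ABC`. -/
theorem two_c_edges_on_side (N : ℕ) (ABC T : Tri)
    (hABC : IsTriangle ABC) (hT : IsTriangle T)
    (α β γ : ℝ) (hangles : HasAngles T α β γ)
    (hγ : π / 2 < γ)
    (hirr : ¬ ∃ q : ℚ, α = (q : ℝ) * π)
    (hlt : ∀ m : Fin 3, triAngle ABC m < γ)
    (tiles : Fin N → Tri) (ht : IsTiling N ABC T tiles) :
    ∃ i j : Fin N, i ≠ j ∧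
      (∃ k l : Fin 3, k ≠ l ∧ dist (tiles i k) (tiles i l) = sideLen T 2 ∧
        segment ℝ (tiles i k) (tiles i l) ⊆ segment ℝ (ABC 0) (ABC 2)) ∧
      (∃ k l : Fin 3, k ≠ l ∧ dist (tiles j k) (tiles j l) = sideLen T 2 ∧
        segment ℝ (tiles j k) (tiles j l) ⊆ segment ℝ (ABC 0) (ABC 2)) := by
  choose σ hσ using ht.congr
  obtain ⟨ha1, -, ha3⟩ := hangles
  have hV : ∀ i, IsTriangle (tiles i ∘ (σ i).symm) := fun i => indep_of_dist hT (fun k l => by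
    have := hσ i ((σ i).symm k) ((σ i).symm l)
    simpa using this)
  have hset : ∀ i, triSet (mkAB _ (hV i)) = triSet (tiles i) := fun i => triSet_perm _ _
  let C : Cfg N :=
    { B := mkAB ABC hABC
      T := mkAB T hT
      V := fun i => mkAB _ (hV i)
      hd := fun i k l => by
        have := hσ i ((σ i).symm k) ((σ i).symm l)
        simpa [mkAB_apply] using this
      disj := fun i j hij y h1 h2 => by
        rw [← mem_int_triSet, hset] at h1 h2
        have := ht.disj i j hij
        have h3 : y ∈ interior (triSet (tiles i)) ∩ interior (triSet (tiles j)) := ⟨h1, h2⟩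
        rw [this] at h3
        exact h3
      cov := fun y => by
        simp only [← mem_triSet_s15, hset]
        have := ht.cover
        have h2 : triSet (mkAB ABC hABC) = triSet ABC := rfl
        rw [h2, ← this, Set.mem_iUnion]
      hγ := by rw [← ha3] at hγ; exact hγ
      hlt := fun m => by rw [← ha3] at hlt; exact hlt m }
  have hHI : C.HI := C.HI_of_irr (by rw [← ha1] at hirr; exact hirr)
  have key : ∀ t, C.On t → ∃ k l : Fin 3, k ≠ l ∧ dist (tiles t k) (tiles t l) = sideLen T 2 ∧
        segment ℝ (tiles t k) (tiles t l) ⊆ segment ℝ (ABC 0) (ABC 2) := by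
    intro t h
    refine ⟨(σ t).symm 0, (σ t).symm 1, ?_, ?_, ?_⟩
    · intro h; exact absurd ((σ t).symm.injective h) (by decide)
    · exact C.dV t 2
    · refine (convex_segment _ _).segment_subset ?_ ?_
      · exact mem_seg C.B (fun k => C.vB t 0 k) h.1
      · exact mem_seg C.B (fun k => C.vB t 1 k) h.2
  obtain ⟨i, j, hij, hi, hj⟩ := C.two hHI
  exact ⟨i, j, hij, key i hi, key j hj⟩
end
end
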